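/- ∫_{(0,∞)³} [ (1+x+y+z)(1+1/x+1/y+1/z) − 1 ]^{−1} dx dy dz/(xyz) = (π³/√15) · ( 1 + 2·∑_{n≥1} e^{−n²π√(5/3)} )² · ( 1 + 2·∑_{n≥1} e^{−n²π√15} )². -/

import Mathlib

open MeasureTheory

namespace Banana

/-- The Gaussian weight `exp (-π y u² / 4)`. -/
noncomputable def gw (y : ℝ) (u : ℤ) : ℝ := Real.exp (-Real.pi * y * (u:ℝ)^2 / 4)

/-- Sum of Gaussian weights twisted by `χ`. -/
noncomputable def thetaTw (χ : ℤ → ℝ) (y : ℝ) : ℝ := ∑' u : ℤ, χ u * gw y u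

/-- Binary version of `thetaTw`. -/
noncomputable def thetaTw₂ (ψ : ℤ × ℤ → ℝ) (y z : ℝ) : ℝ :=
  ∑' p : ℤ × ℤ, ψ p * (gw y p.1 * gw z p.2)

def chi2 (u : ℤ) : ℝ := if u % 2 = 1 then 1 else 0
def chi3 (u : ℤ) : ℝ := if u % 2 = 0 then 1 else 0
def chi4 (u : ℤ) : ℝ := if u % 4 = 0 then 1 else if u % 4 = 2 then -1 else 0

noncomputable def th2 (y : ℝ) : ℝ := thetaTw chi2 y
noncomputable def th3 (y : ℝ) : ℝ := thetaTw chi3 y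
noncomputable def th4 (y : ℝ) : ℝ := thetaTw chi4 y

lemma gw_pos (y : ℝ) (u : ℤ) : 0 < gw y u := Real.exp_pos _

lemma summable_gw {y : ℝ} (hy : 0 < y) : Summable (gw y) := by
  have h := (summable_jacobiTheta₂_term_iff 0 (Complex.I * (y/4:ℝ))).2 (by simp; positivity)
  have h2 := h.norm
  refine h2.congr fun n => ?_
  rw [norm_jacobiTheta₂_term]
  simp [gw]
  ring

lemma abs_chi2_le (u : ℤ) : |chi2 u| ≤ 1 := by unfold chi2; split_ifs <;> simp
lemma abs_chi3_le (u : ℤ) : |chi3 u| ≤ 1 := by unfold chi3; split_ifs <;> simp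
lemma abs_chi4_le (u : ℤ) : |chi4 u| ≤ 1 := by unfold chi4; split_ifs <;> simp

lemma summable_tw {χ : ℤ → ℝ} (hχ : ∀ u, |χ u| ≤ 1) {y : ℝ} (hy : 0 < y) :
    Summable fun u => χ u * gw y u := by
  refine Summable.of_norm_bounded (summable_gw hy) fun u => ?_
  rw [norm_mul, Real.norm_eq_abs, Real.norm_of_nonneg (gw_pos y u).le]
  exact mul_le_of_le_one_left (gw_pos y u).le (hχ u)

lemma summable_gw₂ {y z : ℝ} (hy : 0 < y) (hz : 0 < z) :
    Summable fun p : ℤ × ℤ => gw y p.1 * gw z p.2 :=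
  (summable_gw hy).mul_of_nonneg (summable_gw hz) (fun u => (gw_pos y u).le)
    (fun u => (gw_pos z u).le)

lemma summable_tw₂ {ψ : ℤ × ℤ → ℝ} {C : ℝ} (hψ : ∀ u, |ψ u| ≤ C) {y z : ℝ} (hy : 0 < y)
    (hz : 0 < z) : Summable fun p => ψ p * (gw y p.1 * gw z p.2) := by
  refine Summable.of_norm_bounded ((summable_gw₂ hy hz).mul_left C) fun u => ?_
  have h := (mul_pos (gw_pos y u.1) (gw_pos z u.2)).le
  rw [norm_mul, Real.norm_eq_abs, Real.norm_of_nonneg h]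
  exact mul_le_mul_of_nonneg_right (hψ u) h

lemma thetaTw_mul {χ χ' : ℤ → ℝ} (hχ : ∀ u, |χ u| ≤ 1) (hχ' : ∀ u, |χ' u| ≤ 1) {y z : ℝ}
    (hy : 0 < y) (hz : 0 < z) :
    thetaTw χ y * thetaTw χ' z = thetaTw₂ (fun p => χ p.1 * χ' p.2) y z := by
  unfold thetaTw thetaTw₂
  rw [(summable_tw hχ hy).tsum_mul_tsum (summable_tw hχ' hz)]
  · exact tsum_congr fun p => by ring
  · refine (summable_tw₂ (ψ := fun p => χ p.1 * χ' p.2) (C := 1) ?_ hy hz).congr fun p => by ring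
    intro p
    rw [abs_mul]
    exact mul_le_one₀ (hχ _) (abs_nonneg _) (hχ' _)

lemma thetaTw₂_add {ψ ψ' : ℤ × ℤ → ℝ} {C C' : ℝ} (hψ : ∀ u, |ψ u| ≤ C) (hψ' : ∀ u, |ψ' u| ≤ C')
    {y z : ℝ} (hy : 0 < y) (hz : 0 < z) :
    thetaTw₂ ψ y z + thetaTw₂ ψ' y z = thetaTw₂ (fun p => ψ p + ψ' p) y z := by
  unfold thetaTw₂
  rw [← (summable_tw₂ hψ hy hz).tsum_add (summable_tw₂ hψ' hy hz)]
  exact tsum_congr fun p => by ring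

lemma thetaTw₂_const_mul (c : ℝ) (ψ : ℤ × ℤ → ℝ) (y z : ℝ) :
    c * thetaTw₂ ψ y z = thetaTw₂ (fun p => c * ψ p) y z := by
  unfold thetaTw₂
  rw [← tsum_mul_left]
  exact tsum_congr fun p => by ring

/-- Equality of two binary sums having a common injective parametrization. -/
lemma thetaTw₂_reindex (φ φ' g g' : ℤ × ℤ → ℤ × ℤ) (hφ : Function.Injective φ)
    (hφ' : Function.Injective φ') {ψ ψ' : ℤ × ℤ → ℝ}
    (hs : ∀ p, ψ p ≠ 0 → φ (g p) = p) (hs' : ∀ p, ψ' p ≠ 0 → φ' (g' p) = p)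
    (hψ : ∀ p, ψ (φ p) = ψ' (φ' p)) {y z y' z' : ℝ}
    (hQ : ∀ p : ℤ × ℤ, y * ((φ p).1:ℝ)^2 + z * ((φ p).2:ℝ)^2 =
      y' * ((φ' p).1:ℝ)^2 + z' * ((φ' p).2:ℝ)^2) :
    thetaTw₂ ψ y z = thetaTw₂ ψ' y' z' := by
  unfold thetaTw₂
  rw [← hφ.tsum_eq (f := fun p => ψ p * (gw y p.1 * gw z p.2)),
    ← hφ'.tsum_eq (f := fun p => ψ' p * (gw y' p.1 * gw z' p.2))]
  · refine tsum_congr fun p => ?_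
    rw [hψ, gw, gw, gw, gw, ← Real.exp_add, ← Real.exp_add]
    congr 2
    linear_combination (-Real.pi/4) * hQ p
  · intro p hp
    exact ⟨_, hs' p fun h => hp (by simp [h])⟩
  · intro p hp
    exact ⟨_, hs p fun h => hp (by simp [h])⟩

lemma abs_prod_le {χ χ' : ℤ → ℝ} (hχ : ∀ u, |χ u| ≤ 1) (hχ' : ∀ u, |χ' u| ≤ 1) (p : ℤ × ℤ) :
    |χ p.1 * χ' p.2| ≤ 1 := by
  rw [abs_mul]
  exact mul_le_one₀ (hχ _) (abs_nonneg _) (hχ' _)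

/-- `θ₃θ₃ + θ₂θ₂` is the sum over congruent pairs. -/
lemma th3_mul_add_th2_mul {y z : ℝ} (hy : 0 < y) (hz : 0 < z) :
    th3 y * th3 z + th2 y * th2 z =
      thetaTw₂ (fun p => if (p.1 + p.2) % 2 = 0 then 1 else 0) y z := by
  rw [th3, th2, th3, th2, thetaTw_mul abs_chi3_le abs_chi3_le hy hz,
    thetaTw_mul abs_chi2_le abs_chi2_le hy hz,
    thetaTw₂_add (abs_prod_le abs_chi3_le abs_chi3_le) (abs_prod_le abs_chi2_le abs_chi2_le) hy hz]
  congr 1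
  ext p
  unfold chi3 chi2
  split_ifs <;> first | omega | simp

lemma thetaTw₂_reindex_sq {ψ ψ' : ℤ × ℤ → ℝ} (hs : ∀ p, ψ p ≠ 0 → p.1 % 2 = 0 ∧ p.2 % 2 = 0)
    (hs' : ∀ p, ψ' p ≠ 0 → (p.1 + p.2) % 2 = 0)
    (hψ : ∀ m n, ψ (2*m, 2*n) = ψ' (m+n, m-n)) (y : ℝ) :
    thetaTw₂ ψ y y = thetaTw₂ ψ' (2*y) (2*y) := by
  refine thetaTw₂_reindex (fun p => (2*p.1, 2*p.2)) (fun p => (p.1+p.2, p.1-p.2))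
    (fun p => (p.1/2, p.2/2)) (fun p => ((p.1+p.2)/2, (p.1-p.2)/2)) ?_ ?_ ?_ ?_
    (fun p => hψ _ _) ?_
  · rintro ⟨a, b⟩ ⟨c, d⟩ h
    simp only [Prod.mk.injEq] at h ⊢
    omega
  · rintro ⟨a, b⟩ ⟨c, d⟩ h
    simp only [Prod.mk.injEq] at h ⊢
    omega
  · rintro ⟨a, b⟩ h
    have := hs _ h
    simp only [Prod.mk.injEq] at this ⊢
    omega
  · rintro ⟨a, b⟩ h
    have := hs' _ h
    simp only [Prod.mk.injEq] at this ⊢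
    omega
  · intro p
    push_cast
    ring

lemma th3_sq {y : ℝ} (hy : 0 < y) : th3 y ^ 2 = th3 (2*y)^2 + th2 (2*y)^2 := by
  have h2 : 0 < 2 * y := by positivity
  rw [sq, sq, sq, th3_mul_add_th2_mul h2 h2, th3, thetaTw_mul abs_chi3_le abs_chi3_le hy hy]
  refine thetaTw₂_reindex_sq ?_ ?_ ?_ y
  · intro p
    simp only [chi3]
    split_ifs <;> simp [*]
  · intro p
    simp
  · intro m n
    simp [chi3]
    omega

lemma th4_sq {y : ℝ} (hy : 0 < y) : th4 y ^ 2 = th3 (2*y)^2 - th2 (2*y)^2 := by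
  have h2 : 0 < 2 * y := by positivity
  have hneg : -th2 (2*y)^2 = (-1) * (th2 (2*y) * th2 (2*y)) := by ring
  rw [sub_eq_add_neg, hneg, sq, sq, th4, th3, th2, thetaTw_mul abs_chi4_le abs_chi4_le hy hy,
    thetaTw_mul abs_chi3_le abs_chi3_le h2 h2, thetaTw_mul abs_chi2_le abs_chi2_le h2 h2,
    thetaTw₂_const_mul, thetaTw₂_add (C' := 1) (abs_prod_le abs_chi3_le abs_chi3_le) _ h2 h2]
  rotate_left
  · intro p
    rw [neg_one_mul, abs_neg]
    exact abs_prod_le abs_chi2_le abs_chi2_le p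
  refine thetaTw₂_reindex_sq ?_ ?_ ?_ y
  · intro p
    simp only [chi4]
    split_ifs <;> first | omega | simp
  · intro p
    simp only [chi2, chi3]
    split_ifs <;> first | omega | simp
  · intro m n
    simp only [chi2, chi3, chi4]
    split_ifs <;> first | omega | simp

lemma th2_sq {y : ℝ} (hy : 0 < y) : th2 y ^ 2 = 2 * th2 (2*y) * th3 (2*y) := by
  have h2 : 0 < 2 * y := by positivity
  have : 2 * th2 (2*y) * th3 (2*y) = th2 (2*y) * th3 (2*y) + th3 (2*y) * th2 (2*y) := by ring
  rw [this, sq, th2, th2, th3, thetaTw_mul abs_chi2_le abs_chi2_le hy hy,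
    thetaTw_mul abs_chi2_le abs_chi3_le h2 h2, thetaTw_mul abs_chi3_le abs_chi2_le h2 h2,
    thetaTw₂_add (abs_prod_le abs_chi2_le abs_chi3_le) (abs_prod_le abs_chi3_le abs_chi2_le) h2 h2]
  refine thetaTw₂_reindex (fun p => (p.1+p.2, p.1-p.2)) (fun p => p)
    (fun p => ((p.1+p.2)/2, (p.1-p.2)/2)) (fun p => p) ?_ (fun _ _ h => h) ?_ (fun _ _ => rfl) ?_ ?_
  · rintro ⟨a, b⟩ ⟨c, d⟩ h
    simp only [Prod.mk.injEq] at h ⊢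
    omega
  · rintro ⟨a, b⟩
    simp only [chi2, Prod.mk.injEq]
    split_ifs <;> first | omega | simp
  · rintro ⟨a, b⟩
    simp only [chi2, chi3]
    split_ifs <;> first | omega | simp
  · intro p
    push_cast
    ring

/-- `θ₂θ₂` is twice the sum over odd pairs with `u ≡ -v (mod 4)`. -/
lemma th2_mul {y z : ℝ} (hy : 0 < y) (hz : 0 < z) :
    th2 y * th2 z =
      thetaTw₂ (fun p => if p.1 % 2 = 1 ∧ (p.1 + p.2) % 4 = 0 then 2 else 0) y z := by
  have h1 : thetaTw₂ (fun p => if p.1 % 2 = 1 ∧ (p.1 + p.2) % 4 = 0 then (1:ℝ) else 0) y z =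
      thetaTw₂ (fun p => if p.1 % 2 = 1 ∧ (p.1 - p.2) % 4 = 0 then (1:ℝ) else 0) y z := by
    refine thetaTw₂_reindex (fun p => (p.1, p.2)) (fun p => (p.1, -p.2)) (fun p => p)
      (fun p => (p.1, -p.2)) (fun _ _ h => h) ?_ (fun _ _ => rfl) ?_ ?_ ?_
    · rintro ⟨a, b⟩ ⟨c, d⟩ h
      simpa using h
    · simp
    · rintro ⟨a, b⟩
      simp
    · intro p
      push_cast
      ring
  have h2 : thetaTw₂ (fun p => if p.1 % 2 = 1 ∧ (p.1 + p.2) % 4 = 0 then (2:ℝ) else 0) y z =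
      2 * thetaTw₂ (fun p => if p.1 % 2 = 1 ∧ (p.1 + p.2) % 4 = 0 then (1:ℝ) else 0) y z := by
    rw [thetaTw₂_const_mul]
    congr 1
    ext p
    split_ifs <;> simp
  rw [h2, two_mul]
  nth_rw 2 [h1]
  rw [th2, th2, thetaTw_mul abs_chi2_le abs_chi2_le hy hz,
    thetaTw₂_add (C := 1) (C' := 1) _ _ hy hz]
  · congr 1
    ext p
    simp only [chi2]
    split_ifs <;> first | omega | simp
  · intro p
    split_ifs <;> simp
  · intro p
    split_ifs <;> simp

/-- The cubic modular equation. -/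
lemma th3_mul_three {y : ℝ} (hy : 0 < y) :
    th3 y * th3 (3*y) = th4 y * th4 (3*y) + th2 y * th2 (3*y) := by
  have h3 : 0 < 3 * y := by positivity
  have : th3 y * th3 (3*y) + (-1) * (th4 y * th4 (3*y)) = th2 y * th2 (3*y) := by
    rw [th2_mul hy h3, th3, th4, th3, th4, thetaTw_mul abs_chi3_le abs_chi3_le hy h3,
      thetaTw_mul abs_chi4_le abs_chi4_le hy h3, thetaTw₂_const_mul,
      thetaTw₂_add (C' := 1) (abs_prod_le abs_chi3_le abs_chi3_le) _ hy h3]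
    rotate_left
    · intro p
      rw [neg_one_mul, abs_neg]
      exact abs_prod_le abs_chi4_le abs_chi4_le p
    refine thetaTw₂_reindex (fun p => (2*p.1, 2*p.2)) (fun p => (p.1+3*p.2, p.2-p.1))
      (fun p => (p.1/2, p.2/2)) (fun p => ((p.1-3*p.2)/4, (p.1+p.2)/4)) ?_ ?_ ?_ ?_ ?_ ?_
    · rintro ⟨a, b⟩ ⟨c, d⟩ h
      simp only [Prod.mk.injEq] at h ⊢
      omega
    · rintro ⟨a, b⟩ ⟨c, d⟩ h
      simp only [Prod.mk.injEq] at h ⊢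
      omega
    · rintro ⟨a, b⟩
      simp only [chi4, chi3, Prod.mk.injEq]
      split_ifs <;> first | omega | simp
    · rintro ⟨a, b⟩
      simp only [Prod.mk.injEq]
      split_ifs <;> first | omega | simp
    · rintro ⟨a, b⟩
      simp only [chi4, chi3]
      split_ifs <;> first | omega | (simp; done) | norm_num
    · intro p
      push_cast
      ring
  linarith

lemma sum_three_th {y z : ℝ} (hy : 0 < y) (hz : 0 < z) :
    th3 y * th3 z + th4 y * th4 z + th2 y * th2 z =
      2 * thetaTw₂ (fun p => if (p.1 + p.2) % 4 = 0 then 1 else 0) y z := by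
  rw [th2_mul hy hz, th3, th4, th3, th4, thetaTw_mul abs_chi3_le abs_chi3_le hy hz,
    thetaTw_mul abs_chi4_le abs_chi4_le hy hz,
    thetaTw₂_add (abs_prod_le abs_chi3_le abs_chi3_le) (abs_prod_le abs_chi4_le abs_chi4_le) hy hz,
    thetaTw₂_add (C := 2) (C' := 2) _ _ hy hz, thetaTw₂_const_mul]
  · congr 1
    ext p
    simp only [chi4, chi3]
    split_ifs <;> first | omega | (simp; done) | norm_num
  · intro p
    refine (abs_add_le _ _).trans ?_
    have := abs_prod_le abs_chi3_le abs_chi3_le p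
    have := abs_prod_le abs_chi4_le abs_chi4_le p
    linarith
  · intro p
    split_ifs <;> simp

lemma sum_three_th_fifteen {y : ℝ} (hy : 0 < y) :
    th3 y * th3 (15*y) + th4 y * th4 (15*y) + th2 y * th2 (15*y) =
      2 * (th3 (6*y) * th3 (10*y) + th2 (6*y) * th2 (10*y)) := by
  rw [sum_three_th hy (by positivity), th3_mul_add_th2_mul (by positivity) (by positivity)]
  congr 1
  refine thetaTw₂_reindex (fun p => (4*p.1-p.2, p.2)) (fun p => (p.2+p.1, p.2-p.1))
      (fun p => ((p.1+p.2)/4, p.2)) (fun p => ((p.1-p.2)/2, (p.1+p.2)/2)) ?_ ?_ ?_ ?_ ?_ ?_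
  · rintro ⟨a, b⟩ ⟨c, d⟩ h
    simp only [Prod.mk.injEq] at h ⊢
    omega
  · rintro ⟨a, b⟩ ⟨c, d⟩ h
    simp only [Prod.mk.injEq] at h ⊢
    omega
  · rintro ⟨a, b⟩
    simp only [Prod.mk.injEq]
    split_ifs <;> simp
    omega
  · rintro ⟨a, b⟩
    simp only [Prod.mk.injEq]
    split_ifs <;> first | omega | simp
  · rintro ⟨a, b⟩
    split_ifs <;> first | omega | simp
  · intro p
    push_cast
    ring

lemma sum_three_th_three_five {y : ℝ} (hy : 0 < y) :
    th3 (3*y) * th3 (5*y) + th4 (3*y) * th4 (5*y) + th2 (3*y) * th2 (5*y) =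
      2 * (th3 (2*y) * th3 (30*y) + th2 (2*y) * th2 (30*y)) := by
  rw [sum_three_th (by positivity) (by positivity),
    th3_mul_add_th2_mul (by positivity) (by positivity)]
  congr 1
  refine thetaTw₂_reindex (fun p => (4*p.1-p.2, p.2)) (fun p => (2*p.2-3*p.1, -p.1))
      (fun p => ((p.1+p.2)/4, p.2)) (fun p => (-p.2, (p.1-3*p.2)/2)) ?_ ?_ ?_ ?_ ?_ ?_
  · rintro ⟨a, b⟩ ⟨c, d⟩ h
    simp only [Prod.mk.injEq] at h ⊢
    omega
  · rintro ⟨a, b⟩ ⟨c, d⟩ h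
    simp only [Prod.mk.injEq] at h ⊢
    omega
  · rintro ⟨a, b⟩
    simp only [Prod.mk.injEq]
    split_ifs <;> simp
    omega
  · rintro ⟨a, b⟩
    simp only [Prod.mk.injEq]
    split_ifs <;> first | omega | simp
  · rintro ⟨a, b⟩
    split_ifs <;> first | omega | simp
  · intro p
    push_cast
    ring

lemma th3_eq_tsum (y : ℝ) : th3 y = ∑' n : ℤ, Real.exp (-Real.pi * y * (n:ℝ)^2) := by
  have hinj : Function.Injective fun n : ℤ => 2 * n := fun a b h => by simpa using h
  rw [th3, thetaTw, ← hinj.tsum_eq]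
  · refine tsum_congr fun n => ?_
    simp [chi3, gw]
    ring
  · intro u hu
    simp only [chi3, Function.mem_support] at hu
    refine ⟨u/2, ?_⟩
    by_contra h
    apply hu
    rw [if_neg (by simp at h; omega)]
    simp

lemma th4_eq_tsum (y : ℝ) :
    th4 y = ∑' n : ℤ, (if n % 2 = 0 then 1 else -1) * Real.exp (-Real.pi * y * (n:ℝ)^2) := by
  have hinj : Function.Injective fun n : ℤ => 2 * n := fun a b h => by simpa using h
  rw [th4, thetaTw, ← hinj.tsum_eq]
  · refine tsum_congr fun n => ?_
    simp only [chi4, gw]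
    congr 1
    · split_ifs <;> first | omega | rfl
    · push_cast
      congr 1
      ring
  · intro u hu
    simp only [chi4, Function.mem_support] at hu
    refine ⟨u/2, ?_⟩
    by_contra h
    apply hu
    simp only at h
    rw [if_neg (by omega), if_neg (by omega)]
    simp

lemma th2_eq_tsum (y : ℝ) : th2 y = ∑' n : ℤ, Real.exp (-Real.pi * y * ((n:ℝ)-1/2)^2) := by
  have hinj : Function.Injective fun n : ℤ => 2 * n - 1 := fun a b h => by
    simp only at h
    omega
  rw [th2, thetaTw, ← hinj.tsum_eq]
  · refine tsum_congr fun n => ?_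
    simp only [chi2, gw]
    rw [if_pos (by omega), one_mul]
    push_cast
    congr 1
    ring
  · intro u hu
    simp only [chi2, Function.mem_support] at hu
    refine ⟨(u+1)/2, ?_⟩
    by_contra h
    apply hu
    simp only at h
    rw [if_neg (by omega)]
    simp

lemma th3_inv {y : ℝ} (hy : 0 < y) : th3 (1/y) = √y * th3 y := by
  rw [th3_eq_tsum, th3_eq_tsum, Real.tsum_exp_neg_mul_int_sq (by positivity : 0 < 1/y),
    ← Real.sqrt_eq_rpow, Real.sqrt_div zero_le_one]
  simp

lemma th2_inv {y : ℝ} (hy : 0 < y) : th2 (1/y) = √y * th4 y := by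
  have h := Complex.tsum_exp_neg_quadratic (a := (y:ℂ)) (by simpa using hy) (Complex.I / 2)
  have e1 : ∀ n : ℤ, Complex.exp (-↑Real.pi * (y:ℂ) * ↑n ^ 2 + 2 * ↑Real.pi * (Complex.I / 2) * ↑n) =
      (((if n % 2 = 0 then 1 else -1) * Real.exp (-Real.pi * y * (n:ℝ)^2) : ℝ) : ℂ) := by
    intro n
    rw [Complex.exp_add, mul_comm, Complex.ofReal_mul]
    congr 1
    · have : 2 * ↑Real.pi * (Complex.I / 2) * (n:ℂ) = n * (Real.pi * Complex.I) := by ring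
      rw [this, Complex.exp_int_mul, Complex.exp_pi_mul_I]
      split_ifs with h
      · rw [Even.neg_one_zpow (Int.even_iff.2 h)]
        simp
      · rw [Odd.neg_one_zpow (Int.odd_iff.2 (by omega))]
        simp
    · push_cast
      ring_nf
  have e2 : ∀ n : ℤ, Complex.exp (-↑Real.pi / (y:ℂ) * (↑n + Complex.I * (Complex.I / 2)) ^ 2) =
      ((Real.exp (-Real.pi * (1/y) * ((n:ℝ)-1/2)^2) : ℝ) : ℂ) := by
    intro n
    push_cast
    congr 1
    rw [show Complex.I * (Complex.I / 2) = -(1/2) by linear_combination Complex.I_mul_I / 2]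
    ring
  simp_rw [e1, e2] at h
  have e3 : (y:ℂ) ^ (1/2:ℂ) = ((√y : ℝ) : ℂ) := by
    rw [Real.sqrt_eq_rpow, Complex.ofReal_cpow hy.le]
    push_cast
    rfl
  rw [e3, ← Complex.ofReal_tsum, ← Complex.ofReal_tsum] at h
  rw [show (1:ℂ) / ((√y : ℝ) : ℂ) = ((1 / √y : ℝ) : ℂ) by push_cast; rfl, ← Complex.ofReal_mul,
    Complex.ofReal_inj] at h
  rw [th2_eq_tsum, th4_eq_tsum, h]
  have : √y ≠ 0 := by positivity
  rw [← mul_assoc, mul_one_div_cancel this, one_mul]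

lemma th4_inv {y : ℝ} (hy : 0 < y) : th4 (1/y) = √y * th2 y := by
  have h := th2_inv (one_div_pos.2 hy)
  rw [one_div_one_div, Real.sqrt_div zero_le_one] at h
  have : √y ≠ 0 := by positivity
  rw [h]
  simp
  field_simp

lemma tsum_int_of_even {f : ℤ → ℝ} (hf : Summable f) (he : ∀ n, f (-n) = f n) :
    ∑' n, f n = f 0 + 2 * ∑' n : ℕ, f ((n:ℤ)+1) := by
  have h := hf.comp_injective (i := fun n : ℕ => (n:ℤ)+1) (fun a b h => by simpa using h)
  have h' : (fun n : ℕ => f (-((n:ℤ)+1))) = fun n : ℕ => f ((n:ℤ)+1) := by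
    ext n
    exact he _
  rw [tsum_of_add_one_of_neg_add_one h, h']
  · ring
  · rw [h']
    exact h

lemma summable_exp_sq {y : ℝ} (hy : 0 < y) :
    Summable fun n : ℤ => Real.exp (-Real.pi * y * (n:ℝ)^2) := by
  have hinj : Function.Injective fun n : ℤ => 2 * n := fun a b h => by simpa using h
  refine ((summable_gw hy).comp_injective hinj).congr fun n => ?_
  simp [gw]
  ring

lemma th3_eq_nat {y : ℝ} (hy : 0 < y) :
    th3 y = 1 + 2 * ∑' n : ℕ, Real.exp (-((n:ℝ)+1)^2 * Real.pi * y) := by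
  rw [th3_eq_tsum, tsum_int_of_even (summable_exp_sq hy) (by simp)]
  simp
  exact tsum_congr fun n => by congr 1; ring

lemma exp_sq_le {y : ℝ} (hy : 0 < y) (n : ℕ) :
    Real.exp (-Real.pi * y * (((n:ℤ)+1:ℤ):ℝ)^2) ≤
      Real.exp (-Real.pi * y) * Real.exp (-Real.pi * y) ^ n := by
  rw [← Real.exp_nat_mul, ← Real.exp_add, Real.exp_le_exp]
  push_cast
  have : 0 < Real.pi * y := by positivity
  have h2 : 0 ≤ Real.pi * y * (n * (n + 1)) := by positivity
  linarith

/-- A twisted sum differs from `1` by at most `2 q / (1 - q)`, `q = exp (-π y)`. -/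
lemma abs_tsum_exp_sq_sub_one_le {y : ℝ} (hy : 0 < y) (ε : ℤ → ℝ) (hε : ∀ n, |ε n| ≤ 1)
    (h0 : ε 0 = 1) (he : ∀ n, ε (-n) = ε n) {q : ℝ} (hq : Real.exp (-Real.pi * y) ≤ q)
    (hq1 : q < 1) :
    |∑' n : ℤ, ε n * Real.exp (-Real.pi * y * (n:ℝ)^2) - 1| ≤ 2 * q / (1 - q) := by
  have hb : ∀ n : ℤ, ‖ε n * Real.exp (-Real.pi * y * (n:ℝ)^2)‖ ≤
      Real.exp (-Real.pi * y * (n:ℝ)^2) := by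
    intro n
    rw [norm_mul, Real.norm_eq_abs, Real.norm_of_nonneg (Real.exp_pos _).le]
    exact mul_le_of_le_one_left (Real.exp_pos _).le (hε n)
  rw [tsum_int_of_even (.of_norm_bounded (summable_exp_sq hy) hb) (by simp [he])]
  have hq0 : 0 < q := (Real.exp_pos _).trans_le hq
  have hs : HasSum (fun n : ℕ => q * q ^ n) (q * (1 - q)⁻¹) :=
    (hasSum_geometric_of_lt_one hq0.le hq1).mul_left q
  have := tsum_of_norm_bounded hs (f := fun n : ℕ => ε ((n:ℤ)+1) *
    Real.exp (-Real.pi * y * (((n:ℤ)+1:ℤ):ℝ)^2)) fun n => by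
      refine (hb _).trans ((exp_sq_le hy n).trans ?_)
      gcongr
  simp only [h0, Int.cast_zero]
  rw [Real.norm_eq_abs] at this
  rw [show (1:ℝ) * Real.exp (-Real.pi * y * 0 ^ 2) = 1 by simp, add_sub_cancel_left, abs_mul,
    abs_two, mul_div_assoc, div_eq_mul_inv]
  gcongr

lemma abs_th3_sub_one_le {y q : ℝ} (hy : 0 < y) (hq : Real.exp (-Real.pi * y) ≤ q)
    (hq1 : q < 1) : |th3 y - 1| ≤ 2 * q / (1 - q) := by
  have := abs_tsum_exp_sq_sub_one_le hy (fun _ => 1) (by simp) rfl (by simp) hq hq1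
  simpa [th3_eq_tsum] using this

lemma abs_th4_sub_one_le {y q : ℝ} (hy : 0 < y) (hq : Real.exp (-Real.pi * y) ≤ q)
    (hq1 : q < 1) : |th4 y - 1| ≤ 2 * q / (1 - q) := by
  rw [th4_eq_tsum]
  refine abs_tsum_exp_sq_sub_one_le hy (fun n => if n % 2 = 0 then 1 else -1) ?_ (by simp) ?_ hq hq1
  · intro n
    split_ifs <;> simp
  · intro n
    simp

lemma exp_neg_pi_le {y : ℝ} {k : ℕ} (hy : (k:ℝ) ≤ y) :
    Real.exp (-Real.pi * y) ≤ (1/8) ^ k := by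
  have h1 : Real.exp (-Real.pi * y) ≤ Real.exp (-3) ^ k := by
    rw [← Real.exp_nat_mul, Real.exp_le_exp]
    have := Real.pi_gt_three
    nlinarith [(Nat.cast_nonneg k : (0:ℝ) ≤ k)]
  have h2 : Real.exp (-3) ≤ 1/8 := by
    rw [Real.exp_neg, one_div]
    apply inv_anti₀ (by norm_num)
    have : Real.exp 3 = Real.exp 1 ^ 3 := by rw [← Real.exp_nat_mul]; norm_num
    rw [this]
    have := Real.add_one_le_exp 1
    calc (8:ℝ) = 2 ^ 3 := by norm_num
      _ ≤ _ := by gcongr; linarith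
  exact h1.trans (by gcongr)

lemma th3_pos {y : ℝ} (hy : 0 < y) : 0 < th3 y := by
  rw [th3_eq_tsum]
  exact (summable_exp_sq hy).tsum_pos (fun _ => (Real.exp_pos _).le) 0 (Real.exp_pos _)

lemma th2_pos {y : ℝ} (hy : 0 < y) : 0 < th2 y :=
  (summable_tw abs_chi2_le hy).tsum_pos
    (fun u => mul_nonneg (by unfold chi2; split_ifs <;> simp) (gw_pos _ _).le) 1
    (mul_pos (by simp [chi2]) (gw_pos _ _))

lemma th4_pos {y : ℝ} (hy : 0 < y) : 0 < th4 y := by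
  have h := th4_inv (one_div_pos.2 hy)
  rw [one_div_one_div] at h
  rw [h]
  have := th2_pos (one_div_pos.2 hy)
  positivity

lemma th3_pow_four {y : ℝ} (hy : 0 < y) : th3 y ^ 4 = th2 y ^ 4 + th4 y ^ 4 := by
  have h3 := th3_sq hy
  have h4 := th4_sq hy
  have h2 := th2_sq hy
  rw [show th3 y ^ 4 = (th3 y ^ 2) ^ 2 by ring, show th2 y ^ 4 = (th2 y ^ 2) ^ 2 by ring,
    show th4 y ^ 4 = (th4 y ^ 2) ^ 2 by ring, h2, h3, h4]
  ring

/-- The product `(θ₃θ₃ + θ₂θ₂)(2/y, 2 y)` in terms of theta values at `y`. -/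
lemma th_mul_two_sq {y : ℝ} (hy : 0 < y) :
    (th3 (2*(1/y)) * th3 (2*y) + th2 (2*(1/y)) * th2 (2*y)) ^ 2 =
      y / 2 * (th3 y ^ 4 + 2 * th2 y ^ 2 * th4 y ^ 2) := by
  have hy' : 0 < 1/y := one_div_pos.2 hy
  have a1 := th3_sq hy
  have a2 := th4_sq hy
  have a3 := th2_sq hy
  have b1 := th3_sq hy'
  have b2 := th4_sq hy'
  have b3 := th2_sq hy'
  rw [th3_inv hy, mul_pow, Real.sq_sqrt hy.le] at b1
  rw [th4_inv hy, mul_pow, Real.sq_sqrt hy.le] at b2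
  rw [th2_inv hy, mul_pow, Real.sq_sqrt hy.le] at b3
  generalize th3 (2*(1/y)) = u3 at *
  generalize th2 (2*(1/y)) = u2 at *
  generalize th3 (2*y) = v3 at *
  generalize th2 (2*y) = v2 at *
  rw [show th3 y ^ 4 = (th3 y ^ 2) ^ 2 by ring]
  generalize th3 y ^ 2 = x3 at *
  generalize th2 y ^ 2 = x2 at *
  generalize th4 y ^ 2 = x4 at *
  subst a1 a2 a3
  linear_combination (-v3^2/2) * (b1 + b2) - v2^2/2 * (b1 - b2) - v2*v3*b3

/-- The solution of the system of modular equations of degrees `3` and `5`. -/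
lemma modular_system {p q P R X Y : ℝ} (hp : 0 < p) (hq : 0 < q) (hP : 0 < P) (hR : 0 < R)
    (h1 : P^4 = X * Y) (h2 : R^4 = (1-X)*(1-Y)) (h3 : p^4 = X*(1-X)) (h4 : q^4 = Y*(1-Y))
    (h5 : P + R = 1) (h6 : p*q = P*R)
    (h7 : (1+2*p)^2*(1+2*q)^2 = 4*(1+2*p^2)*(1+2*q^2)) :
    p*q = 1/16 ∧ (1-2*X)*(1-2*Y) = 33/64 := by
  obtain rfl : R = 1 - P := by linarith
  obtain ⟨x, hx, hxh⟩ : ∃ x : ℝ, 0 < x ∧ x^2 = p*q :=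
    ⟨√(p*q), by positivity, Real.sq_sqrt (by positivity)⟩
  have hx2 : x ≤ 1/2 := by nlinarith [sq_nonneg (2*P-1)]
  have hS : (p^2+q^2)^2 = (2*x*(1-2*x^2))^2 := by
    have e1 : X + Y = 1 + P^4 - (1-P)^4 := by linear_combination h2 - h1
    have e2 : (p^2+q^2)^2 = (X+Y) - (X+Y)^2 + 2*P^4 + 2*(p*q)^2 := by
      linear_combination h3 + h4 - 2 * h1
    rw [e2, e1, show (2*x*(1-2*x^2))^2 = 4*x^2*(1-2*x^2)^2 by ring, hxh, h6]
    ring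
  have hS' : p^2+q^2 = 2*x*(1-2*x^2) := by
    rw [sq_eq_sq₀] at hS
    · exact hS
    · positivity
    · have : 0 ≤ 1 - 2*x^2 := by nlinarith
      positivity
  have e3 : ((1+2*p)*(1+2*q))^2 = (2*(1+2*x-2*x^2))^2 := by
    rw [mul_pow, h7]
    linear_combination 8 * hS' - (16*(p*q + x^2)) * hxh
  have e4 : (1+2*p)*(1+2*q) = 2*(1+2*x-2*x^2) := by
    rw [sq_eq_sq₀] at e3
    · exact e3
    · positivity
    · nlinarith
  have e5 : 2*(p+q) = 1+4*x-8*x^2 := by linear_combination e4 + 4 * hxh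
  have e6 : (4*x-1)*(16*x^3-8*x^2-4*x-1) = 0 := by
    have : (2*(p+q))^2 = 4*(2*x*(1-2*x^2) + 2*x^2) := by
      linear_combination 4*hS' - 8*hxh
    rw [e5] at this
    linear_combination this
  have hx4 : x = 1/4 := by
    rcases mul_eq_zero.1 e6 with h | h
    · linarith
    · nlinarith [mul_nonneg (sq_nonneg x) (by linarith : 0 ≤ 1 - 2*x)]
  have h16 : p*q = 1/16 := by rw [← hxh, hx4]; norm_num
  refine ⟨h16, ?_⟩
  have hPR : P*(1-P) = 1/16 := by rw [← h6, h16]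
  have e7 : (1-2*X)*(1-2*Y) = -1 + 2*(P^4 + (1-P)^4) := by linear_combination -2*h1 - 2*h2
  have e8 : P^4 + (1-P)^4 = (1-2*(P*(1-P)))^2 - 2*(P*(1-P))^2 := by ring
  rw [e7, e8, hPR]
  norm_num

lemma theta_modular {a2 a3 a4 b2 b3 b4 : ℝ} (ha2 : 0 < a2) (ha3 : 0 < a3) (ha4 : 0 < a4)
    (hb2 : 0 < b2) (hb3 : 0 < b3) (hb4 : 0 < b4)
    (Ja : a3^4 = a2^4 + a4^4) (Jb : b3^4 = b2^4 + b4^4) (hc : a3*b3 = a4*b4 + a2*b2)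
    (E1 : 3*(b3^2 + 2*(b2*b4))^2 = 2*(a3^4 + 2*a2^2*a4^2))
    (E2 : (a3^2 + 2*(a2*a4))^2 = 6*(b3^4 + 2*b2^2*b4^2)) :
    a2*a4*(b2*b4) = a3^2*b3^2/16 ∧
      (a4^4-a2^4)*(b4^4-b2^4) = 33/64*(a3^4*b3^4) := by
  have hX : 1 - (a2/a3)^4 = (a4/a3)^4 := by
    field_simp
    linarith
  have hY : 1 - (b2/b3)^4 = (b4/b3)^4 := by
    field_simp
    linarith
  have key := modular_system (p := a2*a4/a3^2) (q := b2*b4/b3^2) (P := a2*b2/(a3*b3))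
    (R := a4*b4/(a3*b3)) (X := (a2/a3)^4) (Y := (b2/b3)^4) (by positivity) (by positivity)
    (by positivity) (by positivity) (by field_simp) (by rw [hX, hY]; field_simp)
    (by rw [hX]; field_simp) (by rw [hY]; field_simp) (by field_simp; linarith)
    (by field_simp) (by
      field_simp
      have h : 3*(b3^2 + 2*(b2*b4))^2 * (a3^2 + 2*(a2*a4))^2 =
        2*(a3^4 + 2*a2^2*a4^2) * (6*(b3^4 + 2*b2^2*b4^2)) := by rw [E1, E2]
      linear_combination h / 3)
  obtain ⟨k1, k2⟩ := key
  constructor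
  · field_simp at k1 ⊢
    linarith
  · have e1 : 1 - 2 * (a2/a3)^4 = (a4^4-a2^4)/a3^4 := by
      field_simp
      linarith
    have e2 : 1 - 2 * (b2/b3)^4 = (b4^4-b2^4)/b3^4 := by
      field_simp
      linarith
    rw [e1, e2] at k2
    field_simp at k2 ⊢
    linarith

lemma modular_lt {a b a3 b3 : ℝ} (ha : 0 < a) (hb : 0 < b) (hb3 : 0 < b3) (ha3 : 0 < a3)
    (E1 : 3*(b3^2 + 2*b)^2 = 2*(a3^4 + 2*a^2))
    (E2 : (a3^2 + 2*a)^2 = 6*(b3^4 + 2*b^2)) (hab : a3^4 < 3*b3^4) :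
    b*a3^2 < a*b3^2 := by
  by_contra! hcon
  obtain ⟨p, hp, rfl⟩ : ∃ p, 0 < p ∧ p * a3^2 = a := ⟨a/a3^2, by positivity, by field_simp⟩
  obtain ⟨q, hq, rfl⟩ : ∃ q, 0 < q ∧ q * b3^2 = b := ⟨b/b3^2, by positivity, by field_simp⟩
  have hpq : p ≤ q := by
    have : 0 < a3^2*b3^2 := by positivity
    by_contra! h
    nlinarith
  have f1 : 3*b3^4*(1+2*q)^2 = 2*a3^4*(1+2*p^2) := by linear_combination E1
  have f2 : a3^4*(1+2*p)^2 = 6*b3^4*(1+2*q^2) := by linear_combination E2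
  have f3 : p^2 ≤ q^2 := by gcongr
  have f4 : a3^4*(1+2*p^2) < (3*b3^4)*(1+2*p^2) := by gcongr
  have f5 : a3^4*(1+2*p)^2 < 3*b3^4*(1+2*p)^2 := by gcongr
  have hB : 0 < b3^4 := by positivity
  have g1 : (1+2*q)^2 < 2*(1+2*p^2) := lt_of_mul_lt_mul_left (by linarith) hB.le
  have g2 : 2*(1+2*q^2) < (1+2*p)^2 := lt_of_mul_lt_mul_left (by linarith) hB.le
  linarith

/-- Evaluation of theta products at `√(5/3)` and `√15`. -/
lemma theta_values {ya yb : ℝ} (hya : ya = √(5/3)) (hyb : yb = √15) :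
    th2 ya*th4 ya*(th2 yb*th4 yb) = th3 ya^2*th3 yb^2/16 ∧
      (th4 ya^4-th2 ya^4)*(th4 yb^4-th2 yb^4) = 33/64*(th3 ya^4*th3 yb^4) ∧
      |th4 ya^4-th2 ya^4| * th3 yb^4 < (th4 yb^4-th2 yb^4)*th3 ya^4 := by
  have ha : 0 < ya := by rw [hya]; positivity
  have hb : 0 < yb := by rw [hyb]; positivity
  have hba : yb = 3 * ya := by
    rw [hya, hyb, show (15:ℝ) = 3^2*(5/3) by norm_num, Real.sqrt_mul (by norm_num),
      Real.sqrt_sq (by norm_num)]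
  have hb2 : yb * yb = 15 := by rw [hyb]; exact Real.mul_self_sqrt (by norm_num)
  have Ja := th3_pow_four ha
  have Jb := th3_pow_four hb
  have hc : th3 ya*th3 yb = th4 ya*th4 yb + th2 ya*th2 yb := by
    rw [hba]
    exact th3_mul_three ha
  have q1 : 0 < 1/yb := by positivity
  have E1 : 3*(th3 yb^2 + 2*(th2 yb*th4 yb))^2 = 2*(th3 ya^4 + 2*th2 ya^2*th4 ya^2) := by
    have h := sum_three_th_fifteen q1
    have r1 : 15*(1/yb) = yb := by field_simp; linarith
    have r2 : 6*(1/yb) = 2*(1/ya) := by rw [hba]; field_simp; norm_num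
    have r3 : 10*(1/yb) = 2*ya := by field_simp; nlinarith
    rw [r1, r2, r3, th3_inv hb, th4_inv hb, th2_inv hb] at h
    have h2 := congrArg (· ^ 2) h
    simp only [mul_pow, th_mul_two_sq ha] at h2
    have h3 : (√yb * th3 yb * th3 yb + √yb * th2 yb * th4 yb + √yb * th4 yb * th2 yb) ^ 2 =
        yb * (th3 yb^2 + 2*(th2 yb*th4 yb))^2 := by
      linear_combination (th3 yb^2 + 2*(th2 yb*th4 yb))^2 * Real.sq_sqrt hb.le
    rw [h3] at h2
    apply mul_left_cancel₀ ha.ne'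
    rw [hba] at h2 ⊢
    linarith
  have E2 : (th3 ya^2 + 2*(th2 ya*th4 ya))^2 = 6*(th3 yb^4 + 2*th2 yb^2*th4 yb^2) := by
    have h := sum_three_th_three_five q1
    have r1 : 5*(1/yb) = ya := by field_simp; nlinarith
    have r2 : 3*(1/yb) = 1/ya := by rw [hba]; field_simp
    have r3 : 30*(1/yb) = 2*yb := by field_simp; nlinarith
    rw [r1, r2, r3, th3_inv ha, th4_inv ha, th2_inv ha] at h
    have h2 := congrArg (· ^ 2) h
    simp only [mul_pow, th_mul_two_sq hb] at h2
    have h3 : (√ya * th3 ya * th3 ya + √ya * th2 ya * th4 ya + √ya * th4 ya * th2 ya) ^ 2 =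
        ya * (th3 ya^2 + 2*(th2 ya*th4 ya))^2 := by
      linear_combination (th3 ya^2 + 2*(th2 ya*th4 ya))^2 * Real.sq_sqrt ha.le
    rw [h3] at h2
    apply mul_left_cancel₀ ha.ne'
    have : yb / 2 = 3 * ya / 2 := by rw [hba]
    rw [this] at h2
    linarith
  have pa2 := th2_pos ha
  have pa3 := th3_pos ha
  have pa4 := th4_pos ha
  have pb2 := th2_pos hb
  have pb3 := th3_pos hb
  have pb4 := th4_pos hb
  obtain ⟨k1, k2⟩ := theta_modular pa2 pa3 pa4 pb2 pb3 pb4 Ja Jb hc E1 E2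
  refine ⟨k1, k2, ?_⟩
  have ya1 : ((1:ℕ):ℝ) ≤ ya := by
    rw [hya]
    exact Real.le_sqrt_of_sq_le (by norm_num)
  have yb3 : ((3:ℕ):ℝ) ≤ yb := by
    rw [hba]
    push_cast at ya1 ⊢
    linarith
  have A3 := abs_th3_sub_one_le ha (exp_neg_pi_le ya1) (by norm_num)
  have B3 := abs_th3_sub_one_le hb (exp_neg_pi_le yb3) (by norm_num)
  have B4 := abs_th4_sub_one_le hb (exp_neg_pi_le yb3) (by norm_num)
  norm_num at A3 B3 B4
  rw [abs_le] at A3 B3 B4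
  generalize th2 ya = a2 at *
  generalize th3 ya = a3 at *
  generalize th4 ya = a4 at *
  generalize th2 yb = b2 at *
  generalize th3 yb = b3 at *
  generalize th4 yb = b4 at *
  have hb1 : 0 < b4^4 - b2^4 := by
    have h1 : b3^4 ≤ (1+2/511)^4 := by gcongr; linarith
    have h2 : (1-2/511)^4 ≤ b4^4 := by gcongr; linarith
    norm_num at h1 h2
    linarith
  have hab : a3^4 < 3*b3^4 := by
    have h1 : a3^4 ≤ (1+2/7)^4 := by gcongr; linarith
    have h2 : (1-2/511)^4 ≤ b3^4 := by gcongr; linarith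
    norm_num at h1 h2
    linarith
  have hg := modular_lt (mul_pos pa2 pa4) (mul_pos pb2 pb4) pb3 pa3
    (by linear_combination E1) (by linear_combination E2) hab
  have hsq : ((b4^4-b2^4)*a3^4)^2 - ((a4^4-a2^4)*b3^4)^2 =
      4*((a2*a4*b3^2)^4 - (b2*b4*a3^2)^4) := by
    have e1 : (b4^4-b2^4)^2 = b3^8 - 4*(b2*b4)^4 := by
      rw [show b3^8 = (b3^4)^2 by ring, Jb]; ring
    have e2 : (a4^4-a2^4)^2 = a3^8 - 4*(a2*a4)^4 := by
      rw [show a3^8 = (a3^4)^2 by ring, Ja]; ring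
    rw [mul_pow, mul_pow, e1, e2]
    ring
  have hlt : (b2*b4*a3^2)^4 < (a2*a4*b3^2)^4 := by gcongr
  rw [← abs_of_pos (show 0 < b3^4 by positivity), ← abs_mul]
  apply abs_lt_of_sq_lt_sq
  · linarith
  · positivity
open Set

/-- Change of variables along a bijection with explicit inverse. -/
lemma lintegral_cov {s t : Set ℝ} (f f' g : ℝ → ℝ) (hs : MeasurableSet s)
    (hd : ∀ x ∈ s, HasDerivAt f (f' x) x) (hf : ∀ x ∈ s, f x ∈ t) (hgf : ∀ x ∈ s, g (f x) = x)
    (hg : ∀ y ∈ t, g y ∈ s) (hfg : ∀ y ∈ t, f (g y) = y) (F : ℝ → ENNReal) :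
    ∫⁻ y in t, F y = ∫⁻ x in s, ENNReal.ofReal |f' x| * F (f x) := by
  have him : f '' s = t := by
    ext y
    exact ⟨fun ⟨x, hx, h⟩ => h ▸ hf x hx, fun hy => ⟨g y, hg y hy, hfg y hy⟩⟩
  rw [← him, lintegral_image_eq_lintegral_abs_deriv_mul hs
    (fun x hx => (hd x hx).hasDerivWithinAt) (fun x hx y hy h => by
      rw [← hgf x hx, ← hgf y hy, h])]

/-- The inverse square root, zero on the nonpositive half-line. -/
noncomputable def isq (t : ℝ) : ℝ := (√t)⁻¹

lemma isq_nonneg (t : ℝ) : 0 ≤ isq t := inv_nonneg.2 (Real.sqrt_nonneg t)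

lemma isq_of_nonpos {t : ℝ} (ht : t ≤ 0) : isq t = 0 := by
  rw [isq, Real.sqrt_eq_zero_of_nonpos ht, inv_zero]

lemma isq_mul {s : ℝ} (hs : 0 ≤ s) (t : ℝ) : isq (s * t) = isq s * isq t := by
  rw [isq, Real.sqrt_mul hs, mul_inv, isq, isq]

lemma measurable_isq : Measurable isq := by
  unfold isq
  fun_prop

/-- `isq` as an extended nonnegative real. -/
noncomputable def eisq (t : ℝ) : ENNReal := ENNReal.ofReal (isq t)

@[fun_prop]
lemma measurable_eisq : Measurable eisq := measurable_isq.ennreal_ofReal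

lemma eisq_of_nonpos {t : ℝ} (ht : t ≤ 0) : eisq t = 0 := by
  rw [eisq, isq_of_nonpos ht, ENNReal.ofReal_zero]

lemma eisq_mul {s : ℝ} (hs : 0 ≤ s) (t : ℝ) : eisq (s * t) = eisq s * eisq t := by
  rw [eisq, isq_mul hs, ENNReal.ofReal_mul (isq_nonneg s), eisq, eisq]

lemma isq_sq {t : ℝ} (ht : 0 ≤ t) : isq (t^2) = t⁻¹ := by rw [isq, Real.sqrt_sq ht]

lemma isq_mul_self {t : ℝ} (ht : 0 ≤ t) : isq t * isq t = t⁻¹ := by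
  rw [isq, ← mul_inv, Real.mul_self_sqrt ht]

/-- Complete elliptic integral in symmetric form. -/
noncomputable def ellOmega (a b : ℝ) : ENNReal := ∫⁻ u : ℝ, eisq ((u^2+a^2)*(u^2+b^2))

lemma lintegral_even {f : ℝ → ENNReal} (hf : ∀ x, f (-x) = f x) :
    ∫⁻ x, f x = 2 * ∫⁻ x in Ioi 0, f x := by
  have h1 : ∫⁻ x in Iio 0, f x = ∫⁻ x in Ioi 0, f x := by
    rw [lintegral_cov (s := Ioi 0) (t := Iio 0) (fun x => -x) (fun _ => -1) (fun x => -x)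
      measurableSet_Ioi (fun x _ => hasDerivAt_neg x) (by simp) (by simp) (by simp) (by simp)]
    simp [hf]
  rw [← setLIntegral_univ, ← Iic_union_Ioi (a := (0:ℝ)), lintegral_union measurableSet_Ioi
    (by rw [Set.disjoint_left]; intro x h; simpa using h), two_mul,
    setLIntegral_congr Iio_ae_eq_Iic.symm, h1]

lemma ellOmega_scale {k : ℝ} (hk : 0 < k) (a b : ℝ) :
    ellOmega a b = ENNReal.ofReal k * ellOmega (k*a) (k*b) := by
  unfold ellOmega
  rw [← setLIntegral_univ (fun u : ℝ => eisq ((u^2+(k*a)^2)*(u^2+(k*b)^2))),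
    lintegral_cov (s := univ) (t := univ) (fun u => k*u) (fun _ => k) (fun u => u/k)
    MeasurableSet.univ (fun x _ => by simpa using (hasDerivAt_id x).const_mul k) (by simp)
    (fun x _ => by field_simp) (by simp) (fun x _ => by field_simp), setLIntegral_univ,
    ← lintegral_const_mul _ (by fun_prop)]
  refine lintegral_congr fun u => ?_
  rw [show ((k*u)^2+(k*a)^2)*((k*u)^2+(k*b)^2) = (k^2)^2*((u^2+a^2)*(u^2+b^2)) by ring,
    eisq_mul (by positivity : 0 ≤ (k^2)^2), eisq, eisq, isq_sq (by positivity), abs_of_pos hk,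
    ← mul_assoc, ← mul_assoc, ← ENNReal.ofReal_mul hk.le, ← ENNReal.ofReal_mul (by positivity),
    show k * k * (k^2)⁻¹ = 1 by field_simp]
  simp

/-- Landen's transformation. -/
lemma ellOmega_landen {a b : ℝ} (ha : 0 < a) (hb : 0 < b) :
    ellOmega ((a+b)/2) (√(a*b)) = ellOmega a b := by
  have h0 : ∫⁻ u : ℝ, eisq ((u^2+a^2)*(u^2+b^2)) =
      2 * ∫⁻ u in Ioi (0:ℝ), eisq ((u^2+a^2)*(u^2+b^2)) := lintegral_even (fun x => by simp)
  have hab : 0 < a * b := by positivity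
  unfold ellOmega
  rw [h0, ← setLIntegral_univ (fun u : ℝ => eisq ((u^2+((a+b)/2)^2)*(u^2+(√(a*b))^2))),
    lintegral_cov (s := Ioi 0) (t := univ) (fun t => (t - a*b/t)/2) (fun t => (1 + a*b/t^2)/2)
    (fun u => u + √(u^2 + a*b)) measurableSet_Ioi ?_ (by simp) ?_ ?_ ?_,
    ← lintegral_const_mul _ (by fun_prop)]
  · refine setLIntegral_congr_fun measurableSet_Ioi fun t (ht : 0 < t) => ?_
    have e : (((t - a*b/t)/2)^2+((a+b)/2)^2)*(((t - a*b/t)/2)^2+(√(a*b))^2) =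
        ((1 + a*b/t^2)/4)^2 * ((t^2+a^2)*(t^2+b^2)) := by
      rw [Real.sq_sqrt hab.le]
      field_simp
      ring
    have h1 : 0 < 1 + a*b/t^2 := by positivity
    rw [e, eisq_mul (by positivity), ← mul_assoc, eisq, isq_sq (by positivity),
      abs_of_pos (by positivity), ← ENNReal.ofReal_mul (by positivity)]
    congr 1
    rw [show (1 + a*b/t^2)/2 * ((1 + a*b/t^2)/4)⁻¹ = 2 by field_simp; norm_num]
    simp
  · intro t (ht : 0 < t)
    have h := ((hasDerivAt_id t).sub ((hasDerivAt_inv ht.ne').const_mul (a*b))).div_const 2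
    refine (h.congr_deriv ?_).congr_of_eventuallyEq (Filter.Eventually.of_forall fun x => ?_)
    · field_simp
      ring
    · simp [div_eq_mul_inv]
  · intro t (ht : 0 < t)
    have e : ((t - a*b/t)/2)^2 + a*b = ((t + a*b/t)/2)^2 := by
      field_simp
      ring
    rw [e, Real.sqrt_sq (by positivity)]
    field_simp
    ring
  · intro u _
    have : |u| < √(u^2 + a*b) := by
      rw [← Real.sqrt_sq_eq_abs]
      exact Real.sqrt_lt_sqrt (sq_nonneg u) (by linarith)
    have := neg_abs_le u
    rw [mem_Ioi]
    linarith
  · intro u _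
    have h1 : |u| < √(u^2 + a*b) := by
      rw [← Real.sqrt_sq_eq_abs]
      exact Real.sqrt_lt_sqrt (sq_nonneg u) (by linarith)
    have h2 := neg_abs_le u
    have h3 : 0 < u + √(u^2 + a*b) := by linarith
    have h4 := Real.sq_sqrt (show 0 ≤ u^2 + a*b by positivity)
    field_simp
    linarith

lemma ellOmega_self {a : ℝ} (ha : 0 < a) : ellOmega a a = ENNReal.ofReal (Real.pi / a) := by
  have h1 : ellOmega 1 1 = ENNReal.ofReal Real.pi := by
    unfold ellOmega
    rw [← integral_univ_inv_one_add_sq, ofReal_integral_eq_lintegral_ofReal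
      integrable_inv_one_add_sq (Filter.Eventually.of_forall fun x => by positivity)]
    refine lintegral_congr fun u => ?_
    rw [eisq, show (u^2+1^2)*(u^2+1^2) = (1+u^2)^2 by ring, isq_sq (by positivity)]
  have h2 := ellOmega_scale ha 1 1
  rw [mul_one, h1] at h2
  rw [div_eq_inv_mul, ENNReal.ofReal_mul (by positivity), h2, ← mul_assoc,
    ← ENNReal.ofReal_mul (by positivity), inv_mul_cancel₀ ha.ne']
  simp

lemma isq_anti {s t : ℝ} (hs : 0 < s) (h : s ≤ t) : isq t ≤ isq s := by
  unfold isq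
  gcongr

lemma ellOmega_anti {a b a' b' : ℝ} (ha : 0 < a) (hb : 0 < b) (haa : a ≤ a') (hbb : b ≤ b') :
    ellOmega a' b' ≤ ellOmega a b := by
  refine lintegral_mono fun u => ENNReal.ofReal_le_ofReal (isq_anti (by positivity) ?_)
  gcongr

lemma th3_two_sq {y : ℝ} (hy : 0 < y) : th3 (2*y)^2 = (th3 y^2 + th4 y^2)/2 := by
  rw [th3_sq hy, th4_sq hy]
  ring

lemma th4_two_sq {y : ℝ} (hy : 0 < y) : th4 (2*y)^2 = √(th3 y^2 * th4 y^2) := by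
  have h1 := th3_pow_four (show 0 < 2*y by positivity)
  have h : th3 y^2 * th4 y^2 = (th4 (2*y)^2)^2 := by
    rw [th3_sq hy, th4_sq hy]
    linear_combination h1
  rw [h, Real.sqrt_sq (sq_nonneg _)]

lemma ellOmega_th_two {y : ℝ} (hy : 0 < y) :
    ellOmega (th3 (2*y)^2) (th4 (2*y)^2) = ellOmega (th3 y^2) (th4 y^2) := by
  have h3 := th3_pos hy
  have h4 := th4_pos hy
  rw [th3_two_sq hy, th4_two_sq hy, ellOmega_landen (by positivity) (by positivity)]

open Filter Topology in
lemma tendsto_th (f : ℝ → ℝ) (hf : ∀ {y q : ℝ}, 0 < y → Real.exp (-Real.pi * y) ≤ q → q < 1 →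
    |f y - 1| ≤ 2 * q / (1 - q)) : Tendsto f atTop (𝓝 1) := by
  rw [tendsto_iff_norm_sub_tendsto_zero]
  have hq : Tendsto (fun y : ℝ => Real.exp (-Real.pi * y)) atTop (𝓝 0) := by
    exact Real.tendsto_exp_atBot.comp (tendsto_id.const_mul_atTop_of_neg (by simp [Real.pi_pos]))
  have h2 : Tendsto (fun y : ℝ => 2 * Real.exp (-Real.pi * y) / (1 - Real.exp (-Real.pi * y)))
      atTop (𝓝 0) := by
    have := (hq.const_mul 2).div (hq.const_sub 1) (by norm_num)
    rw [mul_zero, zero_div] at this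
    exact this
  refine tendsto_of_tendsto_of_tendsto_of_le_of_le' tendsto_const_nhds h2
    (Eventually.of_forall fun y => norm_nonneg _) ?_
  filter_upwards [eventually_gt_atTop 0] with y hy
  refine hf hy le_rfl ?_
  rw [Real.exp_lt_one_iff]
  have := Real.pi_pos
  nlinarith

open Filter Topology in
lemma ellOmega_th34 {y : ℝ} (hy : 0 < y) :
    ellOmega (th3 y^2) (th4 y^2) = ENNReal.ofReal Real.pi := by
  have hn : ∀ n : ℕ, ellOmega (th3 (2^n*y)^2) (th4 (2^n*y)^2) = ellOmega (th3 y^2) (th4 y^2) := by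
    intro n
    induction n with
    | zero => simp
    | succ n ih => rw [pow_succ' 2 n, mul_assoc, ellOmega_th_two (by positivity), ih]
  have hty : Tendsto (fun n : ℕ => (2:ℝ)^n*y) atTop atTop :=
    (tendsto_pow_atTop_atTop_of_one_lt one_lt_two).atTop_mul_const hy
  have h3 := (tendsto_th th3 abs_th3_sub_one_le).comp hty
  have h4 := (tendsto_th th4 abs_th4_sub_one_le).comp hty
  have lo : Tendsto (fun n : ℕ => min (th3 (2^n*y)^2) (th4 (2^n*y)^2)) atTop (𝓝 1) := by
    simpa using (h3.pow 2).min (h4.pow 2)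
  have hi : Tendsto (fun n : ℕ => max (th3 (2^n*y)^2) (th4 (2^n*y)^2)) atTop (𝓝 1) := by
    simpa using (h3.pow 2).max (h4.pow 2)
  have key : ∀ {f : ℕ → ℝ}, Tendsto f atTop (𝓝 1) →
      Tendsto (fun n => ENNReal.ofReal (Real.pi / f n)) atTop (𝓝 (ENNReal.ofReal Real.pi)) := by
    intro f hf
    have := (tendsto_const_nhds (x := Real.pi)).div hf one_ne_zero
    rw [div_one] at this
    exact (ENNReal.continuous_ofReal.tendsto _).comp this
  have hp : ∀ n : ℕ, 0 < th3 (2^n*y)^2 ∧ 0 < th4 (2^n*y)^2 := fun n =>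
    ⟨by have := th3_pos (show 0 < 2^n*y by positivity); positivity,
     by have := th4_pos (show 0 < 2^n*y by positivity); positivity⟩
  apply le_antisymm
  · refine ge_of_tendsto (key lo) (Eventually.of_forall fun n => ?_)
    rw [← hn n, ← ellOmega_self (lt_min (hp n).1 (hp n).2)]
    exact ellOmega_anti (lt_min (hp n).1 (hp n).2) (lt_min (hp n).1 (hp n).2)
      (min_le_left _ _) (min_le_right _ _)
  · refine le_of_tendsto (key hi) (Eventually.of_forall fun n => ?_)
    rw [← hn n, ← ellOmega_self (lt_max_of_lt_left (hp n).1)]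
    exact ellOmega_anti (hp n).1 (hp n).2 (le_max_left _ _) (le_max_right _ _)

lemma ellOmega_th32 {y : ℝ} (hy : 0 < y) :
    ellOmega (th3 y^2) (th2 y^2) = ENNReal.ofReal (y * Real.pi) := by
  have h := ellOmega_th34 (one_div_pos.2 hy)
  rw [th3_inv hy, th4_inv hy, mul_pow, mul_pow, Real.sq_sqrt hy.le] at h
  rw [ellOmega_scale hy, h, ENNReal.ofReal_mul hy.le]

lemma setLIntegral_shrink {s t : Set ℝ} {f : ℝ → ENNReal} (hs : MeasurableSet s)
    (ht : MeasurableSet t) (hts : t ⊆ s) (h : ∀ x ∈ s, x ∉ t → f x = 0) :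
    ∫⁻ x in s, f x = ∫⁻ x in t, f x := by
  rw [← lintegral_indicator hs, ← lintegral_indicator ht]
  congr 1
  ext x
  by_cases hx : x ∈ t
  · simp [hx, hts hx]
  · by_cases hx' : x ∈ s
    · simp [hx, hx', h x hx' hx]
    · simp [hx, hx']

lemma cos_eq_tan_half {φ : ℝ} (h : Real.cos (φ/2) ≠ 0) :
    Real.cos φ = (1 - Real.tan (φ/2)^2)/(1 + Real.tan (φ/2)^2) := by
  have h1 := Real.inv_one_add_tan_sq h
  have h2 := Real.cos_two_mul (φ/2)
  rw [mul_div_cancel₀ _ two_ne_zero, ← h1] at h2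
  rw [h2]
  have : 0 < 1 + Real.tan (φ/2)^2 := by positivity
  field_simp
  ring

lemma sin_eq_tan_half {φ : ℝ} (h : Real.cos (φ/2) ≠ 0) :
    Real.sin φ = 2 * Real.tan (φ/2)/(1 + Real.tan (φ/2)^2) := by
  have h1 := Real.inv_one_add_tan_sq h
  have h2 := Real.sin_two_mul (φ/2)
  rw [show 2 * (φ/2) = φ by ring] at h2
  rw [h2, div_eq_mul_inv _ (1 + _), h1, Real.tan_eq_sin_div_cos]
  field_simp

lemma cos_half_pos {φ : ℝ} (h : φ ∈ Ioo (-Real.pi) Real.pi) : 0 < Real.cos (φ/2) :=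
  Real.cos_pos_of_mem_Ioo ⟨by linarith [h.1], by linarith [h.2]⟩

lemma two_arctan_mem (t : ℝ) : 2 * Real.arctan t ∈ Ioo (-Real.pi) Real.pi :=
  ⟨by linarith [Real.neg_pi_div_two_lt_arctan t], by linarith [Real.arctan_lt_pi_div_two t]⟩

lemma tan_half_two_arctan (t : ℝ) : Real.tan (2 * Real.arctan t / 2) = t := by
  rw [mul_div_cancel_left₀ _ two_ne_zero, Real.tan_arctan]

lemma two_arctan_tan_half {φ : ℝ} (h : φ ∈ Ioo (-Real.pi) Real.pi) :
    2 * Real.arctan (Real.tan (φ/2)) = φ := by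
  rw [Real.arctan_tan (by linarith [h.1]) (by linarith [h.2])]
  ring

lemma add_mul_cos_eq {p q μ c : ℝ} (hμ : c + μ = q/p)
    (hc : c - μ = p/q) {φ : ℝ} (h : φ ∈ Ioo (-Real.pi) Real.pi) :
    μ + c * Real.cos φ = (q/p - p/q * Real.tan (φ/2)^2)/(1 + Real.tan (φ/2)^2) := by
  rw [cos_eq_tan_half (cos_half_pos h).ne', ← hμ, ← hc]
  have : 0 < 1 + Real.tan (φ/2)^2 := by positivity
  field_simp
  ring

/-- `∫ (μ + c cos φ)_+^{-1/2}` over a period, for `p = θ₂²`, `q = θ₄²`, `r = θ₃²`. -/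
lemma lintegral_eisq_cos {p q r μ c : ℝ} (hp : 0 < p) (hq : 0 < q) (hr : 0 < r)
    (h : p^2+q^2 = r^2) (hμ : c + μ = q/p) (hc : c - μ = p/q) :
    ∫⁻ φ in Ioo (-Real.pi) Real.pi, eisq (μ + c * Real.cos φ) =
      ENNReal.ofReal (2 * √(p*q)) * ellOmega r p := by
  have hw : ∀ u : ℝ, 0 < r^2+u^2 := fun u => by positivity
  have ht2 : ∀ u : ℝ, (q/p*u/√(r^2+u^2))^2 = q^2/p^2*u^2/(r^2+u^2) := fun u => by
    rw [div_pow, Real.sq_sqrt (hw u).le, mul_pow, div_pow]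
  have hval : ∀ u : ℝ, (q/p - p/q * (q/p*u/√(r^2+u^2))^2)/(1 + (q/p*u/√(r^2+u^2))^2) =
      p*q/(p^2+u^2) := fun u => by
    have := hw u
    have h' : 0 < p^2*(r^2+u^2)+q^2*u^2 := by positivity
    rw [ht2, ← h] at *
    field_simp
    ring
  have hpos : ∀ φ ∈ Ioo (-Real.pi) Real.pi, 0 < μ + c * Real.cos φ →
      0 < (q/p)^2 - Real.tan (φ/2)^2 := fun φ hφ h0 => by
    rw [add_mul_cos_eq hμ hc hφ, lt_div_iff₀ (by positivity), zero_mul] at h0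
    have := mul_pos (div_pos hq hp) h0
    calc _ < _ := this
      _ = _ := by field_simp
  have hmeas : MeasurableSet {φ | 0 < μ + c * Real.cos φ} :=
    measurableSet_lt measurable_const (by fun_prop)
  rw [setLIntegral_shrink measurableSet_Ioo (measurableSet_Ioo.inter hmeas) inter_subset_left
    (fun x hx hx' => eisq_of_nonpos (not_lt.1 fun h0 => hx' ⟨hx, h0⟩)),
    lintegral_cov (s := univ) (fun u => 2 * Real.arctan (q/p*u/√(r^2+u^2)))
      (fun u => 2*p*q/(√(r^2+u^2)*(p^2+u^2)))
      (fun φ => r*Real.tan (φ/2)/√((q/p)^2-Real.tan (φ/2)^2)) MeasurableSet.univ ?_ ?_ ?_ (by simp)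
      ?_, setLIntegral_univ, ellOmega, ← lintegral_const_mul _ (by fun_prop)]
  · refine lintegral_congr fun u => ?_
    rw [add_mul_cos_eq hμ hc (two_arctan_mem _), tan_half_two_arctan, hval,
      abs_of_pos (by have := hw u; positivity), eisq, eisq,
      ← ENNReal.ofReal_mul (by have := hw u; positivity), ← ENNReal.ofReal_mul (by positivity)]
    congr 1
    have h1 := hw u
    have h2 : 0 < p^2+u^2 := by positivity
    rw [isq, isq, Real.sqrt_div (by positivity), add_comm (u^2) (r^2), add_comm (u^2) (p^2),
      Real.sqrt_mul h1.le]
    have e1 : √(p^2+u^2) * √(p^2+u^2) = p^2+u^2 := Real.mul_self_sqrt h2.le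
    have e2 : √(p*q)*√(p*q) = p*q := Real.mul_self_sqrt (by positivity)
    field_simp
    linear_combination (p*q) * e1 - (p^2+u^2) * e2
  · intro u _
    have hwu := hw u
    have hsq : √(r^2+u^2)^2 = r^2+u^2 := Real.sq_sqrt hwu.le
    have d1 : HasDerivAt (fun u => √(r^2+u^2)) (2*u/(2*√(r^2+u^2))) u := by
      have : HasDerivAt (fun u : ℝ => r^2+u^2) (2*u) u := by
        simpa using ((hasDerivAt_id u).pow 2).const_add (r^2)
      exact this.sqrt hwu.ne'
    have d2 : HasDerivAt (fun u : ℝ => q/p*u) (q/p) u := by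
      simpa using (hasDerivAt_id u).const_mul (q/p)
    have hs0 : √(r^2+u^2) ≠ 0 := by positivity
    have d3 := ((d2.div d1 hs0).arctan).const_mul 2
    refine d3.congr_deriv ?_
    simp only [Pi.div_apply]
    rw [ht2]
    have hsr : √(r^2+u^2) * √(r^2+u^2) = r^2+u^2 := by rw [← sq, hsq]
    generalize hS : √(r^2+u^2) = S at *
    have : 0 < S := by rw [← hS]; positivity
    rw [← hsr]
    have hr2 : S * S - u*u = p^2 + q^2 := by rw [hsr, h]; ring
    have h2 : 0 < p^2+u^2 := by positivity
    have h3 : (p^2*(S*S) + q^2*u^2) = r^2*(p^2+u^2) := by rw [hsr, ← h]; ring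
    have h4 : 1 + q^2/p^2*u^2/(S*S) = r^2*(p^2+u^2)/(p^2*(S*S)) := by
      rw [← h3]; field_simp
    rw [h4, ← h]
    field_simp
    linear_combination hr2
  · intro u _
    refine ⟨two_arctan_mem _, ?_⟩
    rw [mem_ofPred, add_mul_cos_eq hμ hc (two_arctan_mem _), tan_half_two_arctan, hval]
    positivity
  · intro u _
    have hwu := hw u
    rw [tan_half_two_arctan]
    have e : (q/p)^2 - (q/p*u/√(r^2+u^2))^2 = (q/p*r/√(r^2+u^2))^2 := by
      rw [ht2]
      generalize hκ : q/p = κ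
      rw [← div_pow, hκ, div_pow _ (√_), Real.sq_sqrt hwu.le]
      field_simp
      ring
    rw [e, Real.sqrt_sq (by positivity)]
    field_simp
  · rintro φ ⟨hφ, hφ'⟩
    have h0 := hpos φ hφ hφ'
    generalize hT : Real.tan (φ/2) = T at *
    have hκ0 : 0 < q/p := div_pos hq hp
    generalize q/p = κ at *
    have e : r^2 + (r*T/√(κ^2-T^2))^2 = (r*κ/√(κ^2-T^2))^2 := by
      rw [div_pow, div_pow, Real.sq_sqrt h0.le]
      rw [eq_div_iff h0.ne', add_mul, div_mul_cancel₀ _ h0.ne']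
      ring
    rw [e, Real.sqrt_sq (by positivity)]
    have : 0 < √(κ^2-T^2) := Real.sqrt_pos.2 h0
    rw [show κ*(r*T/√(κ^2-T^2))/(r*κ/√(κ^2-T^2)) = T by field_simp, ← hT]
    exact two_arctan_tan_half hφ

/-- The positive period integral in terms of theta values. -/
lemma lintegral_eisq_cos_pos {y μ c : ℝ} (hy : 0 < y)
    (hμ : c + μ = th4 y^2 / th2 y^2) (hc : c - μ = th2 y^2 / th4 y^2) :
    ∫⁻ φ in Ioo (-Real.pi) Real.pi, eisq (μ + c * Real.cos φ) =
      ENNReal.ofReal (2 * Real.pi * y * (th2 y * th4 y)) := by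
  have h2 := th2_pos hy
  have h3 := th3_pos hy
  have h4 := th4_pos hy
  have e : (th2 y^2)^2 + (th4 y^2)^2 = (th3 y^2)^2 := by
    have := th3_pow_four hy
    linear_combination -this
  rw [lintegral_eisq_cos (pow_pos h2 2) (pow_pos h4 2) (pow_pos h3 2) e hμ hc,
    ellOmega_th32 hy, ← ENNReal.ofReal_mul (by positivity), ← mul_pow,
    Real.sqrt_sq (by positivity)]
  congr 1
  ring

/-- The negative period integral in terms of theta values. -/
lemma lintegral_eisq_cos_neg {y μ c : ℝ} (hy : 0 < y)
    (hμ : c + μ = th4 y^2 / th2 y^2) (hc : c - μ = th2 y^2 / th4 y^2) :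
    ∫⁻ φ in Ioo (-Real.pi) Real.pi, eisq (-μ + c * Real.cos φ) =
      ENNReal.ofReal (2 * Real.pi * (th2 y * th4 y)) := by
  have h2 := th2_pos hy
  have h3 := th3_pos hy
  have h4 := th4_pos hy
  have e : (th4 y^2)^2 + (th2 y^2)^2 = (th3 y^2)^2 := by
    have := th3_pow_four hy
    linear_combination -this
  rw [lintegral_eisq_cos (pow_pos h4 2) (pow_pos h2 2) (pow_pos h3 2) e
    (by rw [← hc]; ring) (by rw [← hμ]; ring),
    ellOmega_th34 hy, ← ENNReal.ofReal_mul (by positivity), ← mul_pow,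
    Real.sqrt_sq (by positivity)]
  congr 1
  ring

/-- The basic elliptic integral `∫₀^∞ (w (α + β w + γ w²))₊^{-1/2} dw`. -/
noncomputable def ellG (α β γ : ℝ) : ENNReal :=
  ∫⁻ w in Ioi (0:ℝ), eisq (w*(α+β*w+γ*w^2))

lemma eisq_sq_mul_cancel {k : ℝ} (hk : 0 < k) (t : ℝ) :
    ENNReal.ofReal k * eisq (k^2*t) = eisq t := by
  rw [eisq_mul (by positivity), ← mul_assoc, eisq, isq_sq hk.le, ← ENNReal.ofReal_mul hk.le,
    mul_inv_cancel₀ hk.ne', ENNReal.ofReal_one, one_mul]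

lemma ellG_scale {k : ℝ} (hk : 0 < k) (α β γ : ℝ) :
    ellG α β γ = ellG (α*k) β (γ/k) := by
  unfold ellG
  rw [lintegral_cov (s := Ioi 0) (t := Ioi 0) (fun u => u/k) (fun _ => 1/k) (fun u => k*u)
    measurableSet_Ioi (fun x _ => by simpa using (hasDerivAt_id x).div_const k)
    (fun x hx => div_pos hx hk) (fun x _ => by field_simp) (fun x hx => mul_pos hk hx)
    (fun x _ => by field_simp)]
  refine lintegral_congr fun w => ?_
  rw [show w/k*(α+β*(w/k)+γ*(w/k)^2) = (1/k)^2*(w*(α*k+β*w+γ/k*w^2)) by field_simp,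
    abs_of_pos (by positivity), eisq_sq_mul_cancel (by positivity)]

/-- Reciprocal substitution on subintervals. -/
lemma setLIntegral_eisq_recip {s t : Set ℝ} {κ : ℝ} (hκ : 0 < κ) (hs : MeasurableSet s)
    (hs0 : ∀ x ∈ s, 0 < x) (ht0 : ∀ x ∈ t, 0 < x) (hst : ∀ x ∈ s, κ/x ∈ t)
    (hts : ∀ x ∈ t, κ/x ∈ s) {α β γ : ℝ} :
    ∫⁻ w in t, eisq (w*(α+β*w+γ*w^2)) = ∫⁻ w in s, eisq (w*(γ*κ+β*w+α/κ*w^2)) := by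
  rw [lintegral_cov (fun u => κ/u) (fun u => -κ/u^2) (fun u => κ/u) hs
    (fun x hx => ?_) hst (fun x hx => ?_) hts fun x hx => ?_]
  · refine setLIntegral_congr_fun hs fun w hw => ?_
    have hw0 := hs0 w hw
    rw [show κ/w*(α+β*(κ/w)+γ*(κ/w)^2) = (κ/w^2)^2*(w*(γ*κ+β*w+α/κ*w^2)) by field_simp; ring,
      neg_div, abs_neg, abs_of_pos (by positivity), eisq_sq_mul_cancel (by positivity)]
  · have := (hasDerivAt_inv (hs0 x hx).ne').const_mul κ
    refine (this.congr_deriv ?_).congr_of_eventuallyEq (Filter.Eventually.of_forall fun x => ?_)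
    · field_simp
    · simp [div_eq_mul_inv]
  · have := hs0 x hx
    field_simp
  · have := ht0 x hx
    field_simp

lemma ellG_inv (α β γ : ℝ) : ellG α β γ = ellG γ β α := by
  unfold ellG
  rw [setLIntegral_eisq_recip (s := Ioi 0) one_pos measurableSet_Ioi (by simp) (by simp) (by simp)
    (by simp)]
  simp

lemma ellG_neg {α γ : ℝ} (β : ℝ) (h : α * γ < 0) : ellG α β γ = ellG (-α) β (-γ) := by
  have hα : α ≠ 0 := by rintro rfl; simp at h
  have hγ : γ ≠ 0 := by rintro rfl; simp at h
  have hk : 0 < -α/γ := by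
    rw [← mul_div_mul_right _ _ hγ]
    exact div_pos (by linarith) (mul_self_pos.2 hγ)
  rw [ellG_inv, ellG_scale hk]
  congr 1 <;> field_simp

/-- The two coefficient vectors with equal product and compatible signs give the same integral. -/
lemma ellG_congr {α γ a b : ℝ} (β : ℝ) (h : α * γ = a * b) (h0 : 0 < a / α) :
    ellG α β γ = ellG a β b := by
  have hα : α ≠ 0 := by rintro rfl; simp at h0
  have ha : a ≠ 0 := by rintro rfl; simp at h0
  rw [ellG_scale h0]
  congr 1
  · field_simp
  · field_simp
    linarith

lemma setLIntegral_moebius_lt {a b : ℝ} (hb : 0 < b) :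
    ∫⁻ v in Ioo 0 (1/b), eisq (v*(a-v)*(1-b*v)) = ellG a (2*(a*b)-1) ((a*b-1)*b) := by
  unfold ellG
  have h1 : ∀ x ∈ Ioi (0:ℝ), 0 < 1 + b*x := fun x hx => by
    have := mul_pos hb hx
    linarith
  have h2 : ∀ x ∈ Ioo 0 (1/b), 0 < 1 - b*x := fun x hx => by
    have := (lt_div_iff₀ hb).1 hx.2
    linarith
  have e : ∀ x ∈ Ioi (0:ℝ), 1 - b*(x/(1+b*x)) = 1/(1+b*x) := fun x hx => by
    have := h1 x hx
    field_simp
    ring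
  rw [lintegral_cov (s := Ioi 0) (t := Ioo 0 (1/b)) (fun T => T/(1+b*T)) (fun T => 1/(1+b*T)^2)
    (fun v => v/(1-b*v)) measurableSet_Ioi (fun x hx => ?_) (fun x hx => ⟨?_, ?_⟩) (fun x hx => ?_)
    (fun x hx => ?_) fun x hx => ?_]
  · refine setLIntegral_congr_fun measurableSet_Ioi fun w hw => ?_
    have := h1 w hw
    rw [show w/(1+b*w)*(a-w/(1+b*w))*(1-b*(w/(1+b*w))) =
      (1/(1+b*w)^2)^2*(w*(a+(2*(a*b)-1)*w+(a*b-1)*b*w^2)) by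
        rw [e w hw, show a+(2*(a*b)-1)*w+(a*b-1)*b*w^2 = (a*(1+b*w)-w)*(1+b*w) by ring]
        generalize 1+b*w = D at this
        field_simp,
      abs_of_pos (by positivity), eisq_sq_mul_cancel (by positivity)]
  · have h := h1 x hx
    have hd : HasDerivAt (fun x => 1+b*x) b x := by
      simpa using ((hasDerivAt_id x).const_mul b).const_add 1
    refine ((hasDerivAt_id x).div hd h.ne').congr_deriv ?_
    congr 1
    simp only [id]
    ring
  · exact div_pos hx (h1 x hx)
  · rw [div_lt_div_iff₀ (h1 x hx) hb]
    linarith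
  · rw [e x hx, div_div_div_cancel_right₀ (h1 x hx).ne', div_one]
  · exact div_pos hx.1 (h2 x hx)
  · have := h2 x hx
    have e : 1 + b*(x/(1-b*x)) = 1/(1-b*x) := by
      field_simp
      ring
    rw [e, div_div_div_cancel_right₀ this.ne', div_one]

lemma setLIntegral_moebius_gt {a b : ℝ} (hb : 0 < b) :
    ∫⁻ v in Ioi (1/b), eisq (v*(a-v)*(1-b*v)) =
      ∫⁻ w in Ioi (1/b), eisq (w*(-a+(2*(a*b)-1)*w+(-((a*b-1)*b))*w^2)) := by
  have h1 : ∀ x ∈ Ioi (1/b), 0 < b*x-1 := fun x hx => by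
    have := (div_lt_iff₀ hb).1 hx
    linarith
  have hb' : 0 < 1/b := by positivity
  have e : ∀ x ∈ Ioi (1/b), b*(x/(b*x-1)) - 1 = 1/(b*x-1) := fun x hx => by
    have := h1 x hx
    field_simp
    ring
  have hm : ∀ x ∈ Ioi (1/b), x/(b*x-1) ∈ Ioi (1/b) := fun x hx => by
    rw [mem_Ioi, div_lt_div_iff₀ hb (h1 x hx)]
    linarith
  have hi : ∀ x ∈ Ioi (1/b), x/(b*x-1)/(b*(x/(b*x-1))-1) = x := fun x hx => by
    rw [e x hx, div_div_div_cancel_right₀ (h1 x hx).ne', div_one]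
  rw [lintegral_cov (s := Ioi (1/b)) (fun T => T/(b*T-1)) (fun T => -(1/(b*T-1)^2))
    (fun v => v/(b*v-1)) measurableSet_Ioi (fun x hx => ?_) hm hi hm hi]
  · refine setLIntegral_congr_fun measurableSet_Ioi fun w hw => ?_
    have := h1 w hw
    rw [show w/(b*w-1)*(a-w/(b*w-1))*(1-b*(w/(b*w-1))) =
      (1/(b*w-1)^2)^2*(w*(-a+(2*(a*b)-1)*w+(-((a*b-1)*b))*w^2)) by
        rw [show 1-b*(w/(b*w-1)) = -(1/(b*w-1)) by rw [← e w hw]; ring,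
          show -a+(2*(a*b)-1)*w+(-((a*b-1)*b))*w^2 = -((a*(b*w-1)-w)*(b*w-1)) by ring]
        generalize b*w-1 = D at this
        field_simp,
      abs_neg, abs_of_pos (by positivity), eisq_sq_mul_cancel (by positivity)]
  · have h := h1 x hx
    have hd : HasDerivAt (fun x => b*x-1) b x := by
      simpa using ((hasDerivAt_id x).const_mul b).sub_const 1
    refine ((hasDerivAt_id x).div hd h.ne').congr_deriv ?_
    simp
    field_simp
    ring

lemma setLIntegral_split {f : ℝ → ENNReal} {c : ℝ} (hc : 0 < c) :
    ∫⁻ v in Ioi (0:ℝ), f v = (∫⁻ v in Ioo 0 c, f v) + ∫⁻ v in Ioi c, f v := by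
  rw [← Ioc_union_Ioi_eq_Ioi hc.le, lintegral_union measurableSet_Ioi
    (by rw [Set.disjoint_left]; intro x h; simpa using h.2), setLIntegral_congr Ioo_ae_eq_Ioc.symm]

lemma ellG_eq_prod (a b : ℝ) :
    ellG a (-(1+a*b)) b = ∫⁻ v in Ioi (0:ℝ), eisq (v*(a-v)*(1-b*v)) := by
  unfold ellG
  refine lintegral_congr fun v => ?_
  congr 1
  ring

/-- Comparison of the fibre integral with the two sector integrals, with `0 < b`. -/
lemma two_mul_ellG_aux {a b α γ : ℝ} (hb : 0 < b) (h0 : a*b ≠ 0) (h1 : a*b ≠ 1)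
    (h : α*γ = a*b*(a*b-1)) (hs : 0 < α + γ) :
    2 * ellG a (-(1+a*b)) b =
      ellG α (2*(a*b)-1) γ + 3 * ellG (-α) (2*(a*b)-1) (-γ) := by
  have hb' : 0 < 1/b := by positivity
  have hpos : 0 < α * γ → 0 < α ∧ 0 < γ := fun hp => by
    rcases (mul_pos_iff.1 hp) with h | h
    · exact h
    · linarith [h.1, h.2]
  rw [ellG_eq_prod, setLIntegral_split hb', setLIntegral_moebius_lt hb]
  rcases lt_or_gt_of_ne h0 with hm | hm
  · have ha : a < 0 := neg_of_mul_neg_left hm hb.le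
    obtain ⟨hα, hγ⟩ := hpos (by rw [h]; exact mul_pos_of_neg_of_neg hm (by linarith))
    have hz : ellG a (2*(a*b)-1) ((a*b-1)*b) = 0 := by
      unfold ellG
      refine (setLIntegral_congr_fun measurableSet_Ioi fun w (hw : 0 < w) => ?_).trans
        lintegral_zero
      refine eisq_of_nonpos (mul_nonpos_of_nonneg_of_nonpos hw.le ?_)
      have := mul_pos (sub_pos.2 (hm.trans zero_lt_one)) (mul_pos hb (pow_pos hw 2))
      have := mul_pos (neg_pos.2 hm) hw
      nlinarith
    have hz' : ellG (-α) (2*(a*b)-1) (-γ) = 0 := by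
      unfold ellG
      refine (setLIntegral_congr_fun measurableSet_Ioi fun w (hw : 0 < w) => ?_).trans
        lintegral_zero
      refine eisq_of_nonpos (mul_nonpos_of_nonneg_of_nonpos hw.le ?_)
      have := mul_pos hγ (pow_pos hw 2)
      have := mul_pos (neg_pos.2 hm) hw
      nlinarith
    rw [hz, hz', zero_add, mul_zero, add_zero, setLIntegral_moebius_gt hb]
    rw [ellG_congr (α := α) (γ := γ) (a := -a) (b := -((a*b-1)*b)) _ (by rw [h]; ring)
      (div_pos (by linarith) hα)]
    have hm1 : 0 < 1 - a*b := by linarith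
    have hκ : 0 < -a/((1-a*b)*b) := div_pos (by linarith) (by positivity)
    set c := -a/(1-a*b) with hc
    have hc0 : 0 < c := div_pos (by linarith) hm1
    have hcb : c < 1/b := by
      rw [hc, div_lt_div_iff₀ hm1 hb]
      linarith
    unfold ellG
    rw [setLIntegral_split hb', two_mul]
    congr 1
    have hfac : ∀ w, w*(-a+(2*(a*b)-1)*w+(-((a*b-1)*b))*w^2) = 
        (1-a*b)*(w*((w-c)*(b*w-1))) := fun w => by
      rw [hc]; field_simp; ring
    rw [setLIntegral_shrink (t := Ioo 0 c) measurableSet_Ioo measurableSet_Ioo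
      (Ioo_subset_Ioo_right hcb.le) fun x hx hx' => eisq_of_nonpos ?_]
    · rw [setLIntegral_eisq_recip (s := Ioo 0 c) (t := Ioi (1/b)) hκ measurableSet_Ioo (fun x hx => hx.1)
        (fun x hx => hb'.trans hx) (fun x hx => ?_) (fun x hx => ⟨?_, ?_⟩)]
      · refine lintegral_congr fun w => ?_
        congr 1
        have hκ1 : -((a*b-1)*b) * (-a/((1-a*b)*b)) = -a := by
          field_simp
          ring
        have hκ2 : -a/(-a/((1-a*b)*b)) = -((a*b-1)*b) := by
          rw [div_div_cancel₀ (by linarith)]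
          ring
        rw [hκ1, hκ2]
      · have h2 := hx.2
        rw [hc, lt_div_iff₀ hm1] at h2
        rw [mem_Ioi, div_div, div_lt_div_iff₀ hb (by have := hx.1; positivity)]
        nlinarith
      · exact div_pos hκ (hb'.trans hx)
      · have hx' := (div_lt_iff₀ hb).1 hx
        have := hb'.trans hx
        rw [hc, div_div, div_lt_div_iff₀ (by positivity) hm1]
        nlinarith [mul_pos (neg_pos.2 ha) hm1]
    · have hcx : c ≤ x := not_lt.1 fun h => hx' ⟨hx.1, h⟩
      have := (lt_div_iff₀ hb).1 hx.2
      rw [hfac]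
      refine mul_nonpos_of_nonneg_of_nonpos hm1.le (mul_nonpos_of_nonneg_of_nonpos hx.1.le
        (mul_nonpos_of_nonneg_of_nonpos (by linarith) (by linarith)))
  · have ha : 0 < a := pos_of_mul_pos_left hm hb.le
    have hgt : ∫⁻ v in Ioi (1/b), eisq (v*(a-v)*(1-b*v)) =
        ellG (-a) (2*(a*b)-1) (-((a*b-1)*b)) := by
      rw [setLIntegral_moebius_gt hb, ellG]
      refine (setLIntegral_shrink measurableSet_Ioi measurableSet_Ioi (Ioi_subset_Ioi hb'.le)
        fun x hx hx' => eisq_of_nonpos ?_).symm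
      have h2 : x * b ≤ 1 := (le_div_iff₀ hb).1 (not_lt.1 hx')
      have hx0 : 0 < x := hx
      rw [show -a+(2*(a*b)-1)*x+(-((a*b-1)*b))*x^2 = -((a*(1-x*b)+x)*(1-x*b)) by ring]
      have := mul_nonneg ha.le (sub_nonneg.2 h2)
      refine mul_nonpos_of_nonneg_of_nonpos hx0.le (neg_nonpos.2 (mul_nonneg (by linarith)
        (by linarith)))
    rcases lt_or_gt_of_ne h1 with hm1 | hm1
    · have hn : α*γ < 0 := by rw [h]; exact mul_neg_of_pos_of_neg hm (by linarith)
      have hn' : a*((a*b-1)*b) < 0 := by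
        have := mul_neg_of_pos_of_neg hm (sub_neg.2 hm1)
        linarith
      rw [hgt, ← ellG_neg _ hn, ← ellG_neg _ hn']
      have : ellG α (2*(a*b)-1) γ = ellG a (2*(a*b)-1) ((a*b-1)*b) := by
        rcases mul_neg_iff.1 hn with h' | h'
        · exact ellG_congr _ (by rw [h]; ring) (div_pos ha h'.1)
        · rw [ellG_inv]
          exact ellG_congr _ (by rw [mul_comm, h]; ring) (div_pos ha h'.2)
      rw [this]
      ring
    · obtain ⟨hα, hγ⟩ := hpos (by rw [h]; exact mul_pos hm (by linarith))
      have e1 : ellG α (2*(a*b)-1) γ = ellG a (2*(a*b)-1) ((a*b-1)*b) :=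
        ellG_congr _ (by rw [h]; ring) (div_pos ha hα)
      have e2 : ellG (-α) (2*(a*b)-1) (-γ) = ellG (-a) (2*(a*b)-1) (-((a*b-1)*b)) :=
        ellG_congr _ (by rw [neg_mul_neg, h]; ring) (by rw [neg_div_neg_eq]; exact div_pos ha hα)
      have hab : 1/b < a := by rw [div_lt_iff₀ hb]; exact hm1
      have e3 : ellG (-a) (2*(a*b)-1) (-((a*b-1)*b)) = ellG a (2*(a*b)-1) ((a*b-1)*b) := by
        rw [← hgt, ← setLIntegral_moebius_lt hb,
          setLIntegral_shrink measurableSet_Ioi measurableSet_Ioi (Ioi_subset_Ioi hab.le)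
          fun x hx hx' => eisq_of_nonpos ?_]
        · have e : ∀ v, v*(a-v)*(1-b*v) = v*(a+(-(1+a*b))*v+b*v^2) := fun v => by ring
          simp only [e]
          rw [setLIntegral_eisq_recip (s := Ioo 0 (1/b)) (t := Ioi a) (κ := a/b) (by positivity)
            measurableSet_Ioo (fun x hx => hx.1) (fun x hx => ha.trans hx) (fun x hx => ?_)
            (fun x hx => ⟨?_, ?_⟩)]
          · refine lintegral_congr fun w => ?_
            congr 1
            field_simp
          · have := (lt_div_iff₀ hb).1 hx.2
            have := hx.1
            rw [mem_Ioi, div_div, lt_div_iff₀ (by positivity)]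
            nlinarith
          · exact div_pos (by positivity) (ha.trans hx)
          · have hx0 := ha.trans hx
            have := mul_pos hb (sub_pos.2 hx)
            rw [div_div, div_lt_div_iff₀ (by positivity) hb]
            nlinarith
        · have h2 : x ≤ a := not_lt.1 hx'
          have h3 := (div_lt_iff₀ hb).1 hx
          have : 0 < x := hb'.trans hx
          exact mul_nonpos_of_nonneg_of_nonpos (mul_nonneg this.le (by linarith)) (by linarith)
      rw [hgt, e1, e2, e3]
      ring

lemma two_mul_ellG {a b α γ : ℝ} (hab : 0 < a + b) (h0 : a*b ≠ 0) (h1 : a*b ≠ 1)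
    (h : α*γ = a*b*(a*b-1)) (hs : 0 < α + γ) :
    2 * ellG a (-(1+a*b)) b =
      ellG α (2*(a*b)-1) γ + 3 * ellG (-α) (2*(a*b)-1) (-γ) := by
  by_cases hb : 0 < b
  · exact two_mul_ellG_aux hb h0 h1 h hs
  · have := two_mul_ellG_aux (a := b) (b := a) (by linarith) (by rwa [mul_comm]) (by rwa [mul_comm])
      (by rwa [mul_comm b a]) hs
    rwa [mul_comm b a, ellG_inv] at this

lemma eisq_mul_eisq_scale {k : ℝ} (hk : 0 < k) (s t : ℝ) :
    eisq (k*s) * eisq (k*t) = ENNReal.ofReal k⁻¹ * (eisq s * eisq t) := by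
  rw [eisq_mul hk.le, eisq_mul hk.le, mul_mul_mul_comm]
  congr 1
  rw [eisq, ← ENNReal.ofReal_mul (isq_nonneg k), isq_mul_self hk.le]

/-- Half-angle substitution for a product of two inverse square roots. -/
lemma lintegral_eisq_eisq_half {R μ c ν d s : ℝ} (hμ : c + μ = R)
    (hc : c - μ = 1/R) (ε ε' : ℝ) :
    ∫⁻ φ in Ioo (-Real.pi) Real.pi,
      eisq (ε * (μ + c * Real.cos φ)) * eisq (ε' * (ν + d * Real.cos (φ - s))) =
    2 * ∫⁻ τ, eisq (ε * (R - τ^2/R)) * eisq (ε' * ((ν + d * Real.cos s) + 2 * d * Real.sin s * τ +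
      (ν - d * Real.cos s) * τ^2)) := by
  rw [lintegral_cov (s := univ) (fun τ => 2 * Real.arctan τ) (fun τ => 2 / (1+τ^2))
    (fun φ => Real.tan (φ/2)) MeasurableSet.univ
    (fun x _ => ((Real.hasDerivAt_arctan x).const_mul 2).congr_deriv (by ring))
    (fun x _ => two_arctan_mem x) (fun x _ => tan_half_two_arctan x) (by simp)
    (fun x hx => two_arctan_tan_half hx), setLIntegral_univ, ← lintegral_const_mul _ (by fun_prop)]
  refine lintegral_congr fun τ => ?_
  have h0 := (cos_half_pos (two_arctan_mem τ)).ne'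
  have h1 : 0 < 1 + τ^2 := by positivity
  have e1 : ε * (μ + c * Real.cos (2 * Real.arctan τ)) = (1+τ^2)⁻¹ * (ε * (R - τ^2/R)) := by
    rw [cos_eq_tan_half h0, tan_half_two_arctan, ← hμ, div_eq_mul_one_div (τ^2) (c+μ), hμ, ← hc,
      ← hμ]
    field_simp
    ring
  have e2 : ε' * (ν + d * Real.cos (2 * Real.arctan τ - s)) = (1+τ^2)⁻¹ *
      (ε' * ((ν + d * Real.cos s) + 2 * d * Real.sin s * τ + (ν - d * Real.cos s) * τ^2)) := by
    rw [Real.cos_sub, cos_eq_tan_half h0, sin_eq_tan_half h0, tan_half_two_arctan]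
    field_simp
    ring
  rw [e1, e2, eisq_mul_eisq_scale (by positivity), inv_inv, ← mul_assoc,
    ← ENNReal.ofReal_mul (by positivity), abs_of_pos (by positivity), div_mul_cancel₀ _ h1.ne']
  simp

/-- The quadratic form in the coordinate `τ = R (w - 1) / (w + 1)`. -/
lemma quad_moebius {R q0 q1 q2 w : ℝ} (hR : R ≠ 0) (hw : w + 1 ≠ 0) :
    q0 + q1 * (R*(w-1)/(w+1)) + q2 * (R*(w-1)/(w+1))^2 =
      4*R/(w+1)^2 * ((q0/R-q1+q2*R)/4 + (q0/R-q2*R)/2*w + (q0/R+q1+q2*R)/4*w^2) := by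
  field_simp
  ring

lemma lintegral_quad_pos {R q0 q1 q2 : ℝ} (hR : 0 < R) :
    2 * ∫⁻ τ, eisq (R - τ^2/R) * eisq (-(q0+q1*τ+q2*τ^2)) =
      ellG (-((q0/R-q1+q2*R)/4)) (-((q0/R-q2*R)/2)) (-((q0/R+q1+q2*R)/4)) := by
  have h1 : ∀ x ∈ Ioo (-R) R, 0 < R - x := fun x hx => by linarith [hx.2]
  have h2 : ∀ x ∈ Ioo (-R) R, 0 < R + x := fun x hx => by linarith [hx.1]
  have h3 : ∀ x ∈ Ioi (0:ℝ), 0 < x + 1 := fun x hx => by linarith [mem_Ioi.1 hx]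
  rw [← setLIntegral_univ, setLIntegral_shrink (t := Ioo (-R) R) MeasurableSet.univ
    measurableSet_Ioo (subset_univ _) (fun x _ hx => ?_),
    lintegral_cov (s := Ioi 0) (t := Ioo (-R) R) (fun w => R*(w-1)/(w+1)) (fun w => 2*R/(w+1)^2)
    (fun τ => (R+τ)/(R-τ)) measurableSet_Ioi (fun x hx => ?_) (fun x hx => ⟨?_, ?_⟩) (fun x hx => ?_)
    (fun x hx => div_pos (h2 x hx) (h1 x hx)) (fun x hx => ?_), ellG,
    ← lintegral_const_mul _ (by fun_prop)]
  · refine setLIntegral_congr_fun measurableSet_Ioi fun w hw => ?_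
    have hw1 := h3 w hw
    have e : R - (R*(w-1)/(w+1))^2/R = 4*R/(w+1)^2*w := by
      field_simp
      ring
    rw [quad_moebius hR.ne' hw1.ne', e, ← mul_neg, eisq_mul_eisq_scale (by positivity),
      eisq_mul (le_of_lt hw), ← mul_assoc, ← mul_assoc, abs_of_pos (by positivity),
      show (2:ENNReal) = ENNReal.ofReal 2 by simp, ← ENNReal.ofReal_mul (by positivity),
      ← ENNReal.ofReal_mul (by positivity), show 2 * (2*R/(w+1)^2) * (4*R/(w+1)^2)⁻¹ = 1 by
        field_simp; norm_num, ENNReal.ofReal_one, one_mul]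
    congr 2
    ring
  · have h := h3 x hx
    have hn : HasDerivAt (fun x => R*(x-1)) R x := by
      simpa using ((hasDerivAt_id x).sub_const 1).const_mul R
    have hd : HasDerivAt (fun x => x+1) 1 x := (hasDerivAt_id x).add_const 1
    refine (hn.div hd h.ne').congr_deriv ?_
    congr 1
    ring
  · have h := h3 x hx
    rw [lt_div_iff₀ h]
    nlinarith [mul_pos hR hx]
  · have h := h3 x hx
    rw [div_lt_iff₀ h]
    nlinarith
  · have h := h3 x hx
    have e1 : R + R*(x-1)/(x+1) = 2*R*x/(x+1) := by field_simp; ring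
    have e2 : R - R*(x-1)/(x+1) = 2*R/(x+1) := by field_simp; ring
    rw [e1, e2, div_div_div_cancel_right₀ h.ne']
    field_simp
  · have hm := h1 x hx
    have e1 : (R+x)/(R-x) - 1 = 2*x/(R-x) := by field_simp; ring
    have e2 : (R+x)/(R-x) + 1 = 2*R/(R-x) := by field_simp; ring
    rw [e1, e2, mul_div_assoc', div_div_div_cancel_right₀ hm.ne']
    field_simp
  · rw [eisq_of_nonpos, zero_mul]
    have : R^2 ≤ x^2 := by
      rcases not_and_or.1 hx with h | h
      · nlinarith
      · nlinarith
    rw [sub_nonpos, le_div_iff₀ hR]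
    linarith

lemma lintegral_quad_neg {R q0 q1 q2 : ℝ} (hR : 0 < R) :
    2 * ∫⁻ τ, eisq (-(R - τ^2/R)) * eisq (q0+q1*τ+q2*τ^2) =
      ellG ((q0/R-q1+q2*R)/4) (-((q0/R-q2*R)/2)) ((q0/R+q1+q2*R)/4) := by
  have h3 : ∀ x ∈ Ioi (0:ℝ), 0 < x + 1 := fun x hx => by linarith [mem_Ioi.1 hx]
  have ht : MeasurableSet {x : ℝ | R^2 < x^2} := measurableSet_lt (by fun_prop) (by fun_prop)
  have hs : MeasurableSet (Ioi (0:ℝ) \ {1}) := measurableSet_Ioi.diff (measurableSet_singleton 1)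
  have hns : ∀ x ∈ Ioi (0:ℝ) \ {1}, -x + 1 ≠ 0 := fun x hx h => hx.2 (by
    rw [mem_singleton_iff]; linarith)
  have hnt : ∀ x ∈ {x : ℝ | R^2 < x^2}, x - R ≠ 0 := fun x hx h => by
    rw [mem_ofPred, sub_eq_zero.1 h] at hx
    exact lt_irrefl _ hx
  rw [← setLIntegral_univ, setLIntegral_shrink (t := {x | R^2 < x^2}) MeasurableSet.univ
    ht (subset_univ _) (fun x _ hx => ?_),
    lintegral_cov (s := Ioi 0 \ {1}) (fun w => R*(-w-1)/(-w+1)) (fun w => -(2*R/(-w+1)^2))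
    (fun τ => (τ+R)/(τ-R)) hs (fun x hx => ?_) (fun x hx => ?_) (fun x hx => ?_)
    (fun x hx => ⟨?_, fun h => ?_⟩) (fun x hx => ?_), ellG,
    ← setLIntegral_congr (sdiff_null_ae_eq_self (s := Ioi (0:ℝ)) (measure_singleton (1:ℝ))),
    ← lintegral_const_mul _ (by fun_prop)]
  · refine setLIntegral_congr_fun hs fun w hw => ?_
    have hw1 := hns w hw
    have e : -(R - (R*(-w-1)/(-w+1))^2/R) = 4*R/(-w+1)^2*w := by
      field_simp
      ring
    rw [quad_moebius hR.ne' hw1, e, eisq_mul_eisq_scale (by positivity),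
      eisq_mul (le_of_lt hw.1), ← mul_assoc, ← mul_assoc, abs_neg, abs_of_pos (by positivity),
      show (2:ENNReal) = ENNReal.ofReal 2 by simp, ← ENNReal.ofReal_mul (by positivity),
      ← ENNReal.ofReal_mul (by positivity), show 2 * (2*R/(-w+1)^2) * (4*R/(-w+1)^2)⁻¹ = 1 by
        field_simp; norm_num, ENNReal.ofReal_one, one_mul]
    congr 2
    ring
  · have h := hns x hx
    have hn : HasDerivAt (fun x => R*(-x-1)) (-R) x := by
      simpa using ((hasDerivAt_neg x).sub_const 1).const_mul R
    have hd : HasDerivAt (fun x => -x+1) (-1) x := (hasDerivAt_neg x).add_const 1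
    refine (hn.div hd h).congr_deriv ?_
    rw [← neg_div]
    congr 1
    ring
  · have h := hns x hx
    have := mem_Ioi.1 hx.1
    rw [mem_ofPred, div_pow, lt_div_iff₀ (by positivity), mul_pow]
    have := pow_pos hR 2
    nlinarith
  · have h := hns x hx
    have e1 : R*(-x-1)/(-x+1) + R = -2*R*x/(-x+1) := by field_simp; ring
    have e2 : R*(-x-1)/(-x+1) - R = -2*R/(-x+1) := by field_simp; ring
    rw [e1, e2, div_div_div_cancel_right₀ h]
    field_simp
  · have h : 0 < (x+R)*(x-R) := by
      have := mem_ofPred.1 hx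
      nlinarith
    have : 0 < (x-R)*(x-R) := mul_self_pos.2 (hnt x hx)
    rw [mem_Ioi, ← mul_div_mul_right _ _ (hnt x hx)]
    exact div_pos h this
  · rw [mem_singleton_iff, div_eq_one_iff_eq (hnt x hx)] at h
    linarith
  · have hm := hnt x hx
    have e1 : -((x+R)/(x-R)) - 1 = -2*x/(x-R) := by field_simp; ring
    have e2 : -((x+R)/(x-R)) + 1 = -2*R/(x-R) := by field_simp; ring
    rw [e1, e2, mul_div_assoc', div_div_div_cancel_right₀ hm]
    field_simp
  · rw [eisq_of_nonpos, zero_mul]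
    have : x^2 ≤ R^2 := not_lt.1 hx
    rw [neg_nonpos, sub_nonneg, div_le_iff₀ hR]
    linarith

/-- Fubini for a convolution over the circle. -/
lemma lintegral_circle_conv {f g : ℝ → ENNReal} (hf : Measurable f) (hg : Measurable g)
    (hper : Function.Periodic g (2*Real.pi)) :
    ∫⁻ s in Ioo 0 (2*Real.pi), ∫⁻ φ in Ioo (-Real.pi) Real.pi, f φ * g (φ - s) =
      (∫⁻ φ in Ioo (-Real.pi) Real.pi, f φ) * ∫⁻ φ in Ioo (-Real.pi) Real.pi, g φ := by
  have hpi := Real.two_pi_pos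
  rw [lintegral_lintegral_swap (by fun_prop), ← lintegral_mul_const _ hf]
  refine lintegral_congr fun φ => ?_
  rw [lintegral_const_mul _ (by fun_prop)]
  congr 1
  rw [lintegral_cov (s := Ioo (φ - 2*Real.pi) φ) (t := Ioo 0 (2*Real.pi)) (fun x => φ - x) (fun _ => -1) (fun x => φ - x)
    measurableSet_Ioo (fun x _ => by simpa using (hasDerivAt_id x).const_sub φ)
    (fun x hx => ⟨by linarith [hx.2], by linarith [hx.1]⟩) (by simp)
    (fun x hx => ⟨by linarith [hx.2], by linarith [hx.1]⟩) (by simp)]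
  have h : ∀ n : AddSubgroup.zmultiples (2*Real.pi), ∀ x, g (n +ᵥ x) = g x := by
    rintro ⟨_, n, rfl⟩ x
    rw [AddSubgroup.vadd_def, vadd_eq_add, add_comm]
    exact hper.zsmul n x
  have := (isAddFundamentalDomain_Ioc hpi (φ - 2*Real.pi)).setLIntegral_eq
    (isAddFundamentalDomain_Ioc hpi (-Real.pi)) g h
  rw [sub_add_cancel, show -Real.pi + 2*Real.pi = Real.pi by ring] at this
  simp only [sub_sub_cancel, abs_neg, abs_one, ENNReal.ofReal_one, one_mul]
  rw [setLIntegral_congr Ioo_ae_eq_Ioc, this, setLIntegral_congr Ioo_ae_eq_Ioc.symm]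

lemma lintegral_eisq_neg_shift (ν d : ℝ) :
    ∫⁻ φ in Ioo (-Real.pi) Real.pi, eisq (-(ν + d * Real.cos φ)) =
      ∫⁻ φ in Ioo (-Real.pi) Real.pi, eisq (-ν + d * Real.cos φ) := by
  have hpi := Real.two_pi_pos
  have h : ∀ n : AddSubgroup.zmultiples (2*Real.pi), ∀ x,
      eisq (-ν + d * Real.cos (n +ᵥ x)) = eisq (-ν + d * Real.cos x) := by
    rintro ⟨_, n, rfl⟩ x
    rw [AddSubgroup.vadd_def, vadd_eq_add, add_comm _ x]
    have hz := Real.cos_periodic.zsmul n x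
    dsimp only at hz ⊢
    rw [hz]
  have := (isAddFundamentalDomain_Ioc hpi 0).setLIntegral_eq
    (isAddFundamentalDomain_Ioc hpi (-Real.pi)) (fun x => eisq (-ν + d * Real.cos x)) h
  rw [zero_add, show -Real.pi + 2*Real.pi = Real.pi by ring] at this
  rw [setLIntegral_congr Ioo_ae_eq_Ioc, setLIntegral_congr (Ioo_ae_eq_Ioc (a := -Real.pi)), ← this,
    ← setLIntegral_congr Ioo_ae_eq_Ioc, ← setLIntegral_congr Ioo_ae_eq_Ioc,
    lintegral_cov (s := Ioo 0 (2*Real.pi)) (t := Ioo (-Real.pi) Real.pi) (fun x => x - Real.pi)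
    (fun _ => 1) (fun x => x + Real.pi) measurableSet_Ioo
    (fun x _ => (hasDerivAt_id x).sub_const _)
    (fun x hx => ⟨by linarith [hx.1], by linarith [hx.2]⟩) (by simp)
    (fun x hx => ⟨by linarith [hx.1], by linarith [hx.2]⟩) (by simp)]
  refine lintegral_congr fun x => ?_
  rw [Real.cos_sub_pi, abs_one, ENNReal.ofReal_one, one_mul]
  congr 1
  ring

/-- The fibre integral `M(A)`. -/
noncomputable def fibre (A : ℝ) : ENNReal :=
  ∫⁻ v in Ioi (0:ℝ), eisq (v * ((8*(1+Real.cos A)-1) - v) * (1 - (8*(1-Real.cos A)-1)*v))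

lemma ae_cos_sq_ne (k : ℝ) : ∀ᵐ A, A ∈ Ioo 0 Real.pi → Real.cos A^2 ≠ k := by
  have hfin : ({A : ℝ | A ∈ Ioo 0 Real.pi ∧ Real.cos A^2 = k}).Finite := by
    refine (Set.toFinite {Real.arccos (√k), Real.arccos (-√k)}).subset ?_
    rintro A ⟨hA, rfl⟩
    rw [Real.sqrt_sq_eq_abs]
    rcases abs_choice (Real.cos A) with h | h
    · left
      rw [h, Real.arccos_cos hA.1.le hA.2.le]
    · right
      rw [h, neg_neg, mem_singleton_iff, Real.arccos_cos hA.1.le hA.2.le]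
  filter_upwards [compl_mem_ae_iff.2 (hfin.measure_zero volume)] with A hA h1 h2
  exact hA ⟨h1, h2⟩

/-- The average of the fibre integral factors into products of periods. -/
theorem lintegral_fibre {R μ c ν d : ℝ} (hR : 0 < R) (hμ : c + μ = R) (hc : c - μ = 1/R)
    (hcd : c * d = 64) (hμν : μ * ν = 33) (hd : d^2 = 1 + ν^2) (hs : |d*μ| < ν*c) :
    4 * ∫⁻ A in Ioo 0 Real.pi, fibre A =
      (∫⁻ φ in Ioo (-Real.pi) Real.pi, eisq (-μ + c * Real.cos φ)) *
        (∫⁻ φ in Ioo (-Real.pi) Real.pi, eisq (ν + d * Real.cos φ)) +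
      3 * ((∫⁻ φ in Ioo (-Real.pi) Real.pi, eisq (μ + c * Real.cos φ)) *
        (∫⁻ φ in Ioo (-Real.pi) Real.pi, eisq (-ν + d * Real.cos φ))) := by
  have hpi := Real.pi_pos
  set α : ℝ → ℝ := fun s => ((ν+d*Real.cos s)/R-2*d*Real.sin s+(ν-d*Real.cos s)*R)/4 with hα
  set γ : ℝ → ℝ := fun s => ((ν+d*Real.cos s)/R+2*d*Real.sin s+(ν-d*Real.cos s)*R)/4 with hγ
  have hdiv : ∀ x, x / R = x * (c - μ) := fun x => by rw [hc]; ring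
  have hRc : (c - μ)*(c + μ) = 1 := by rw [hc, hμ]; field_simp
  have hβ : ∀ s, -(((ν+d*Real.cos s)/R-(ν-d*Real.cos s)*R)/2) = 33 - 64*Real.cos s := fun s => by
    rw [hdiv, ← hμ, ← hcd, ← hμν]
    ring
  have hprod : ∀ s, α s * γ s = ((33 - 64*Real.cos s)^2-1)/4 := fun s => by
    have h1 := Real.sin_sq_add_cos_sq s
    rw [← hβ, hα, hγ]
    simp only [hdiv]
    simp only [← hμ]
    linear_combination (ν+d*Real.cos s)*(ν-d*Real.cos s)/4 * hRc - d^2/4*h1 - hd/4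
  have hsum : ∀ s, 0 < α s + γ s := fun s => by
    have e : α s + γ s = ν*c - d*μ*Real.cos s := by
      simp only [hα, hγ, hdiv]
      simp only [← hμ]
      ring
    have h1 := Real.abs_cos_le_one s
    have h2 : d*μ*Real.cos s ≤ |d*μ| := (le_abs_self _).trans (by
      rw [abs_mul]
      exact mul_le_of_le_one_right (abs_nonneg _) h1)
    rw [e]
    linarith
  have hconv : ∀ ε ε' : ℝ, ∫⁻ s in Ioo 0 (2*Real.pi), 2 * ∫⁻ τ, eisq (ε * (R - τ^2/R)) *
      eisq (ε' * ((ν + d * Real.cos s) + 2 * d * Real.sin s * τ + (ν - d * Real.cos s) * τ^2)) =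
      (∫⁻ φ in Ioo (-Real.pi) Real.pi, eisq (ε * (μ + c * Real.cos φ))) *
        ∫⁻ φ in Ioo (-Real.pi) Real.pi, eisq (ε' * (ν + d * Real.cos φ)) := fun ε ε' => by
    rw [← lintegral_circle_conv (by fun_prop) (by fun_prop)
      (fun x => by rw [Real.cos_add_two_pi])]
    exact lintegral_congr fun s => (lintegral_eisq_eisq_half hμ hc ε ε').symm
  have hpos : ∫⁻ s in Ioo 0 (2*Real.pi), ellG (-α s) (33 - 64*Real.cos s) (-γ s) =
      (∫⁻ φ in Ioo (-Real.pi) Real.pi, eisq (μ + c * Real.cos φ)) *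
        ∫⁻ φ in Ioo (-Real.pi) Real.pi, eisq (-ν + d * Real.cos φ) := by
    rw [← lintegral_eisq_neg_shift]
    have := hconv 1 (-1)
    simp only [one_mul, neg_one_mul] at this
    rw [← this]
    refine lintegral_congr fun s => ?_
    rw [lintegral_quad_pos hR, hβ]
  have hneg : ∫⁻ s in Ioo 0 (2*Real.pi), ellG (α s) (33 - 64*Real.cos s) (γ s) =
      (∫⁻ φ in Ioo (-Real.pi) Real.pi, eisq (-μ + c * Real.cos φ)) *
        ∫⁻ φ in Ioo (-Real.pi) Real.pi, eisq (ν + d * Real.cos φ) := by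
    rw [← lintegral_eisq_neg_shift]
    have := hconv (-1) 1
    simp only [one_mul, neg_one_mul] at this
    rw [← this]
    refine lintegral_congr fun s => ?_
    rw [lintegral_quad_neg hR, hβ]
  have hdbl : ∀ F : ℝ → ENNReal, ∫⁻ s in Ioo 0 (2*Real.pi), F s =
      2 * ∫⁻ A in Ioo 0 Real.pi, F (2*A) := fun F => by
    rw [lintegral_cov (s := Ioo 0 Real.pi) (t := Ioo 0 (2*Real.pi)) (fun x => 2*x)
      (fun _ => 2) (fun x => x/2) measurableSet_Ioo
      (fun x _ => by simpa using (hasDerivAt_id x).const_mul 2)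
      (fun x hx => ⟨by linarith [hx.1], by linarith [hx.2]⟩) (by simp)
      (fun x hx => ⟨by linarith [hx.1], by linarith [hx.2]⟩) (fun x _ => by ring)]
    rw [lintegral_const_mul' _ _ (by simp)]
    simp
  have hmeas : Measurable fun s => ellG (α s) (33 - 64*Real.cos s) (γ s) := by
    unfold ellG
    refine Measurable.lintegral_prod_right ?_
    fun_prop
  have hM : ∀ᵐ A, A ∈ Ioo 0 Real.pi → 2 * fibre A =
      ellG (α (2*A)) (33 - 64*Real.cos (2*A)) (γ (2*A)) +
        3 * ellG (-α (2*A)) (33 - 64*Real.cos (2*A)) (-γ (2*A)) := by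
    filter_upwards [ae_cos_sq_ne (49/64), ae_cos_sq_ne (48/64)] with A h1 h2 hA
    have hab : (8*(1+Real.cos A)-1) * (8*(1-Real.cos A)-1) = 49 - 64*Real.cos A^2 := by ring
    have hb : 33 - 64*Real.cos (2*A) =
        2*((8*(1+Real.cos A)-1) * (8*(1-Real.cos A)-1)) - 1 := by
      rw [Real.cos_two_mul]; ring
    rw [fibre, ← ellG_eq_prod, hb]
    refine two_mul_ellG (by linarith) ?_ ?_ ?_ (hsum _)
    · rw [hab]
      intro h
      exact h1 hA (by linarith)
    · rw [hab]
      intro h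
      exact h2 hA (by linarith)
    · rw [hprod, hb]
      ring
  have h2 : (2:ENNReal) * ∫⁻ A in Ioo 0 Real.pi, fibre A =
      (∫⁻ A in Ioo 0 Real.pi, ellG (α (2*A)) (33 - 64*Real.cos (2*A)) (γ (2*A))) +
        3 * ∫⁻ A in Ioo 0 Real.pi, ellG (-α (2*A)) (33 - 64*Real.cos (2*A)) (-γ (2*A)) := by
    rw [← lintegral_const_mul' _ _ (by simp), ← lintegral_const_mul' _ _ (by simp),
      ← lintegral_add_left (by exact hmeas.comp (measurable_const_mul 2))]
    exact lintegral_congr_ae ((ae_restrict_iff' measurableSet_Ioo).2 hM)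
  rw [← hpos, ← hneg, hdbl, hdbl, show (4:ENNReal) = 2*2 by norm_num, mul_assoc, h2]
  ring

/-- The integral of the fibre periods in closed form. -/
theorem lintegral_fibre_eq :
    ∫⁻ A in Ioo 0 Real.pi, fibre A =
      ENNReal.ofReal (Real.pi^2 * √15 / 8 * (th3 (√(5/3))^2 * th3 (√15)^2)) := by
  obtain ⟨h1, h2, h3⟩ := theta_values (ya := √(5/3)) (yb := √15) rfl rfl
  have hya : 0 < √(5/3) := by positivity
  have hyb : 0 < √15 := by positivity
  have hy : 3 * √(5/3) = √15 := by
    rw [show (15:ℝ) = 3^2*(5/3) by norm_num, Real.sqrt_mul (by norm_num), Real.sqrt_sq (by norm_num)]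
  generalize √(5/3) = ya at *
  generalize √15 = yb at *
  have a2 := th2_pos hya
  have a3 := th3_pos hya
  have a4 := th4_pos hya
  have b2 := th2_pos hyb
  have b3 := th3_pos hyb
  have b4 := th4_pos hyb
  have ea := th3_pow_four hya
  have eb := th3_pow_four hyb
  have hP : (th2 ya*th4 ya)^2 * (th2 yb*th4 yb)^2 = th3 ya^4*th3 yb^4/256 := by
    rw [← mul_pow, h1]; ring
  set μ := (th4 ya^4 - th2 ya^4)/(2*(th2 ya*th4 ya)^2) with hμ
  set c := th3 ya^4/(2*(th2 ya*th4 ya)^2) with hc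
  set ν := (th4 yb^4 - th2 yb^4)/(2*(th2 yb*th4 yb)^2) with hν
  set d := th3 yb^4/(2*(th2 yb*th4 yb)^2) with hd
  have ha1 : c + μ = th4 ya^2/th2 ya^2 := by
    rw [hc, hμ, ea]; field_simp; ring
  have ha2 : c - μ = th2 ya^2/th4 ya^2 := by
    rw [hc, hμ, ea]; field_simp; ring
  have hb1 : d + ν = th4 yb^2/th2 yb^2 := by
    rw [hd, hν, eb]; field_simp; ring
  have hb2 : d - ν = th2 yb^2/th4 yb^2 := by
    rw [hd, hν, eb]; field_simp; ring
  have hcd : c * d = 64 := by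
    rw [hc, hd, div_mul_div_comm, mul_mul_mul_comm, hP]
    field_simp
    norm_num
  have hμν : μ * ν = 33 := by
    rw [hμ, hν, div_mul_div_comm, mul_mul_mul_comm, hP, h2]
    field_simp
    norm_num
  have hd2 : d^2 = 1 + ν^2 := by
    have : (d+ν)*(d-ν) = 1 := by rw [hb1, hb2]; field_simp
    linear_combination this
  have hs : |d*μ| < ν*c := by
    have e1 : d*μ = th3 yb^4 * (th4 ya^4 - th2 ya^4) /
        (2*(th2 ya*th4 ya)^2*(2*(th2 yb*th4 yb)^2)) := by rw [hd, hμ]; field_simp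
    have e2 : ν*c = (th4 yb^4 - th2 yb^4) * th3 ya^4 /
        (2*(th2 ya*th4 ya)^2*(2*(th2 yb*th4 yb)^2)) := by rw [hν, hc]; field_simp
    rw [e1, e2, abs_div, abs_of_pos (by positivity : (0:ℝ) <
      2*(th2 ya*th4 ya)^2*(2*(th2 yb*th4 yb)^2)), abs_mul, abs_of_pos (by positivity), mul_comm]
    gcongr
  have h := lintegral_fibre (R := th4 ya^2/th2 ya^2) (by positivity) ha1
    (by rw [ha2, one_div_div]) hcd hμν hd2 hs
  rw [lintegral_eisq_cos_pos hya ha1 ha2, lintegral_eisq_cos_neg hya ha1 ha2,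
    lintegral_eisq_cos_pos hyb hb1 hb2, lintegral_eisq_cos_neg hyb hb1 hb2,
    show (3:ENNReal) = ENNReal.ofReal 3 by simp, ← ENNReal.ofReal_mul (by positivity),
    ← ENNReal.ofReal_mul (by positivity), ← ENNReal.ofReal_mul (by positivity),
    ← ENNReal.ofReal_add (by positivity) (by positivity)] at h
  have e : 2 * Real.pi * (th2 ya * th4 ya) * (2 * Real.pi * yb * (th2 yb * th4 yb)) +
      3 * (2 * Real.pi * ya * (th2 ya * th4 ya) * (2 * Real.pi * (th2 yb * th4 yb))) =
      4 * (Real.pi^2 * yb / 8 * (th3 ya^2 * th3 yb^2)) := by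
    linear_combination 8*Real.pi^2*yb * h1 + 4*Real.pi^2*(th2 ya*th4 ya*(th2 yb*th4 yb)) * hy
  rw [e, ENNReal.ofReal_mul (by norm_num), show ENNReal.ofReal 4 = 4 by simp] at h
  exact (ENNReal.mul_right_inj (by norm_num) (by norm_num)).1 h

noncomputable def csq (z : ℂ) : ℂ := z ^ (((-1 / 2 : ℝ)) : ℂ)

lemma norm_csq (z : ℂ) : ‖csq z‖ = isq ‖z‖ := by
  rw [csq, Complex.norm_cpow_real, isq, Real.sqrt_eq_rpow, ← Real.rpow_neg (norm_nonneg _)]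
  norm_num

lemma csq_mul_self (z : ℂ) : csq z * csq z = z⁻¹ := by
  rcases eq_or_ne z 0 with rfl | hz
  · simp [csq]
  · rw [csq, ← Complex.cpow_add _ _ hz, ← Complex.cpow_neg_one]
    norm_num

lemma csq_ofReal {t : ℝ} (ht : 0 ≤ t) : csq (t : ℂ) = (isq t : ℂ) := by
  rw [csq, ← Complex.ofReal_cpow ht, isq, Real.sqrt_eq_rpow, ← Real.rpow_neg ht]
  norm_num

lemma csq_conj {z : ℂ} (hz : z ∈ Complex.slitPlane) :
    csq (starRingEnd ℂ z) = starRingEnd ℂ (csq z) := by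
  rw [csq, csq, Complex.conj_cpow _ _ (Complex.slitPlane_arg_ne_pi hz), Complex.conj_ofReal]

lemma hasDerivAt_csq {z : ℂ} (hz : z ∈ Complex.slitPlane) :
    HasDerivAt csq (-(1 / 2) * (z⁻¹ * csq z)) z := by
  have h := (hasDerivAt_id z).cpow_const (c := (((-1 / 2 : ℝ)) : ℂ)) hz
  refine h.congr_deriv ?_
  have hz0 := Complex.slitPlane_ne_zero hz
  rw [id, Complex.cpow_sub _ _ hz0]
  simp only [csq, Complex.cpow_one]
  push_cast
  field_simp

lemma continuousAt_csq {z : ℂ} (hz : z ∈ Complex.slitPlane) : ContinuousAt csq z :=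
  (hasDerivAt_csq hz).continuousAt

/-- The integrand of `kk`. -/
noncomputable def kkf (w : ℂ) (t : ℝ) : ℂ :=
  (Real.exp (-t ^ 2) : ℂ) * csq ((t : ℂ) ^ 2 + 2 * w)

noncomputable def kk (w : ℂ) : ℂ := ∫ t : ℝ, kkf w t

lemma sq_add_mem_slitPlane {w : ℂ} (hw : w ∈ Complex.slitPlane) (t : ℝ) :
    (t : ℂ) ^ 2 + 2 * w ∈ Complex.slitPlane := by
  rw [Complex.mem_slitPlane_iff] at *
  rw [← Complex.ofReal_pow]
  simp only [Complex.add_re, Complex.ofReal_re, Complex.mul_re, Complex.add_im, Complex.ofReal_im,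
    Complex.mul_im, Complex.re_ofNat, Complex.im_ofNat]
  rcases hw with h | h
  · left; nlinarith [sq_nonneg t]
  · right; simpa using h

lemma continuous_kkf {w : ℂ} (hw : w ∈ Complex.slitPlane) : Continuous (kkf w) := by
  unfold kkf
  refine Continuous.mul (by fun_prop) ?_
  rw [continuous_iff_continuousAt]
  intro t
  exact ContinuousAt.comp (f := fun t : ℝ => (t : ℂ) ^ 2 + 2 * w)
    (continuousAt_csq (sq_add_mem_slitPlane hw t)) (by fun_prop)

lemma exists_le_norm_sq_add {w : ℂ} (hw : w ∈ Complex.slitPlane) :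
    ∃ ε > 0, ∀ w' ∈ Metric.ball w ε, w' ∈ Complex.slitPlane ∧
      ∀ t : ℝ, ε ≤ ‖(t : ℂ) ^ 2 + 2 * w'‖ := by
  obtain ⟨ε, hε, hb⟩ := Metric.isOpen_iff.1 Complex.isOpen_slitPlane w hw
  refine ⟨ε / 2, by positivity, fun w' hw' => ⟨hb ?_, fun t => ?_⟩⟩
  · exact Metric.ball_subset_ball (by linarith) hw'
  · have h1 : (-(t ^ 2 / 2 : ℝ) : ℂ) ∉ Metric.ball w ε := by
      intro h
      have := hb h
      rw [Complex.mem_slitPlane_iff] at this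
      simp only [Complex.neg_re, Complex.ofReal_re, Complex.neg_im, Complex.ofReal_im] at this
      rcases this with h | h
      · nlinarith [sq_nonneg t]
      · simp at h
    rw [Metric.mem_ball, dist_eq_norm, not_lt] at h1
    rw [Metric.mem_ball, dist_eq_norm] at hw'
    have h2 : ‖(-(t ^ 2 / 2 : ℝ) : ℂ) - w‖ ≤ ‖(t : ℂ) ^ 2 + 2 * w'‖ / 2 + ‖w' - w‖ := by
      have : (-(t ^ 2 / 2 : ℝ) : ℂ) - w = -(((t : ℂ) ^ 2 + 2 * w') / 2) + (w' - w) := by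
        push_cast; ring
      rw [this]
      refine (norm_add_le _ _).trans ?_
      simp
    linarith

lemma integrable_exp_neg_sq : Integrable fun t : ℝ => Real.exp (-t ^ 2) := by
  simpa using integrable_exp_neg_mul_sq (b := 1) one_pos

lemma hasDerivAt_kk {w : ℂ} (hw : w ∈ Complex.slitPlane) : DifferentiableAt ℂ kk w := by
  obtain ⟨ε, hε, hb⟩ := exists_le_norm_sq_add hw
  have key := hasDerivAt_integral_of_dominated_loc_of_deriv_le (μ := volume) (𝕜 := ℂ)
    (F := fun w t => kkf w t)
    (F' := fun w t => (Real.exp (-t ^ 2) : ℂ) *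
      (-(1 / 2) * ((((t : ℂ) ^ 2 + 2 * w))⁻¹ * csq ((t : ℂ) ^ 2 + 2 * w)) * 2))
    (x₀ := w) (s := Metric.ball w ε) (bound := fun t => Real.exp (-t ^ 2) * (ε⁻¹ * isq ε))
    (Metric.ball_mem_nhds w hε) ?_ ?_ ?_ ?_ ?_ ?_
  · exact key.2.differentiableAt
  · filter_upwards [Metric.ball_mem_nhds w hε] with w' hw'
    exact (continuous_kkf (hb w' hw').1).aestronglyMeasurable
  · refine (integrable_exp_neg_sq.mul_const (isq ε)).mono'
      (continuous_kkf hw).aestronglyMeasurable (Filter.Eventually.of_forall fun t => ?_)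
    rw [kkf, norm_mul, norm_csq, Complex.norm_real, Real.norm_eq_abs, Real.abs_exp]
    gcongr
    exact isq_anti hε ((hb w (Metric.mem_ball_self hε)).2 t)
  · have h1 : (fun t : ℝ => (Real.exp (-t ^ 2) : ℂ) *
      (-(1 / 2) * ((((t : ℂ) ^ 2 + 2 * w))⁻¹ * csq ((t : ℂ) ^ 2 + 2 * w)) * 2)) =
      fun t : ℝ => -(((t : ℂ) ^ 2 + 2 * w))⁻¹ * kkf w t := by
      funext t; rw [kkf]; ring
    rw [h1]
    refine Continuous.aestronglyMeasurable (Continuous.mul ?_ (continuous_kkf hw))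
    refine (Continuous.inv₀ (by fun_prop) fun t => ?_).neg
    exact Complex.slitPlane_ne_zero (sq_add_mem_slitPlane hw t)
  · refine Filter.Eventually.of_forall fun t w' hw' => ?_
    have h := (hb w' hw').2 t
    rw [norm_mul, Complex.norm_real, Real.norm_eq_abs, Real.abs_exp]
    gcongr
    rw [norm_mul, norm_mul, norm_mul, norm_csq, norm_inv]
    have h2 : ‖(-(1 / 2) : ℂ)‖ * ‖(2 : ℂ)‖ = 1 := by simp
    calc _ = (‖(-(1 / 2) : ℂ)‖ * ‖(2 : ℂ)‖) * (‖(t : ℂ) ^ 2 + 2 * w'‖⁻¹ *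
            isq ‖(t : ℂ) ^ 2 + 2 * w'‖) := by ring
      _ ≤ _ := by
        rw [h2, one_mul]
        exact mul_le_mul (inv_anti₀ hε h) (isq_anti hε h) (isq_nonneg _) (by positivity)
  · exact integrable_exp_neg_sq.mul_const _
  · refine Filter.Eventually.of_forall fun t w' hw' => ?_
    have h1 : HasDerivAt (fun w : ℂ => (t : ℂ) ^ 2 + 2 * w) 2 w' := by
      simpa using ((hasDerivAt_id w').const_mul (2 : ℂ)).const_add ((t : ℂ) ^ 2)
    exact ((hasDerivAt_csq (sq_add_mem_slitPlane (hb w' hw').1 t)).comp w' h1).const_mul _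

lemma kk_conj {w : ℂ} (hw : w ∈ Complex.slitPlane) :
    kk (starRingEnd ℂ w) = starRingEnd ℂ (kk w) := by
  rw [kk, kk, ← integral_conj]
  congr 1
  funext t
  rw [kkf, kkf, map_mul, Complex.conj_ofReal, ← csq_conj (sq_add_mem_slitPlane hw t)]
  simp [Complex.conj_ofNat]

lemma exp_neg_le_rpow {a s : ℝ} (ha : 0 ≤ a) (ha1 : a ≤ 1) (hs : 0 < s) :
    Real.exp (-s) ≤ s ^ (-a) := by
  rw [Real.rpow_neg hs.le, Real.exp_neg]
  refine inv_anti₀ (Real.rpow_pos_of_pos hs a) ?_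
  rcases le_total s 1 with h | h
  · exact (Real.rpow_le_one hs.le h ha).trans (by linarith [Real.add_one_le_exp s])
  · exact (Real.rpow_le_rpow_of_exponent_le h ha1).trans
      (by rw [Real.rpow_one]; linarith [Real.add_one_le_exp s])

/-- The scale-free majorant of the integrand of `kk`. -/
noncomputable def kmaj (a t : ℝ) : ℝ := |t| ^ (-(2 * a)) * isq |t ^ 2 - 1|

lemma kmaj_nonneg (a t : ℝ) : 0 ≤ kmaj a t :=
  mul_nonneg (Real.rpow_nonneg (abs_nonneg t) _) (isq_nonneg _)

lemma measurable_kmaj (a : ℝ) : Measurable (kmaj a) := by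
  unfold kmaj
  exact (measurable_id.abs.pow_const _).mul (measurable_isq.comp (by fun_prop))

lemma isq_eq_rpow {t : ℝ} (ht : 0 ≤ t) : isq t = t ^ (-1 / 2 : ℝ) := by
  rw [isq, Real.sqrt_eq_rpow, ← Real.rpow_neg ht]
  norm_num

lemma integrableOn_isq_abs_sub (c a b : ℝ) : IntegrableOn (fun t => isq |t - c|) (Ioc a b) := by
  have h0 : ∀ a : ℝ, IntervalIntegrable (fun t => isq |t|) volume 0 a := by
    have hp : ∀ a : ℝ, 0 ≤ a → IntervalIntegrable (fun t => isq |t|) volume 0 a := by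
      intro a ha
      refine (intervalIntegral.intervalIntegrable_rpow' (r := -1 / 2) (by norm_num)).congr ?_
      intro t ht
      rw [uIoc_of_le ha] at ht
      simp only
      rw [abs_of_pos ht.1, isq_eq_rpow ht.1.le]
    intro a
    rcases le_total 0 a with h | h
    · exact hp a h
    · have := (hp (-a) (by linarith)).comp_mul_left (c := -1)
      simpa using this
  have h1 : IntervalIntegrable (fun t => isq |t|) volume (a - c) (b - c) :=
    (h0 (a - c)).symm.trans (h0 (b - c))
  have h2 := h1.comp_sub_right c
  simp only [sub_add_cancel] at h2
  exact h2.1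

lemma integrable_kmaj {a : ℝ} (ha : 0 < a) (ha1 : a < 1 / 2) : Integrable (kmaj a) := by
  have hneg : ∀ t, kmaj a (-t) = kmaj a t := fun t => by simp [kmaj]
  have h1 : IntegrableOn (kmaj a) (Ioc 0 (1 / 2)) := by
    have hi : IntegrableOn (fun t : ℝ => t ^ (-(2 * a)) * isq (3 / 4)) (Ioc 0 (1 / 2)) :=
      ((intervalIntegral.intervalIntegrable_rpow' (by linarith)).1).mul_const _
    refine hi.mono' (measurable_kmaj a).aestronglyMeasurable ?_
    refine (ae_restrict_iff' measurableSet_Ioc).2 (Filter.Eventually.of_forall fun t ht => ?_)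
    rw [Real.norm_of_nonneg (kmaj_nonneg a t), kmaj, abs_of_pos ht.1]
    refine mul_le_mul_of_nonneg_left ?_ (Real.rpow_nonneg ht.1.le _)
    apply isq_anti (by norm_num)
    rw [abs_of_nonpos (by nlinarith [ht.1, ht.2])]
    nlinarith [ht.1, ht.2]
  have h2 : IntegrableOn (kmaj a) (Ioc (1 / 2) 2) := by
    have hi := (integrableOn_isq_abs_sub 1 (1 / 2) 2).const_mul ((1 / 2 : ℝ) ^ (-(2 * a)))
    refine hi.mono' (measurable_kmaj a).aestronglyMeasurable ?_
    refine (ae_restrict_iff' measurableSet_Ioc).2 (Filter.Eventually.of_forall fun t ht => ?_)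
    have ht0 : 0 < t := by linarith [ht.1]
    rw [Real.norm_of_nonneg (kmaj_nonneg a t), kmaj, abs_of_pos ht0]
    refine mul_le_mul ?_ ?_ (isq_nonneg _) (Real.rpow_nonneg (by norm_num) _)
    · exact Real.rpow_le_rpow_of_nonpos (by norm_num) ht.1.le (by linarith)
    · rcases eq_or_ne t 1 with rfl | h
      · norm_num
      · apply isq_anti (abs_pos.2 (sub_ne_zero.2 h))
        have : t ^ 2 - 1 = (t - 1) * (t + 1) := by ring
        rw [this, abs_mul, abs_of_pos (by linarith : 0 < t + 1)]
        nlinarith [abs_nonneg (t - 1)]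
  have h3 : IntegrableOn (kmaj a) (Ioi 2) := by
    have hi := (integrableOn_Ioi_rpow_of_lt (a := -(2 * a) - 1) (c := 2) (by linarith)
      two_pos).const_mul 2
    refine hi.mono' (measurable_kmaj a).aestronglyMeasurable ?_
    refine (ae_restrict_iff' measurableSet_Ioi).2 (Filter.Eventually.of_forall fun t ht => ?_)
    have ht2 : 2 < t := ht
    have ht0 : 0 < t := by linarith
    rw [Real.norm_of_nonneg (kmaj_nonneg a t), kmaj, abs_of_pos ht0, Real.rpow_sub_one ht0.ne']
    have : isq |t ^ 2 - 1| ≤ 2 * t⁻¹ := by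
      have e : isq ((t / 2) ^ 2) = 2 * t⁻¹ := by
        rw [isq_sq (by positivity)]; field_simp
      rw [← e]
      apply isq_anti (by positivity)
      rw [abs_of_nonneg (by nlinarith)]
      nlinarith
    calc _ ≤ t ^ (-(2 * a)) * (2 * t⁻¹) := by gcongr
      _ = _ := by rw [div_eq_mul_inv]; ring
  have hI : IntegrableOn (kmaj a) (Ioi 0) := by
    rw [← Ioc_union_Ioi_eq_Ioi (by norm_num : (0:ℝ) ≤ 1 / 2),
      ← Ioc_union_Ioi_eq_Ioi (by norm_num : (1 / 2 : ℝ) ≤ 2)]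
    exact h1.union (h2.union h3)
  have hI' : IntegrableOn (kmaj a) (Iio 0) := by
    have := ((Measure.measurePreserving_neg (volume : Measure ℝ)).integrableOn_comp_preimage
      (MeasurableEquiv.neg ℝ).measurableEmbedding).2 hI
    have e1 : Neg.neg ⁻¹' Ioi (0 : ℝ) = Iio 0 := by ext; simp
    have e2 : kmaj a ∘ Neg.neg = kmaj a := funext hneg
    rwa [e1, e2] at this
  have := hI'.union ((integrableOn_Ici_iff_integrableOn_Ioi (by finiteness)).2 hI)
  rwa [Iio_union_Ici, integrableOn_univ] at this

lemma norm_kkf_le {a : ℝ} (ha : 0 < a) (ha1 : a < 1 / 2) {w : ℂ} (hw : w ≠ 0) :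
    ∀ᵐ t : ℝ, ‖kkf w t‖ ≤ √(2 * ‖w‖) ^ (-(2 * a) - 1) * kmaj a (t / √(2 * ‖w‖)) := by
  set c := √(2 * ‖w‖) with hc
  have hw' := norm_pos_iff.2 hw
  have hc0 : 0 < c := Real.sqrt_pos.2 (by positivity)
  have hc2 : c ^ 2 = 2 * ‖w‖ := Real.sq_sqrt (by positivity)
  have hn : ({0, c, -c} : Set ℝ)ᶜ ∈ ae volume :=
    compl_mem_ae_iff.2 (Set.Finite.measure_zero (by simp) _)
  filter_upwards [hn] with t ht
  simp only [mem_compl_iff, mem_insert_iff, mem_singleton_iff, not_or] at ht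
  have h1 : isq ‖(t : ℂ) ^ 2 + 2 * w‖ ≤ isq |t ^ 2 - c ^ 2| := by
    refine isq_anti (abs_pos.2 ?_) ?_
    · have : t ^ 2 - c ^ 2 = (t - c) * (t + c) := by ring
      rw [this]
      exact mul_ne_zero (sub_ne_zero.2 ht.2.1) (fun h => ht.2.2 (by linarith))
    · have := abs_norm_sub_norm_le ((t : ℂ) ^ 2) (-(2 * w))
      rw [sub_neg_eq_add, norm_neg, norm_mul, norm_pow, Complex.norm_real, Real.norm_eq_abs,
        sq_abs, Complex.norm_ofNat] at this
      rwa [hc2]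
  have h2 : Real.exp (-t ^ 2) ≤ |t| ^ (-(2 * a)) := by
    refine (exp_neg_le_rpow ha.le (by linarith) (sq_pos_of_ne_zero ht.1)).trans ?_
    rw [← sq_abs, ← Real.rpow_natCast, ← Real.rpow_mul (abs_nonneg t)]
    push_cast
    rw [mul_neg]
  have h3 : c ^ (-(2 * a) - 1) * kmaj a (t / c) = |t| ^ (-(2 * a)) * isq |t ^ 2 - c ^ 2| := by
    have e : t ^ 2 - c ^ 2 = c ^ 2 * ((t / c) ^ 2 - 1) := by field_simp
    rw [e, abs_mul, abs_of_nonneg (sq_nonneg c), isq_mul (sq_nonneg c), isq_sq hc0.le, kmaj, abs_div,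
      abs_of_pos hc0, Real.div_rpow (abs_nonneg t) hc0.le, Real.rpow_sub_one hc0.ne']
    have := (Real.rpow_pos_of_pos hc0 (-(2 * a))).ne'
    field_simp
  rw [h3, kkf, norm_mul, Complex.norm_real, Real.norm_eq_abs, Real.abs_exp, norm_csq]
  exact mul_le_mul h2 h1 (isq_nonneg _) (Real.rpow_nonneg (abs_nonneg t) _)

lemma norm_kk_le {a : ℝ} (ha : 0 < a) (ha1 : a < 1 / 2) {w : ℂ} (hw : w ≠ 0) :
    ‖kk w‖ ≤ (∫ t, kmaj a t) * ‖w‖ ^ (-a) := by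
  set c := √(2 * ‖w‖) with hc
  have hw' := norm_pos_iff.2 hw
  have hc0 : 0 < c := Real.sqrt_pos.2 (by positivity)
  have hi := ((integrable_kmaj ha ha1).comp_div hc0.ne').const_mul (c ^ (-(2 * a) - 1))
  refine (norm_integral_le_of_norm_le hi (norm_kkf_le ha ha1 hw)).trans ?_
  rw [integral_const_mul, Measure.integral_comp_div, abs_of_pos hc0, smul_eq_mul,
    Real.rpow_sub_one hc0.ne', mul_comm (∫ t, kmaj a t), ← mul_assoc,
    div_mul_cancel₀ _ hc0.ne']
  refine mul_le_mul_of_nonneg_right ?_ (integral_nonneg (kmaj_nonneg a))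
  rw [hc, Real.sqrt_eq_rpow, ← Real.rpow_mul (by positivity)]
  have : (1 / 2 * -(2 * a) : ℝ) = -a := by ring
  rw [this]
  exact Real.rpow_le_rpow_of_nonpos hw' (by linarith) (by linarith)

lemma sq_le_sinh_sq (x : ℝ) : x ^ 2 ≤ Real.sinh x ^ 2 := by
  have h : ∀ x : ℝ, 0 ≤ x → x ^ 2 ≤ Real.sinh x ^ 2 := fun x hx =>
    pow_le_pow_left₀ hx (Real.self_le_sinh_iff.2 hx) 2
  rcases le_total 0 x with hx | hx
  · exact h x hx
  · simpa using h (-x) (by linarith)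

lemma cosh_eq_one_add (u : ℝ) : Real.cosh u = 1 + 2 * Real.sinh (u / 2) ^ 2 := by
  have h := Real.cosh_two_mul (u / 2)
  rw [Real.cosh_sq, mul_div_cancel₀ _ (two_ne_zero)] at h
  linarith

lemma one_add_sq_le_cosh (u : ℝ) : 1 + u ^ 2 / 2 ≤ Real.cosh u := by
  rw [cosh_eq_one_add]
  have := sq_le_sinh_sq (u / 2)
  nlinarith

lemma integrable_exp_neg_mul_cosh {r : ℝ} (hr : 0 < r) :
    Integrable fun u : ℝ => Real.exp (-r * Real.cosh u) := by
  refine (integrable_exp_neg_mul_sq (b := r / 2) (by positivity)).mono'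
    (by fun_prop) (Filter.Eventually.of_forall fun u => ?_)
  rw [Real.norm_eq_abs, Real.abs_exp, Real.exp_le_exp]
  nlinarith [one_add_sq_le_cosh u, sq_nonneg u]

/-- Twice the Macdonald function of order zero on the right half-plane. -/
noncomputable def bKc (z : ℂ) : ℂ := ∫ u : ℝ, Complex.exp (-z * Real.cosh u)

/-- The Macdonald function of order zero on the slit plane. -/
noncomputable def bK (z : ℂ) : ℂ := Complex.exp (-z) * kk z

lemma differentiableOn_bK : DifferentiableOn ℂ bK Complex.slitPlane := fun z hz =>
  (DifferentiableAt.mul (by fun_prop) (hasDerivAt_kk hz)).differentiableWithinAt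

lemma differentiableOn_integral_exp {μ : Measure ℝ} {X : ℝ → ℝ}
    (h : ∀ r : ℝ, 0 < r → Integrable (fun u => Real.exp (r * X u)) μ) :
    DifferentiableOn ℂ (fun z : ℂ => ∫ u, Complex.exp (z * X u) ∂μ) {z | 0 < z.re} := by
  refine (ProbabilityTheory.differentiableOn_complexMGF (X := X) (μ := μ)).mono fun z hz => ?_
  have : Ioi 0 ⊆ ProbabilityTheory.integrableExpSet X μ := fun r hr => h r hr
  exact interior_maximal this isOpen_Ioi hz

lemma isOpen_re_pos : IsOpen {z : ℂ | 0 < z.re} := isOpen_lt continuous_const Complex.continuous_re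

lemma isOpen_im_pos : IsOpen {z : ℂ | 0 < z.im} := isOpen_lt continuous_const Complex.continuous_im

lemma differentiableOn_bKc : DifferentiableOn ℂ bKc {z | 0 < z.re} := by
  have := differentiableOn_integral_exp (μ := volume) (X := fun u => -Real.cosh u)
    (fun r hr => by simpa using integrable_exp_neg_mul_cosh hr)
  refine this.congr fun z _ => ?_
  rw [bKc]
  congr 1; funext u; congr 1; push_cast; ring

lemma bK_ofReal {r : ℝ} (hr : 0 < r) : bK r = bKc r / 2 := by
  set c := √(2 * r) with hc
  have hc0 : 0 < c := Real.sqrt_pos.2 (by positivity)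
  have hc2 : c ^ 2 = 2 * r := Real.sq_sqrt (by positivity)
  have him : (fun v : ℝ => c * Real.sinh v) '' univ = univ := by
    rw [image_univ, range_eq_univ]
    intro y
    obtain ⟨v, hv⟩ := Real.sinh_surjective (y / c)
    exact ⟨v, by simp only [hv]; field_simp⟩
  have h := integral_image_eq_integral_abs_deriv_smul (s := univ) (f := fun v => c * Real.sinh v)
    (f' := fun v => c * Real.cosh v) MeasurableSet.univ
    (fun v _ => ((Real.hasDerivAt_sinh v).const_mul c).hasDerivWithinAt)
    (fun x _ y _ hxy => Real.sinh_injective (mul_left_cancel₀ hc0.ne' hxy)) (kkf r)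
  rw [him, setIntegral_univ, setIntegral_univ] at h
  rw [bK, kk, h, bKc, div_eq_inv_mul, ← smul_eq_mul (2⁻¹ : ℂ)]
  have h2 := Measure.integral_comp_mul_left (fun u : ℝ => Complex.exp (-(r:ℂ) * Real.cosh u)) 2
  have h3 : (2⁻¹ : ℂ) • ∫ u : ℝ, Complex.exp (-(r:ℂ) * Real.cosh u) =
      ∫ u : ℝ, Complex.exp (-(r:ℂ) * Real.cosh (2 * u)) := by
    rw [h2, abs_of_pos (by norm_num), Complex.real_smul]
    simp
  rw [h3, ← integral_const_mul]
  congr 1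
  funext v
  have hch := Real.cosh_pos v
  have e1 : ((c * Real.sinh v : ℝ) : ℂ) ^ 2 + 2 * r = (((c * Real.cosh v) ^ 2 : ℝ) : ℂ) := by
    have : (c * Real.sinh v) ^ 2 + 2 * r = (c * Real.cosh v) ^ 2 := by
      rw [mul_pow, mul_pow, Real.cosh_sq, hc2]; ring
    rw [← this]; push_cast; ring
  have e2 : Real.cosh (2 * v) = 1 + 2 * Real.sinh v ^ 2 := by
    rw [cosh_eq_one_add]; simp
  rw [kkf, e1, csq_ofReal (by positivity), isq_sq (by positivity), e2, abs_of_pos (by positivity),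
    mul_pow, hc2]
  have e3 : Complex.exp (-(r : ℂ) * ((1 + 2 * Real.sinh v ^ 2 : ℝ) : ℂ)) =
      Complex.exp (-r) * (Real.exp (-(2 * r * Real.sinh v ^ 2)) : ℂ) := by
    rw [Complex.ofReal_exp, ← Complex.exp_add]
    congr 1; push_cast; ring
  rw [e3, Complex.real_smul]
  have : (c * Real.cosh v : ℂ) ≠ 0 := by
    exact_mod_cast (by positivity : c * Real.cosh v ≠ 0)
  push_cast at this ⊢
  field_simp
  exact div_self this

lemma re_pos_subset_slitPlane {z : ℂ} (hz : 0 < z.re) : z ∈ Complex.slitPlane := Or.inl hz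

lemma im_pos_subset_slitPlane {z : ℂ} (hz : 0 < z.im) : z ∈ Complex.slitPlane := Or.inr hz.ne'

lemma bK_eq {z : ℂ} (hz : 0 < z.re) : bK z = bKc z / 2 := by
  have h1 : AnalyticOnNhd ℂ bK {z | 0 < z.re} :=
    (differentiableOn_bK.mono fun z hz => re_pos_subset_slitPlane hz).analyticOnNhd isOpen_re_pos
  have h2 : AnalyticOnNhd ℂ (fun z => bKc z / 2) {z | 0 < z.re} :=
    (differentiableOn_bKc.div_const 2).analyticOnNhd isOpen_re_pos
  refine h1.eqOn_of_preconnected_of_frequently_eq h2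
    (convex_halfSpace_re_gt 0).isPreconnected (z₀ := 1) (by simp) ?_ hz
  have ht : Filter.Tendsto (fun n : ℕ => ((1 + 1 / ((n : ℝ) + 1) : ℝ) : ℂ)) Filter.atTop
      (nhdsWithin 1 {1}ᶜ) := by
    rw [tendsto_nhdsWithin_iff]
    constructor
    · have := (tendsto_one_div_add_atTop_nhds_zero_nat (𝕜 := ℝ)).const_add 1
      simpa [Function.comp_def] using (Complex.continuous_ofReal.tendsto _).comp this
    · refine Filter.Eventually.of_forall fun n => ?_
      have : (0:ℝ) < 1 / ((n : ℝ) + 1) := by positivity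
      simp only [mem_compl_iff, mem_singleton_iff]
      intro h
      rw [Complex.ofReal_eq_one] at h
      linarith
  exact ht.frequently (Filter.Frequently.of_forall fun n => bK_ofReal (by positivity))

/-- The circular part of the contour integral for the Macdonald function. -/
noncomputable def bG (z : ℂ) : ℂ := ∫ θ in Ioc 0 (Real.pi / 2), Complex.exp (z * Real.cos θ)

/-- The oscillatory part of the contour integral for the Macdonald function. -/
noncomputable def bH (z : ℂ) : ℂ := ∫ u in Ioi (0 : ℝ), Complex.exp (Complex.I * z * Real.sinh u)

lemma integral_even_complex {f : ℝ → ℂ} (hf : ∀ x, f (-x) = f x) (hi : Integrable f) :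
    ∫ x, f x = 2 * ∫ x in Ioi 0, f x := by
  have h := integral_comp_neg_Iic (c := 0) f
  simp only [hf, neg_zero] at h
  rw [← intervalIntegral.integral_Iic_add_Ioi (b := 0) hi.integrableOn hi.integrableOn, h]
  ring

lemma norm_exp_neg_mul_cosh (z : ℂ) (u : ℝ) :
    ‖Complex.exp (-z * Real.cosh u)‖ = Real.exp (-z.re * Real.cosh u) := by
  rw [Complex.norm_exp, Complex.re_mul_ofReal, Complex.neg_re]

lemma integrable_bKc {z : ℂ} (hz : 0 < z.re) :
    Integrable fun u : ℝ => Complex.exp (-z * Real.cosh u) :=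
  (integrable_exp_neg_mul_cosh hz).mono' (by fun_prop)
    (Filter.Eventually.of_forall fun u => (norm_exp_neg_mul_cosh z u).le)

lemma integrableOn_exp_neg_mul_sinh {y : ℝ} (hy : 0 < y) :
    IntegrableOn (fun u : ℝ => Real.exp (y * -Real.sinh u)) (Ioi 0) := by
  refine (integrableOn_exp_mul_Ioi (a := -y) (by linarith) 0).mono'
    (by fun_prop) ?_
  refine (ae_restrict_iff' measurableSet_Ioi).2 (Filter.Eventually.of_forall fun u hu => ?_)
  rw [Real.norm_eq_abs, Real.abs_exp, Real.exp_le_exp]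
  nlinarith [Real.self_le_sinh_iff.2 (le_of_lt hu)]

lemma integrableOn_bH {z : ℂ} (hz : 0 < z.im) :
    IntegrableOn (fun u : ℝ => Complex.exp (Complex.I * z * Real.sinh u)) (Ioi 0) := by
  refine (integrableOn_exp_neg_mul_sinh hz).mono' (by fun_prop) ?_
  refine Filter.Eventually.of_forall fun u => le_of_eq ?_
  rw [Complex.norm_exp, Complex.re_mul_ofReal, Complex.I_mul_re]
  ring_nf

lemma differentiableOn_bH : DifferentiableOn ℂ bH {z | 0 < z.im} := by
  have h := differentiableOn_integral_exp (μ := volume.restrict (Ioi 0))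
    (X := fun u => -Real.sinh u) (fun r hr => integrableOn_exp_neg_mul_sinh hr)
  have h2 := h.comp (s := {z : ℂ | 0 < z.im}) (f := fun z => -Complex.I * z) (by fun_prop)
    (fun z hz => by simpa using hz)
  refine h2.congr fun z _ => ?_
  rw [bH, Function.comp]
  congr 1; funext u; congr 1; push_cast; ring

lemma differentiable_bG : Differentiable ℂ bG := by
  have h := ProbabilityTheory.differentiableOn_complexMGF (X := Real.cos)
    (μ := volume.restrict (Ioc 0 (Real.pi / 2)))
  have h1 : ProbabilityTheory.integrableExpSet Real.cos
      (volume.restrict (Ioc 0 (Real.pi / 2))) = univ := by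
    refine eq_univ_of_forall fun r => ?_
    exact (Continuous.integrableOn_Icc (by fun_prop)).mono_set Ioc_subset_Icc_self
  rw [h1] at h
  simp only [interior_univ, mem_univ, Set.ofPred_true] at h
  exact differentiableOn_univ.1 h

lemma bKc_eq_of_re_pos_im_pos {z : ℂ} (hx : 0 < z.re) (hy : 0 < z.im) :
    bKc z / 2 = bH z - Complex.I * bG (-z) := by
  have hKc : bKc z = 2 * ∫ u in Ioi (0:ℝ), Complex.exp (-z * Real.cosh u) :=
    integral_even_complex (fun u => by rw [Real.cosh_neg]) (integrable_bKc hx)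
  set f : ℂ → ℂ := fun u => Complex.exp (-z * Complex.cosh u) with hf
  set s : ℝ → ℂ := fun U => ∫ y in (-(Real.pi / 2))..0, f (U + y * Complex.I) with hs
  have hrect : ∀ U : ℝ, (∫ u in (0:ℝ)..U, Complex.exp (-z * Real.cosh u)) =
      (∫ u in (0:ℝ)..U, Complex.exp (Complex.I * z * Real.sinh u)) + Complex.I * s U
        - Complex.I * bG (-z) := by
    intro U
    have h := Complex.integral_boundary_rect_eq_zero_of_differentiableOn f
      (((-(Real.pi / 2) : ℝ) : ℂ) * Complex.I) U (by
        apply Differentiable.differentiableOn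
        rw [hf]; fun_prop)
    simp only [Complex.re_ofReal_mul, Complex.I_re, mul_zero, Complex.ofReal_re,
      Complex.im_ofReal_mul, Complex.I_im, mul_one, Complex.ofReal_im, Complex.ofReal_zero, zero_mul,
      add_zero, zero_add, smul_eq_mul] at h
    have e1 : ∀ x : ℝ, f (x + ((-(Real.pi / 2) : ℝ) : ℂ) * Complex.I) =
        Complex.exp (Complex.I * z * Real.sinh x) := by
      intro x
      rw [hf]
      simp only
      rw [Complex.cosh_add, Complex.cosh_mul_I, Complex.sinh_mul_I, ← Complex.ofReal_cos,
        ← Complex.ofReal_sin]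
      rw [Real.cos_neg, Real.sin_neg, Real.cos_pi_div_two, Real.sin_pi_div_two]
      congr 1; push_cast; ring
    have e2 : ∀ x : ℝ, f x = Complex.exp (-z * Real.cosh x) := by
      intro x; rw [hf]; simp
    have e3 : (∫ y in (-(Real.pi / 2))..0, f (y * Complex.I)) = bG (-z) := by
      rw [bG, ← intervalIntegral.integral_of_le (by positivity)]
      have := intervalIntegral.integral_comp_neg (a := 0) (b := Real.pi / 2)
        (fun y : ℝ => f (y * Complex.I))
      rw [neg_zero] at this
      rw [← this]
      congr 1; funext y
      rw [hf]
      simp only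
      rw [Complex.cosh_mul_I, ← Complex.ofReal_cos, Real.cos_neg]
    simp only [e1, e2, e3] at h
    linear_combination -h
  have hs0 : Filter.Tendsto s Filter.atTop (nhds 0) := by
    set m := min z.re z.im with hm
    have hm0 : 0 < m := lt_min hx hy
    have hb : ∀ U : ℝ, 0 ≤ U → ‖s U‖ ≤ Real.exp (-m * Real.sinh U) * (Real.pi / 2) := by
      intro U hU
      have hpi := Real.pi_pos
      have := intervalIntegral.norm_integral_le_of_norm_le_const (a := -(Real.pi / 2)) (b := 0)
        (f := fun y : ℝ => f (U + y * Complex.I)) (C := Real.exp (-m * Real.sinh U)) ?_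
      · rw [zero_sub, neg_neg, abs_of_pos (by positivity)] at this
        exact this
      · intro y hy'
        rw [uIoc_of_le (by linarith)] at hy'
        rw [hf]
        simp only
        rw [Complex.norm_exp, Complex.cosh_add, Complex.cosh_mul_I, Complex.sinh_mul_I,
          ← Complex.ofReal_cos, ← Complex.ofReal_sin, ← Complex.ofReal_cosh, ← Complex.ofReal_sinh,
          Real.exp_le_exp]
        simp only [Complex.mul_re, Complex.neg_re, Complex.add_re, Complex.ofReal_re,
          Complex.ofReal_im, mul_zero, sub_zero, Complex.I_re, Complex.mul_im, Complex.I_im,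
          Complex.neg_im, Complex.add_im, mul_one, zero_mul, add_zero, zero_add]
        have hc : 0 ≤ Real.cos y := Real.cos_nonneg_of_mem_Icc ⟨by linarith [hy'.1], by linarith [hy'.2]⟩
        have hsn : 0 ≤ -Real.sin y := by
          rw [← Real.sin_neg]
          exact Real.sin_nonneg_of_nonneg_of_le_pi (by linarith [hy'.2]) (by linarith [hy'.1])
        have hsU : 0 ≤ Real.sinh U := Real.sinh_nonneg_iff.2 hU
        have h1 : 1 ≤ Real.cos y + -Real.sin y := by
          nlinarith [Real.sin_sq_add_cos_sq y, mul_nonneg hc hsn]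
        have h2 : Real.sinh U ≤ Real.cosh U := (Real.sinh_lt_cosh U).le
        have h3 : m * Real.sinh U * Real.cos y ≤ z.re * Real.cosh U * Real.cos y := by
          gcongr
          exact min_le_left _ _
        have h4 : m * Real.sinh U * -Real.sin y ≤ z.im * Real.sinh U * -Real.sin y := by
          gcongr
          exact min_le_right _ _
        have h5 : m * Real.sinh U * 1 ≤ m * Real.sinh U * (Real.cos y + -Real.sin y) := by
          gcongr
        nlinarith
    have ht : Filter.Tendsto (fun U => Real.exp (-m * Real.sinh U) * (Real.pi / 2)) Filter.atTop
        (nhds 0) := by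
      have h1 : Filter.Tendsto Real.sinh Filter.atTop Filter.atTop :=
        Real.sinhOrderIso.tendsto_atTop
      have h2 := (Real.tendsto_exp_atBot.comp
        (h1.const_mul_atTop_of_neg (by linarith : -m < 0))).mul_const (Real.pi / 2)
      simpa using h2
    rw [tendsto_zero_iff_norm_tendsto_zero]
    refine squeeze_zero' (Filter.Eventually.of_forall fun _ => norm_nonneg _) ?_ ht
    filter_upwards [Filter.eventually_ge_atTop 0] with U hU using hb U hU
  have hl := intervalIntegral_tendsto_integral_Ioi 0 (integrable_bKc hx).integrableOn
    Filter.tendsto_id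
  have hr := intervalIntegral_tendsto_integral_Ioi 0 (integrableOn_bH hy) Filter.tendsto_id
  have hr2 := (hr.add (hs0.const_mul Complex.I)).sub_const (Complex.I * bG (-z))
  have := tendsto_nhds_unique hl (hr2.congr fun U => (hrect U).symm)
  rw [hKc, this, bH]
  ring

lemma bK_eq_bH {z : ℂ} (hz : 0 < z.im) : bK z = bH z - Complex.I * bG (-z) := by
  have h1 : AnalyticOnNhd ℂ bK {z | 0 < z.im} :=
    (differentiableOn_bK.mono fun z hz => im_pos_subset_slitPlane hz).analyticOnNhd isOpen_im_pos
  have h2 : AnalyticOnNhd ℂ (fun z => bH z - Complex.I * bG (-z)) {z | 0 < z.im} := by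
    refine DifferentiableOn.analyticOnNhd (differentiableOn_bH.sub ?_) isOpen_im_pos
    exact ((differentiable_bG.comp differentiable_neg).const_mul _).differentiableOn
  refine h1.eqOn_of_preconnected_of_frequently_eq h2
    (convex_halfSpace_im_gt 0).isPreconnected (z₀ := 1 + Complex.I) (by simp) ?_ hz
  refine Filter.Eventually.frequently ?_
  refine eventually_nhdsWithin_of_eventually_nhds ?_
  filter_upwards [isOpen_re_pos.mem_nhds (show (1 + Complex.I) ∈ {z : ℂ | 0 < z.re} by simp),
    isOpen_im_pos.mem_nhds (show (1 + Complex.I) ∈ {z : ℂ | 0 < z.im} by simp)] with w h3 h4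
  rw [bK_eq h3, bKc_eq_of_re_pos_im_pos h3 h4]

/-- `π` times the modified Bessel function of order zero. -/
noncomputable def bI (z : ℂ) : ℂ := bG z + bG (-z)

lemma differentiable_bI : Differentiable ℂ bI :=
  differentiable_bG.add (differentiable_bG.comp differentiable_neg)

lemma exp_mul_kk_neg {z : ℂ} (hz : 0 < z.im) :
    Complex.exp z * kk (-z) = bK z + Complex.I * bI z := by
  set w := -(starRingEnd ℂ z) with hw
  have hwi : 0 < w.im := by simpa [hw] using hz
  have h1 : -z = starRingEnd ℂ w := by simp [hw]
  have h2 : Complex.exp z * kk (-z) = starRingEnd ℂ (bK w) := by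
    rw [h1, kk_conj (im_pos_subset_slitPlane hwi), bK, map_mul, ← Complex.exp_conj, map_neg, ← h1,
      neg_neg]
  rw [h2, bK_eq_bH hwi, bK_eq_bH hz, map_sub, map_mul, Complex.conj_I]
  have h3 : starRingEnd ℂ (bH w) = bH z := by
    rw [bH, bH, ← integral_conj]
    congr 1; funext u
    rw [← Complex.exp_conj, map_mul, map_mul, Complex.conj_I, ← h1, Complex.conj_ofReal]
    congr 1; ring
  have h4 : starRingEnd ℂ (bG (-w)) = bG z := by
    rw [bG, bG, ← integral_conj]
    congr 1; funext u
    rw [← Complex.exp_conj, map_mul, map_neg, ← h1, Complex.conj_ofReal, neg_neg]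
  rw [h3, h4, bI]
  ring

noncomputable def bL (z : ℂ) : ℂ := bK z + Complex.I * bI z

lemma differentiableOn_bL : DifferentiableOn ℂ bL Complex.slitPlane :=
  differentiableOn_bK.add (differentiable_bI.const_mul _).differentiableOn

/-- A constant valid in the decay estimates for both exponents `1/4` and `9/20`. -/
noncomputable def kC : ℝ := (∫ t, kmaj (1 / 4) t) + ∫ t, kmaj (9 / 20) t

lemma kC_nonneg : 0 ≤ kC :=
  add_nonneg (integral_nonneg (kmaj_nonneg _)) (integral_nonneg (kmaj_nonneg _))

/-- The decay majorant. -/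
noncomputable def kdec (r : ℝ) : ℝ := min (r ^ (-(1 / 4 : ℝ))) (r ^ (-(9 / 20 : ℝ)))

lemma kdec_nonneg {r : ℝ} (hr : 0 ≤ r) : 0 ≤ kdec r :=
  le_min (Real.rpow_nonneg hr _) (Real.rpow_nonneg hr _)

lemma norm_kk_le_kdec {w : ℂ} (hw : w ≠ 0) : ‖kk w‖ ≤ kC * kdec ‖w‖ := by
  have h1 := norm_kk_le (a := 1 / 4) (by norm_num) (by norm_num) hw
  have h2 := norm_kk_le (a := 9 / 20) (by norm_num) (by norm_num) hw
  have p1 : 0 ≤ ∫ t, kmaj (1 / 4) t := integral_nonneg (kmaj_nonneg _)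
  have p2 : 0 ≤ ∫ t, kmaj (9 / 20) t := integral_nonneg (kmaj_nonneg _)
  rw [kdec]
  rcases min_choice (‖w‖ ^ (-(1 / 4 : ℝ))) (‖w‖ ^ (-(9 / 20 : ℝ))) with h | h <;> rw [h]
  · refine h1.trans (mul_le_mul_of_nonneg_right ?_ (Real.rpow_nonneg (norm_nonneg _) _))
    rw [kC]; linarith
  · refine h2.trans (mul_le_mul_of_nonneg_right ?_ (Real.rpow_nonneg (norm_nonneg _) _))
    rw [kC]; linarith

lemma norm_bK_le {z : ℂ} (hz : z ≠ 0) : ‖bK z‖ ≤ Real.exp (-z.re) * (kC * kdec ‖z‖) := by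
  rw [bK, norm_mul, Complex.norm_exp, Complex.neg_re]
  exact mul_le_mul_of_nonneg_left (norm_kk_le_kdec hz) (Real.exp_pos _).le

lemma norm_bL_le_of_im_pos {z : ℂ} (hz : 0 < z.im) :
    ‖bL z‖ ≤ Real.exp z.re * (kC * kdec ‖z‖) := by
  have h0 : -z ≠ 0 := by
    intro h; rw [neg_eq_zero] at h; simp [h] at hz
  have h := norm_kk_le_kdec h0
  rw [norm_neg] at h
  rw [bL, ← exp_mul_kk_neg hz, norm_mul, Complex.norm_exp]
  exact mul_le_mul_of_nonneg_left h (Real.exp_pos _).le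

lemma continuousAt_kdec {r : ℝ} (hr : 0 < r) : ContinuousAt kdec r :=
  (Real.continuousAt_rpow_const r _ (Or.inl hr.ne')).min
    (Real.continuousAt_rpow_const r _ (Or.inl hr.ne'))

lemma norm_bL_le {z : ℂ} (hz : z ∈ Complex.slitPlane) (him : 0 ≤ z.im) :
    ‖bL z‖ ≤ Real.exp z.re * (kC * kdec ‖z‖) := by
  have hz0 := norm_pos_iff.2 (Complex.slitPlane_ne_zero hz)
  have hc : ContinuousAt bL z :=
    (differentiableOn_bL.differentiableAt (Complex.isOpen_slitPlane.mem_nhds hz)).continuousAt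
  have hd : ContinuousAt (fun z : ℂ => Real.exp z.re * (kC * kdec ‖z‖)) z := by
    refine ContinuousAt.mul (by fun_prop) (continuousAt_const.mul ?_)
    exact ContinuousAt.comp (f := fun z : ℂ => ‖z‖) (continuousAt_kdec hz0) (by fun_prop)
  have ht : Filter.Tendsto (fun n : ℕ => z + ((1 / ((n : ℝ) + 1) : ℝ) : ℂ) * Complex.I) Filter.atTop
      (nhds z) := by
    have h1 := (Complex.continuous_ofReal.tendsto _).comp
      (tendsto_one_div_add_atTop_nhds_zero_nat (𝕜 := ℝ))
    have h2 := (h1.mul_const Complex.I).const_add z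
    simpa [Function.comp_def] using h2
  refine le_of_tendsto_of_tendsto' (hc.norm.tendsto.comp ht) (hd.tendsto.comp ht) fun n => ?_
  apply norm_bL_le_of_im_pos
  have : (0:ℝ) < 1 / ((n : ℝ) + 1) := by positivity
  simp only [Complex.add_im, Complex.im_ofReal_mul, Complex.I_im, mul_one]
  linarith

/-- The integrand of the contour rotation. -/
noncomputable def rotF (z : ℂ) : ℂ := z ^ 2 * bK z ^ 3 * (10 * bL z ^ 2 - 5 * bK z * bL z + bK z ^ 2)

lemma norm_rotF_le {z : ℂ} (hz : z ∈ Complex.slitPlane) (hre : 0 ≤ z.re) (him : 0 ≤ z.im) :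
    ‖rotF z‖ ≤ 16 * kC ^ 5 * (‖z‖ ^ 2 * kdec ‖z‖ ^ 5) := by
  have hz0 := Complex.slitPlane_ne_zero hz
  have hK := norm_bK_le hz0
  have hL := norm_bL_le hz him
  set D := kC * kdec ‖z‖ with hD
  have hD0 : 0 ≤ D := mul_nonneg kC_nonneg (kdec_nonneg (norm_nonneg z))
  have he : Real.exp (-z.re) ≤ 1 := Real.exp_le_one_iff.2 (by linarith)
  have he0 := Real.exp_pos (-z.re)
  have hee : Real.exp (-z.re) * Real.exp z.re = 1 := by rw [← Real.exp_add]; simp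
  have hK1 : ‖bK z‖ ≤ D := hK.trans (by nlinarith)
  have hKL : ‖bK z‖ * ‖bL z‖ ≤ D ^ 2 := by
    calc _ ≤ (Real.exp (-z.re) * D) * (Real.exp z.re * D) := by gcongr
      _ = (Real.exp (-z.re) * Real.exp z.re) * D ^ 2 := by ring
      _ = D ^ 2 := by rw [hee, one_mul]
  have hr : rotF z = z ^ 2 * (10 * (bK z * (bK z * bL z) ^ 2) - 5 * (bK z ^ 3 * (bK z * bL z)) +
      bK z ^ 5) := by rw [rotF]; ring
  have h1 : ‖bK z * (bK z * bL z) ^ 2‖ ≤ D * (D ^ 2) ^ 2 := by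
    rw [norm_mul, norm_pow, norm_mul]; gcongr
  have h2 : ‖bK z ^ 3 * (bK z * bL z)‖ ≤ D ^ 3 * D ^ 2 := by
    rw [norm_mul, norm_pow, norm_mul]; gcongr
  have h3 : ‖bK z ^ 5‖ ≤ D ^ 5 := by rw [norm_pow]; gcongr
  have h4 : ‖10 * (bK z * (bK z * bL z) ^ 2) - 5 * (bK z ^ 3 * (bK z * bL z)) + bK z ^ 5‖ ≤
      10 * (D * (D ^ 2) ^ 2) + 5 * (D ^ 3 * D ^ 2) + D ^ 5 := by
    refine (norm_add_le _ _).trans (add_le_add ((norm_sub_le _ _).trans (add_le_add ?_ ?_)) h3)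
    · rw [norm_mul, Complex.norm_ofNat]; gcongr
    · rw [norm_mul, Complex.norm_ofNat]; gcongr
  rw [hr, norm_mul, norm_pow]
  calc _ ≤ ‖z‖ ^ 2 * (10 * (D * (D ^ 2) ^ 2) + 5 * (D ^ 3 * D ^ 2) + D ^ 5) := by gcongr
    _ = _ := by rw [hD]; ring

/-- The logarithmic form of the majorant. -/
noncomputable def logmaj (t : ℝ) : ℝ := min (Real.exp (3 / 4 * t)) (Real.exp (-(1 / 4) * t))

lemma sq_mul_kdec_le (t : ℝ) : Real.exp t ^ 2 * kdec (Real.exp t) ^ 5 ≤ logmaj t := by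
  have h : ∀ a : ℝ, kdec (Real.exp t) ≤ Real.exp t ^ (-a) →
      Real.exp t ^ 2 * kdec (Real.exp t) ^ 5 ≤ Real.exp ((2 - 5 * a) * t) := by
    intro a h
    have h0 := kdec_nonneg (Real.exp_pos t).le
    calc _ ≤ Real.exp t ^ 2 * (Real.exp t ^ (-a)) ^ 5 := by gcongr
      _ = _ := by
        rw [← Real.exp_mul, ← Real.exp_nat_mul, ← Real.exp_nat_mul, ← Real.exp_add]
        congr 1; push_cast; ring
  refine le_min ?_ ?_
  · refine (h (1 / 4) (min_le_left _ _)).trans_eq ?_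
    norm_num
  · refine (h (9 / 20) (min_le_right _ _)).trans_eq ?_
    norm_num

lemma integrable_logmaj : Integrable logmaj := by
  have hm : AEStronglyMeasurable logmaj volume := by
    unfold logmaj
    exact Continuous.aestronglyMeasurable (by fun_prop)
  have h0 : ∀ t, ‖logmaj t‖ = logmaj t := fun t =>
    Real.norm_of_nonneg (le_min (Real.exp_pos _).le (Real.exp_pos _).le)
  have h1 : IntegrableOn logmaj (Iic 0) :=
    (integrableOn_exp_mul_Iic (a := 3 / 4) (by norm_num) 0).mono' hm.restrict
      (Filter.Eventually.of_forall fun t => by rw [h0]; exact min_le_left _ _)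
  have h2 : IntegrableOn logmaj (Ioi 0) :=
    (integrableOn_exp_mul_Ioi (a := -(1 / 4)) (by norm_num) 0).mono' hm.restrict
      (Filter.Eventually.of_forall fun t => by rw [h0]; exact min_le_right _ _)
  have := h1.union h2
  rwa [Iic_union_Ioi, integrableOn_univ] at this

lemma exp_mem_quadrant {z : ℂ} (h0 : 0 ≤ z.im) (h1 : z.im ≤ Real.pi / 2) :
    Complex.exp z ∈ Complex.slitPlane ∧ 0 ≤ (Complex.exp z).re ∧ 0 ≤ (Complex.exp z).im := by
  have hpi := Real.pi_pos
  have hre : 0 ≤ (Complex.exp z).re := by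
    rw [Complex.exp_re]
    exact mul_nonneg (Real.exp_pos _).le (Real.cos_nonneg_of_mem_Icc ⟨by linarith, h1⟩)
  refine ⟨?_, hre, ?_⟩
  · rcases hre.eq_or_lt with h | h
    · right
      intro him
      exact Complex.exp_ne_zero z (Complex.ext h.symm him)
    · exact Or.inl h
  · rw [Complex.exp_im]
    exact mul_nonneg (Real.exp_pos _).le (Real.sin_nonneg_of_nonneg_of_le_pi h0 (by linarith))

lemma norm_rotF_exp_le {z : ℂ} (h0 : 0 ≤ z.im) (h1 : z.im ≤ Real.pi / 2) :
    ‖rotF (Complex.exp z)‖ ≤ 16 * kC ^ 5 * logmaj z.re := by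
  obtain ⟨ha, hb, hc⟩ := exp_mem_quadrant h0 h1
  refine (norm_rotF_le ha hb hc).trans ?_
  have := kC_nonneg
  rw [Complex.norm_exp]
  gcongr
  exact sq_mul_kdec_le z.re

lemma differentiableOn_rotF : DifferentiableOn ℂ rotF Complex.slitPlane := by
  have h1 := differentiableOn_bK
  have h2 := differentiableOn_bL
  unfold rotF
  fun_prop

lemma continuousOn_rotF_line {s : ℝ} (h0 : 0 ≤ s) (h1 : s ≤ Real.pi / 2) :
    Continuous fun t : ℝ => rotF (Complex.exp (t + s * Complex.I)) := by
  refine differentiableOn_rotF.continuousOn.comp_continuous (by fun_prop) fun t => ?_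
  exact (exp_mem_quadrant (by simpa using h0) (by simpa using h1)).1

lemma integrable_rotF_line {s : ℝ} (h0 : 0 ≤ s) (h1 : s ≤ Real.pi / 2) :
    Integrable fun t : ℝ => rotF (Complex.exp (t + s * Complex.I)) := by
  refine (integrable_logmaj.const_mul (16 * kC ^ 5)).mono'
    (continuousOn_rotF_line h0 h1).aestronglyMeasurable (Filter.Eventually.of_forall fun t => ?_)
  have := norm_rotF_exp_le (z := t + s * Complex.I) (by simpa using h0) (by simpa using h1)
  simpa using this

lemma integral_rotF_rotate :
    ∫ t : ℝ, rotF (Complex.exp t) =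
      ∫ t : ℝ, rotF (Complex.exp (t + ((Real.pi / 2 : ℝ) : ℂ) * Complex.I)) := by
  have hpi := Real.pi_pos
  set f : ℂ → ℂ := fun z => rotF (Complex.exp z) with hf
  have hrect : ∀ T : ℝ, (∫ t in (-T)..T, rotF (Complex.exp t)) =
      (∫ t in (-T)..T, rotF (Complex.exp (t + ((Real.pi / 2 : ℝ) : ℂ) * Complex.I))) -
      (Complex.I * (∫ y in (0:ℝ)..(Real.pi / 2), f (T + y * Complex.I)) -
        Complex.I * (∫ y in (0:ℝ)..(Real.pi / 2), f ((-T : ℝ) + y * Complex.I))) := by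
    intro T
    have h := Complex.integral_boundary_rect_eq_zero_of_differentiableOn f ((-T : ℝ) : ℂ)
      (T + ((Real.pi / 2 : ℝ) : ℂ) * Complex.I) (by
        intro z hz
        rw [Complex.mem_reProdIm] at hz
        simp only [Complex.ofReal_im, Complex.add_im, Complex.im_ofReal_mul, Complex.I_im, mul_one,
          zero_add] at hz
        rw [uIcc_of_le (by positivity : (0:ℝ) ≤ Real.pi / 2)] at hz
        have hm := (exp_mem_quadrant hz.2.1 hz.2.2).1
        have hd := differentiableOn_rotF.differentiableAt (Complex.isOpen_slitPlane.mem_nhds hm)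
        exact (DifferentiableAt.comp z hd Complex.differentiableAt_exp).differentiableWithinAt)
    simp only [Complex.add_re, Complex.re_ofReal_mul, Complex.I_re, mul_zero, Complex.ofReal_re,
      Complex.add_im,
      Complex.im_ofReal_mul, Complex.I_im, mul_one, Complex.ofReal_im, Complex.ofReal_zero, zero_mul,
      add_zero, zero_add, smul_eq_mul] at h
    simp only [hf] at h ⊢
    linear_combination h
  have hside : ∀ T : ℝ, ‖∫ y in (0:ℝ)..(Real.pi / 2), f (T + y * Complex.I)‖ ≤
      16 * kC ^ 5 * logmaj T * (Real.pi / 2) := by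
    intro T
    have := intervalIntegral.norm_integral_le_of_norm_le_const (a := 0) (b := Real.pi / 2)
      (f := fun y : ℝ => f (T + y * Complex.I)) (C := 16 * kC ^ 5 * logmaj T) ?_
    · rwa [sub_zero, abs_of_pos (by positivity)] at this
    · intro y hy
      rw [uIoc_of_le (by positivity)] at hy
      have := norm_rotF_exp_le (z := T + y * Complex.I) (by simpa using hy.1.le)
        (by simpa using hy.2)
      simpa using this
  have hz : ∀ (g : ℝ → ℝ), Filter.Tendsto (fun T => logmaj (g T)) Filter.atTop (nhds 0) →
      Filter.Tendsto (fun T : ℝ => Complex.I * ∫ y in (0:ℝ)..(Real.pi / 2),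
        f ((g T : ℝ) + y * Complex.I)) Filter.atTop (nhds 0) := by
    intro g hg
    rw [← mul_zero Complex.I]
    refine Filter.Tendsto.const_mul _ ?_
    rw [tendsto_zero_iff_norm_tendsto_zero]
    refine squeeze_zero (fun _ => norm_nonneg _) (fun T => hside (g T)) ?_
    simpa using (hg.const_mul (16 * kC ^ 5)).mul_const (Real.pi / 2)
  have hlog0 : ∀ t, 0 ≤ logmaj t := fun t => le_min (Real.exp_pos _).le (Real.exp_pos _).le
  have hg1 : Filter.Tendsto (fun T => logmaj T) Filter.atTop (nhds 0) := by
    refine squeeze_zero hlog0 (fun T => min_le_right _ _) ?_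
    exact Real.tendsto_exp_atBot.comp (Filter.tendsto_id.const_mul_atTop_of_neg (by norm_num))
  have hg2 : Filter.Tendsto (fun T => logmaj (-T)) Filter.atTop (nhds 0) := by
    refine squeeze_zero (fun T => hlog0 _) (fun T => min_le_left _ _) ?_
    refine Real.tendsto_exp_atBot.comp ?_
    simp only [mul_neg]
    exact Filter.tendsto_neg_atTop_atBot.comp (Filter.tendsto_id.const_mul_atTop (by norm_num))
  have hi0 := integrable_rotF_line le_rfl (by positivity : (0:ℝ) ≤ Real.pi / 2)
  simp only [Complex.ofReal_zero, zero_mul, add_zero] at hi0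
  have hl := intervalIntegral_tendsto_integral hi0 Filter.tendsto_neg_atTop_atBot Filter.tendsto_id
  have hr := intervalIntegral_tendsto_integral
    (integrable_rotF_line (by positivity : (0:ℝ) ≤ Real.pi / 2) le_rfl)
    Filter.tendsto_neg_atTop_atBot Filter.tendsto_id
  have hr2 := hr.sub ((hz (fun T => T) hg1).sub (hz (fun T => -T) hg2))
  have := tendsto_nhds_unique hl (hr2.congr fun T => (hrect T).symm)
  rw [this]
  ring

/-- The Macdonald function on the positive half-line. -/
noncomputable def rK (r : ℝ) : ℝ := (∫ u : ℝ, Real.exp (-r * Real.cosh u)) / 2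

noncomputable def rI (r : ℝ) : ℝ :=
  ∫ θ in Ioc 0 (Real.pi / 2), (Real.exp (r * Real.cos θ) + Real.exp (-r * Real.cos θ))

noncomputable def rJ (y : ℝ) : ℝ := ∫ θ in Ioc 0 (Real.pi / 2), 2 * Real.cos (y * Real.cos θ)

lemma bK_ofReal_eq {r : ℝ} (hr : 0 < r) : bK r = rK r := by
  rw [bK_ofReal hr, bKc, rK, Complex.ofReal_div, ← integral_complex_ofReal]
  congr 2
  funext u; push_cast; rfl

lemma bI_eq (z : ℂ) : bI z = ∫ θ in Ioc 0 (Real.pi / 2),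
    (Complex.exp (z * Real.cos θ) + Complex.exp (-z * Real.cos θ)) := by
  rw [integral_add, bI, bG, bG]
  all_goals exact (Continuous.integrableOn_Icc (by fun_prop)).mono_set Ioc_subset_Icc_self

lemma bI_ofReal (r : ℝ) : bI r = rI r := by
  rw [bI_eq, rI, ← integral_complex_ofReal]
  congr 1
  funext u; push_cast; rfl

lemma bI_I_mul (y : ℝ) : bI (y * Complex.I) = rJ y := by
  rw [bI_eq, rJ, ← integral_complex_ofReal]
  congr 1
  funext u
  push_cast
  have h : ∀ w : ℂ, Complex.exp (w * Complex.I) + Complex.exp (-(w * Complex.I)) =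
      2 * Complex.cos w := fun w => by rw [Complex.cos, neg_mul]; ring
  rw [← h]
  ring_nf

@[fun_prop]
lemma continuous_rJ : Continuous rJ := by
  have : rJ = fun y : ℝ => (bI (y * Complex.I)).re :=
    funext fun y => by rw [bI_I_mul, Complex.ofReal_re]
  rw [this]
  exact Complex.continuous_re.comp (differentiable_bI.continuous.comp (by fun_prop))

lemma bK_conj_I {y : ℝ} (hy : 0 < y) :
    bL (y * Complex.I) = starRingEnd ℂ (bK (y * Complex.I)) := by
  have h0 : 0 < ((y : ℂ) * Complex.I).im := by simpa using hy
  rw [bL, ← exp_mul_kk_neg h0, bK, map_mul, ← Complex.exp_conj,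
    ← kk_conj (im_pos_subset_slitPlane h0)]
  simp

lemma rJ_eq {y : ℝ} (hy : 0 < y) : rJ y = -2 * (bK (y * Complex.I)).im := by
  have h := bK_conj_I hy
  rw [bL, bI_I_mul] at h
  have := congrArg Complex.im h
  simp only [Complex.add_im, Complex.im_mul_ofReal, Complex.I_im, Complex.conj_im, one_mul] at this
  linarith

lemma rotF_ofReal_im {r : ℝ} (hr : 0 < r) : (rotF r).im = r * (15 * (r * rI r * rK r ^ 4)) := by
  have h : rotF r = ((r ^ 2 * rK r ^ 3 * (10 * (rK r ^ 2 - rI r ^ 2) - 4 * rK r ^ 2) : ℝ) : ℂ) +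
      ((r * (15 * (r * rI r * rK r ^ 4)) : ℝ) : ℂ) * Complex.I := by
    rw [rotF, bL, bK_ofReal_eq hr, bI_ofReal]
    push_cast
    linear_combination (10 * (r:ℂ) ^ 2 * rK r ^ 3 * (rI r) ^ 2) * Complex.I_sq
  rw [h, Complex.add_im, Complex.ofReal_im, Complex.im_ofReal_mul, Complex.I_im, zero_add, mul_one]

lemma rotF_I_im {y : ℝ} (hy : 0 < y) :
    (rotF (y * Complex.I)).im = y * ((y * rJ y ^ 5) / 2) := by
  rw [rotF, bK_conj_I hy, rJ_eq hy]
  set k := bK (y * Complex.I)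
  have hk : k = (k.re : ℂ) + k.im * Complex.I := (Complex.re_add_im k).symm
  have hc : starRingEnd ℂ k = (k.re : ℂ) - k.im * Complex.I := by
    apply Complex.ext <;> simp
  rw [hc]
  generalize k.im = b at *
  generalize k.re = a at *
  rw [hk]
  have e : ((y : ℂ) * Complex.I) ^ 2 * ((a : ℂ) + b * Complex.I) ^ 3 *
      (10 * ((a : ℂ) - b * Complex.I) ^ 2 - 5 * ((a : ℂ) + b * Complex.I) * ((a : ℂ) - b * Complex.I)
        + ((a : ℂ) + b * Complex.I) ^ 2) = ((-y ^ 2 * (10 * (a ^ 2 + b ^ 2) ^ 2 * a -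
        5 * (a ^ 2 + b ^ 2) * (a ^ 3 - 3 * a * b ^ 2) + (a ^ 5 - 10 * a ^ 3 * b ^ 2 + 5 * a * b ^ 4)) :
        ℝ) : ℂ) + ((-16 * y ^ 2 * b ^ 5 : ℝ) : ℂ) * Complex.I := by
    have h2 : ((a : ℂ) + b * Complex.I) ^ 2 = (a ^ 2 - b ^ 2 : ℂ) + 2 * a * b * Complex.I := by
      linear_combination (b : ℂ) ^ 2 * Complex.I_sq
    have h3 : ((a : ℂ) + b * Complex.I) ^ 3 =
        (a ^ 3 - 3 * a * b ^ 2 : ℂ) + (3 * a ^ 2 * b - b ^ 3) * Complex.I := by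
      rw [pow_succ, h2]
      linear_combination 2 * (a : ℂ) * b ^ 2 * Complex.I_sq
    have h5 : ((a : ℂ) + b * Complex.I) ^ 5 = (a ^ 5 - 10 * a ^ 3 * b ^ 2 + 5 * a * b ^ 4 : ℂ) +
        (5 * a ^ 4 * b - 10 * a ^ 2 * b ^ 3 + b ^ 5) * Complex.I := by
      rw [show (5 : ℕ) = 3 + 2 from rfl, pow_add, h3, h2]
      linear_combination (3 * a ^ 2 * b - b ^ 3 : ℂ) * (2 * a * b) * Complex.I_sq
    have hn : ((a : ℂ) + b * Complex.I) * ((a : ℂ) - b * Complex.I) = a ^ 2 + b ^ 2 := by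
      linear_combination -(b : ℂ) ^ 2 * Complex.I_sq
    have hI : ((y : ℂ) * Complex.I) ^ 2 = -y ^ 2 := by
      rw [mul_pow, Complex.I_sq]; ring
    have hs : ((a : ℂ) + b * Complex.I) ^ 3 *
      (10 * ((a : ℂ) - b * Complex.I) ^ 2 - 5 * ((a : ℂ) + b * Complex.I) * ((a : ℂ) - b * Complex.I)
        + ((a : ℂ) + b * Complex.I) ^ 2) =
        10 * (((a : ℂ) + b * Complex.I) * ((a : ℂ) - b * Complex.I)) ^ 2 * ((a : ℂ) + b * Complex.I) -
        5 * (((a : ℂ) + b * Complex.I) * ((a : ℂ) - b * Complex.I)) * ((a : ℂ) + b * Complex.I) ^ 3 +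
        ((a : ℂ) + b * Complex.I) ^ 5 := by ring
    rw [mul_assoc, hs, hn, h3, h5, hI]
    push_cast
    ring
  rw [e]
  simp only [Complex.add_im, Complex.ofReal_im, Complex.im_ofReal_mul, Complex.I_im]
  ring

lemma image_exp_univ : Real.exp '' univ = Ioi 0 := by
  rw [image_univ, Real.range_exp]

lemma integral_Ioi_eq_exp (g : ℝ → ℝ) :
    ∫ y in Ioi 0, g y = ∫ t : ℝ, Real.exp t * g (Real.exp t) := by
  have := integral_image_eq_integral_abs_deriv_smul (s := univ) (f := Real.exp) (f' := Real.exp)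
    MeasurableSet.univ (fun x _ => (Real.hasDerivAt_exp x).hasDerivWithinAt)
    (Real.exp_injective.injOn) g
  rw [image_exp_univ] at this
  rw [this, setIntegral_univ]
  simp [Real.abs_exp]

lemma integrableOn_Ioi_iff_exp (g : ℝ → ℝ) :
    IntegrableOn g (Ioi 0) ↔ Integrable fun t : ℝ => Real.exp t * g (Real.exp t) := by
  have := integrableOn_image_iff_integrableOn_abs_deriv_smul (s := univ) (f := Real.exp)
    (f' := Real.exp)
    MeasurableSet.univ (fun x _ => (Real.hasDerivAt_exp x).hasDerivWithinAt)
    (Real.exp_injective.injOn) g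
  rw [image_exp_univ] at this
  rw [this, integrableOn_univ]
  simp [Real.abs_exp]

lemma integrableOn_rI_mul_rK_pow : IntegrableOn (fun r => r * rI r * rK r ^ 4) (Ioi 0) := by
  rw [integrableOn_Ioi_iff_exp]
  have h := (integrable_rotF_line le_rfl (by positivity : (0:ℝ) ≤ Real.pi / 2)).im.div_const 15
  refine h.congr (Filter.Eventually.of_forall fun t => ?_)
  simp only [Complex.ofReal_zero, zero_mul, add_zero, RCLike.im_to_complex]
  rw [← Complex.ofReal_exp, rotF_ofReal_im (Real.exp_pos t)]
  ring

lemma integral_rotate :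
    15 * ∫ r in Ioi 0, r * rI r * rK r ^ 4 = ∫ y in Ioi 0, y * rJ y ^ 5 / 2 := by
  rw [← integral_const_mul, integral_Ioi_eq_exp, integral_Ioi_eq_exp]
  have h := congrArg Complex.im integral_rotF_rotate
  have hpi := Real.pi_pos
  have i0 := integrable_rotF_line le_rfl (by positivity : (0:ℝ) ≤ Real.pi / 2)
  have i1 := integrable_rotF_line (by positivity : (0:ℝ) ≤ Real.pi / 2) le_rfl
  simp only [Complex.ofReal_zero, zero_mul, add_zero] at i0
  have h0 := integral_im i0
  have h1 := integral_im i1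
  simp only [RCLike.im_to_complex] at h0 h1
  rw [← h0, ← h1] at h
  refine Eq.trans ?_ (h.trans ?_)
  · congr 1; funext t
    rw [← Complex.ofReal_exp, rotF_ofReal_im (Real.exp_pos t)]
  · congr 1; funext t
    rw [Complex.exp_add, ← Complex.ofReal_exp]
    have : Complex.exp (((Real.pi / 2 : ℝ) : ℂ) * Complex.I) = Complex.I := by
      push_cast; exact Complex.exp_pi_div_two_mul_I
    rw [this, rotF_I_im (Real.exp_pos t)]

lemma bI_eq_integral (z : ℂ) : bI z = ∫ θ in (0:ℝ)..Real.pi, Complex.exp (z * Real.cos θ) := by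
  have hpi := Real.pi_pos
  have hc : Continuous fun θ : ℝ => Complex.exp (z * Real.cos θ) := by fun_prop
  have h2 := intervalIntegral.integral_comp_sub_left (a := 0) (b := Real.pi / 2)
    (fun θ : ℝ => Complex.exp (z * Real.cos θ)) Real.pi
  rw [sub_zero, show Real.pi - Real.pi / 2 = Real.pi / 2 by ring] at h2
  rw [← intervalIntegral.integral_add_adjacent_intervals (b := Real.pi / 2)
    (hc.intervalIntegrable _ _) (hc.intervalIntegrable _ _), ← h2, bI, bG, bG,
    ← intervalIntegral.integral_of_le (by positivity),
    ← intervalIntegral.integral_of_le (by positivity)]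
  congr 2
  funext θ
  rw [Real.cos_pi_sub]
  push_cast; ring_nf

lemma integral_circle_exp (z : ℂ) :
    ∫ θ in (-Real.pi)..Real.pi, Complex.exp (z * Real.cos θ) = 2 * bI z := by
  have hc : Continuous fun θ : ℝ => Complex.exp (z * Real.cos θ) := by fun_prop
  have h2 := intervalIntegral.integral_comp_neg (a := 0) (b := Real.pi)
    (fun θ : ℝ => Complex.exp (z * Real.cos θ))
  rw [neg_zero] at h2
  rw [← intervalIntegral.integral_add_adjacent_intervals (b := 0)
    (hc.intervalIntegrable _ _) (hc.intervalIntegrable _ _), ← h2, bI_eq_integral, two_mul]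
  simp only [Real.cos_neg]

lemma rJ_neg (y : ℝ) : rJ (-y) = rJ y := by
  rw [rJ, rJ]; simp

lemma rJ_abs (y : ℝ) : rJ |y| = rJ y := by
  rcases abs_choice y with h | h <;> rw [h]
  exact rJ_neg y

lemma abs_rJ_le (y : ℝ) : |rJ y| ≤ Real.pi := by
  have hpi := Real.pi_pos
  rw [rJ, ← intervalIntegral.integral_of_le (by positivity), ← Real.norm_eq_abs]
  refine (intervalIntegral.norm_integral_le_of_norm_le_const (C := 2) fun x _ => ?_).trans ?_
  · rw [Real.norm_eq_abs, abs_mul, abs_two]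
    linarith [Real.abs_cos_le_one (y * Real.cos x)]
  · rw [sub_zero, abs_of_pos (by positivity)]
    linarith

lemma integral_circle_exp_re (w : ℂ) :
    ∫ θ in (-Real.pi)..Real.pi,
      Complex.exp (((Complex.exp (θ * Complex.I) * w).re : ℂ) * Complex.I) = 2 * rJ ‖w‖ := by
  rw [← bI_I_mul, ← integral_circle_exp]
  set g : ℝ → ℂ := fun θ => Complex.exp (‖w‖ * Complex.I * Real.cos θ) with hg
  have hp : Function.Periodic g (2 * Real.pi) := by
    intro θ
    rw [hg]; simp only [Real.cos_add_two_pi]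
  have h1 : ∀ θ : ℝ, Complex.exp (((Complex.exp (θ * Complex.I) * w).re : ℂ) * Complex.I) =
      g (θ + w.arg) := by
    intro θ
    rw [hg]
    simp only
    congr 1
    have : (Complex.exp (θ * Complex.I) * w).re = ‖w‖ * Real.cos (θ + w.arg) := by
      conv_lhs => rw [← Complex.norm_mul_exp_arg_mul_I w]
      rw [mul_left_comm, ← Complex.exp_add, ← add_mul, ← Complex.ofReal_add, Complex.re_ofReal_mul,
        Complex.exp_ofReal_mul_I_re]
    rw [this]; push_cast; ring
  simp only [h1]
  rw [intervalIntegral.integral_comp_add_right]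
  have := hp.intervalIntegral_add_eq (-Real.pi + w.arg) (-Real.pi)
  rw [show -Real.pi + 2 * Real.pi = Real.pi by ring,
    show -Real.pi + w.arg + 2 * Real.pi = Real.pi + w.arg by ring] at this
  exact this

lemma rJ_mul_rJ (a b : ℝ) :
    rJ a * rJ b = (∫ δ in (-Real.pi)..Real.pi, rJ ‖(a + b * Complex.exp (δ * Complex.I) : ℂ)‖) / 2 := by
  have hpi := Real.pi_pos
  have key : (2 * rJ a * (2 * rJ b) : ℂ) =
      ∫ δ in (-Real.pi)..Real.pi, (2 * rJ ‖(a + b * Complex.exp (δ * Complex.I) : ℂ)‖ : ℂ) := by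
    simp only [← integral_circle_exp_re]
    rw [intervalIntegral_intervalIntegral_swap]
    · have h1 : ∀ θ : ℝ, (∫ δ in (-Real.pi)..Real.pi,
          Complex.exp (((Complex.exp (θ * Complex.I) *
            (a + b * Complex.exp (δ * Complex.I))).re : ℂ) * Complex.I)) =
          Complex.exp (a * Complex.I * Real.cos θ) * (2 * rJ b) := by
        intro θ
        have hp : Function.Periodic (fun φ : ℝ => Complex.exp (b * Complex.I * Real.cos φ))
            (2 * Real.pi) := by
          intro φ; simp only [Real.cos_add_two_pi]
        have e : ∀ δ : ℝ, Complex.exp (((Complex.exp (θ * Complex.I) *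
            (a + b * Complex.exp (δ * Complex.I))).re : ℂ) * Complex.I) =
            Complex.exp (a * Complex.I * Real.cos θ) *
              Complex.exp (b * Complex.I * Real.cos (δ + θ)) := by
          intro δ
          rw [← Complex.exp_add]
          congr 1
          have : (Complex.exp (θ * Complex.I) * (a + b * Complex.exp (δ * Complex.I))).re =
              a * Real.cos θ + b * Real.cos (δ + θ) := by
            rw [mul_add, mul_comm _ (a : ℂ), mul_left_comm, ← Complex.exp_add, ← add_mul,
              ← Complex.ofReal_add, Complex.add_re, Complex.re_ofReal_mul, Complex.re_ofReal_mul,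
              Complex.exp_ofReal_mul_I_re, Complex.exp_ofReal_mul_I_re, add_comm θ]
          rw [this]; push_cast; ring
        simp only [e]
        rw [intervalIntegral.integral_const_mul, ← bI_I_mul, ← integral_circle_exp]
        congr 1
        rw [intervalIntegral.integral_comp_add_right (fun φ : ℝ => Complex.exp (b * Complex.I * Real.cos φ))]
        have := hp.intervalIntegral_add_eq (-Real.pi + θ) (-Real.pi)
        rw [show -Real.pi + 2 * Real.pi = Real.pi by ring,
          show -Real.pi + θ + 2 * Real.pi = Real.pi + θ by ring] at this
        exact this
      simp only [h1]
      rw [intervalIntegral.integral_mul_const, integral_circle_exp, bI_I_mul]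
    · have hc : Continuous (Function.uncurry fun δ θ : ℝ => Complex.exp (((Complex.exp (θ * Complex.I) *
          (a + b * Complex.exp (δ * Complex.I))).re : ℂ) * Complex.I)) := by
        simp only [Function.uncurry_def]; fun_prop
      refine (hc.continuousOn.integrableOn_compact (K := Icc (-Real.pi) Real.pi ×ˢ Icc (-Real.pi) Real.pi)
        (isCompact_Icc.prod isCompact_Icc)).mono_set ?_
      rw [uIoc_of_le (by linarith)]
      exact prod_mono Ioc_subset_Icc_self Ioc_subset_Icc_self
  have h2 : ((2 * rJ a * (2 * rJ b) : ℝ) : ℂ) =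
      ((∫ δ in (-Real.pi)..Real.pi, 2 * rJ ‖(a + b * Complex.exp (δ * Complex.I) : ℂ)‖ : ℝ) : ℂ) := by
    rw [← intervalIntegral.integral_ofReal]
    push_cast
    exact key
  have h3 := Complex.ofReal_injective h2
  rw [intervalIntegral.integral_const_mul] at h3
  linarith

lemma norm_bI_le (z : ℂ) : ‖bI z‖ ≤ Real.pi * Real.exp ‖z‖ := by
  have hpi := Real.pi_pos
  rw [bI_eq_integral]
  refine (intervalIntegral.norm_integral_le_of_norm_le_const (C := Real.exp ‖z‖) fun x _ => ?_).trans ?_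
  · rw [Complex.norm_exp, Real.exp_le_exp]
    refine (Complex.re_le_norm _).trans ?_
    rw [norm_mul, Complex.norm_real, Real.norm_eq_abs]
    nlinarith [Real.abs_cos_le_one x, norm_nonneg z]
  · rw [sub_zero, abs_of_pos hpi, mul_comm]

lemma integrableOn_mul_exp_quadratic {a : ℝ} (ha : 0 < a) (b : ℝ) :
    IntegrableOn (fun y : ℝ => y * Real.exp (-a * y ^ 2 + b * y)) (Ioi 0) := by
  have h1 := ((integrable_mul_exp_neg_mul_sq (b := a / 2) (by positivity)).const_mul
    (Real.exp (b ^ 2 / (2 * a)))).integrableOn (s := Ioi 0)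
  refine Integrable.mono' h1 (by fun_prop) ?_
  refine (ae_restrict_mem measurableSet_Ioi).mono fun y hy => ?_
  have hy : (0:ℝ) < y := hy
  rw [Real.norm_eq_abs, abs_of_pos (by positivity), mul_left_comm, ← Real.exp_add]
  refine mul_le_mul_of_nonneg_left (Real.exp_le_exp.2 ?_) hy.le
  have : b ^ 2 / (2 * a) + -(a / 2) * y ^ 2 - (-a * y ^ 2 + b * y) = (a * y - b) ^ 2 / (2 * a) := by
    field_simp; ring
  have h2 : 0 ≤ (a * y - b) ^ 2 / (2 * a) := by positivity
  linarith

lemma integral_mul_exp_bI {l : ℂ} (hl : 0 < l.re) (w : ℂ) :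
    ∫ y in Ioi (0:ℝ), (y : ℂ) * Complex.exp (-l * y ^ 2) * bI (w * y) =
      Real.pi / (2 * l) * Complex.exp (w ^ 2 / (4 * l)) := by
  have hpi := Real.pi_pos
  have hl0 : l ≠ 0 := by rintro rfl; simp at hl
  have h1 := GaussianFourier.integral_cexp_neg_mul_sq_norm_add (V := ℂ) hl w 1
  rw [← Complex.integral_comp_polarCoord_symm, Complex.finrank_real_complex, Nat.cast_ofNat,
    div_self (two_ne_zero), Complex.cpow_one, norm_one, Complex.ofReal_one, one_pow, mul_one,
    polarCoord_target] at h1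
  have e : ∀ p ∈ Ioi (0:ℝ) ×ˢ Ioo (-Real.pi) Real.pi,
      p.1 • Complex.exp (-l * ‖Complex.polarCoord.symm p‖ ^ 2 +
        w * (inner ℝ 1 (Complex.polarCoord.symm p) : ℝ)) =
      (p.1 : ℂ) * Complex.exp (-l * p.1 ^ 2) * Complex.exp ((w * p.1) * Real.cos p.2) := by
    intro p hp
    have hp1 : 0 < p.1 := hp.1
    have h2 : (inner ℝ 1 (Complex.polarCoord.symm p) : ℝ) = p.1 * Real.cos p.2 := by
      rw [Complex.inner, map_one, mul_one, Complex.polarCoord_symm_apply, Complex.re_ofReal_mul]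
      congr 1
      rw [Complex.add_re, Complex.ofReal_re, Complex.re_ofReal_mul, Complex.I_re, mul_zero, add_zero]
    rw [Complex.norm_polarCoord_symm, abs_of_pos hp1, h2, Complex.exp_add, Complex.real_smul,
      mul_assoc]
    push_cast
    ring_nf
  rw [setIntegral_congr_fun (measurableSet_Ioi.prod measurableSet_Ioo) e, Measure.volume_eq_prod,
    setIntegral_prod] at h1
  · simp only [integral_const_mul] at h1
    have h3 : ∀ y : ℝ, ∫ θ in Ioo (-Real.pi) Real.pi, Complex.exp ((w * y) * Real.cos θ) =
        2 * bI (w * y) := by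
      intro y
      rw [← integral_circle_exp, intervalIntegral.integral_of_le (by linarith),
        integral_Ioc_eq_integral_Ioo]
    simp only [h3] at h1
    have h4 : ∫ y in Ioi (0:ℝ), (y : ℂ) * Complex.exp (-l * y ^ 2) * (2 * bI (w * y)) =
        2 * ∫ y in Ioi (0:ℝ), (y : ℂ) * Complex.exp (-l * y ^ 2) * bI (w * y) := by
      rw [← integral_const_mul]; congr 1; funext y; ring
    rw [h4] at h1
    linear_combination h1 / 2
  · rw [IntegrableOn, ← Measure.prod_restrict]
    have hd := (integrableOn_mul_exp_quadratic hl ‖w‖).mul_prod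
      (integrable_const (1:ℝ) (μ := volume.restrict (Ioo (-Real.pi) Real.pi)))
    refine hd.mono' (by fun_prop) ?_
    rw [Measure.prod_restrict]
    refine (ae_restrict_mem (measurableSet_Ioi.prod measurableSet_Ioo)).mono fun p hp => ?_
    have hp1 : 0 < p.1 := hp.1
    rw [mul_assoc, ← Complex.exp_add, norm_mul, Complex.norm_real, Real.norm_eq_abs, abs_of_pos hp1,
      mul_one, Complex.norm_exp]
    refine mul_le_mul_of_nonneg_left (Real.exp_le_exp.2 ?_) hp1.le
    rw [Complex.add_re]
    refine add_le_add (le_of_eq ?_) ?_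
    · rw [← Complex.ofReal_pow, Complex.re_mul_ofReal, Complex.neg_re]
    · refine (Complex.re_le_norm _).trans ?_
      rw [norm_mul, norm_mul, Complex.norm_real, Complex.norm_real, Real.norm_eq_abs,
        Real.norm_eq_abs, abs_of_pos hp1]
      have : 0 ≤ ‖w‖ * p.1 := by positivity
      nlinarith [Real.abs_cos_le_one p.2]

lemma integral_Ioi_eq_exp_complex (g : ℝ → ℂ) :
    ∫ y in Ioi 0, g y = ∫ t : ℝ, Real.exp t * g (Real.exp t) := by
  have := integral_image_eq_integral_abs_deriv_smul (s := univ) (f := Real.exp) (f' := Real.exp)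
    MeasurableSet.univ (fun x _ => (Real.hasDerivAt_exp x).hasDerivWithinAt)
    (Real.exp_injective.injOn) g
  rw [image_exp_univ] at this
  simpa [Complex.real_smul, abs_of_pos (Real.exp_pos _)] using this

lemma bKc_mul_eq (p : ℂ) {y : ℝ} (hy : 0 < y) :
    bKc (p * y) = ∫ s in Ioi (0:ℝ),
      (s : ℂ)⁻¹ * Complex.exp (-p / 2 * s) * Complex.exp (-(p / (2 * s)) * y ^ 2) := by
  rw [integral_Ioi_eq_exp_complex, bKc, ← integral_add_right_eq_self _ (-Real.log y)]
  congr 1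
  funext t
  have h0 : (y : ℂ) ≠ 0 := by exact_mod_cast hy.ne'
  have h1 : (Real.exp t : ℂ) ≠ 0 := by exact_mod_cast (Real.exp_pos t).ne'
  rw [← mul_assoc, ← mul_assoc, mul_inv_cancel₀ h1, one_mul, ← Complex.exp_add]
  congr 1
  rw [Real.cosh_eq, ← sub_eq_add_neg, Real.exp_sub, Real.exp_log hy, neg_sub, Real.exp_sub,
    Real.exp_log hy]
  have h2 : (Real.exp (-t)) = (Real.exp t)⁻¹ := Real.exp_neg t
  have h3 : Real.exp t ≠ 0 := (Real.exp_pos t).ne'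
  push_cast
  field_simp
  ring

lemma integrable_schwinger {p : ℂ} (hp : 0 < p.re) :
    Integrable (fun q : ℝ × ℝ => (q.1 : ℂ) * ((q.2 : ℂ)⁻¹ * Complex.exp (-p / 2 * q.2) *
      Complex.exp (-(p / (2 * q.2)) * q.1 ^ 2)))
      ((volume.restrict (Ioi 0)).prod (volume.restrict (Ioi 0))) := by
  have hre : ∀ s : ℝ, (p / (2 * s)).re = p.re / (2 * s) := by
    intro s
    rw [show (2 * s : ℂ) = ((2 * s : ℝ) : ℂ) by push_cast; rfl, Complex.div_ofReal_re]
  refine (integrable_prod_iff' (by fun_prop)).2 ⟨?_, ?_⟩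
  · refine (ae_restrict_mem measurableSet_Ioi).mono fun s hs => ?_
    have hs : (0:ℝ) < s := hs
    have h := (integrable_mul_cexp_neg_mul_sq (b := p / (2 * s))
      (by rw [hre]; positivity)).restrict (s := Ioi 0)
    refine (h.const_mul ((s : ℂ)⁻¹ * Complex.exp (-p / 2 * s))).congr
      (Filter.Eventually.of_forall fun y => ?_)
    simp only
    ring
  · have h : IntegrableOn (fun s : ℝ => (p.re)⁻¹ * Real.exp (-(p.re / 2) * s)) (Ioi 0) :=
      (integrableOn_exp_mul_Ioi (by linarith) 0).const_mul _
    refine h.congr ?_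
    refine (ae_restrict_mem measurableSet_Ioi).mono fun s hs => ?_
    have hs : (0:ℝ) < s := hs
    have e : ∀ y ∈ Ioi (0:ℝ), ‖(y : ℂ) * ((s : ℂ)⁻¹ * Complex.exp (-p / 2 * s) *
      Complex.exp (-(p / (2 * s)) * y ^ 2))‖ =
        (s⁻¹ * Real.exp (-(p.re / 2) * s)) * (y * Real.exp (-(p.re / (2 * s)) * y ^ 2)) := by
      intro y hy
      have hy : (0:ℝ) < y := hy
      rw [norm_mul, norm_mul, norm_mul, norm_inv, Complex.norm_real, Complex.norm_real,
        Real.norm_eq_abs, Real.norm_eq_abs, abs_of_pos hs, abs_of_pos hy, Complex.norm_exp,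
        Complex.norm_exp, Complex.re_mul_ofReal, ← Complex.ofReal_pow, Complex.re_mul_ofReal,
        Complex.neg_re, hre]
      have : (-p / 2).re = -(p.re / 2) := by
        rw [show (2:ℂ) = ((2:ℝ) : ℂ) by norm_cast, Complex.div_ofReal_re, Complex.neg_re]; ring
      rw [this]; ring
    simp only
    rw [setIntegral_congr_fun measurableSet_Ioi e, integral_const_mul]
    have h2 := integral_mul_cexp_neg_mul_sq (b := ((p.re / (2 * s) : ℝ) : ℂ))
      (by rw [Complex.ofReal_re]; positivity)
    have h3 : ∫ y in Ioi (0:ℝ), y * Real.exp (-(p.re / (2 * s)) * y ^ 2) =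
        (2 * (p.re / (2 * s)))⁻¹ := by
      apply Complex.ofReal_injective
      rw [← integral_complex_ofReal]
      push_cast at h2 ⊢
      exact h2
    rw [h3]
    field_simp

lemma integrableOn_mul_bK {p : ℂ} (hp : 0 < p.re) :
    IntegrableOn (fun y : ℝ => (y : ℂ) * bK (p * y)) (Ioi 0) := by
  have h := (integrable_schwinger hp).integral_prod_left.div_const 2
  refine h.congr ?_
  refine (ae_restrict_mem measurableSet_Ioi).mono fun y hy => ?_
  have hy : (0:ℝ) < y := hy
  simp only
  rw [bK_eq (by rw [Complex.re_mul_ofReal]; positivity), bKc_mul_eq p hy, integral_const_mul]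
  ring

/-- The Weber integral of `J₀` against `K₀`. -/
lemma integral_rJ_mul_bK {p : ℂ} (hp : 0 < p.re) (c : ℝ) :
    ∫ y in Ioi (0:ℝ), (rJ (c * y) : ℂ) * ((y : ℂ) * bK (p * y)) =
      Real.pi / 2 * ∫ s in Ioi (0:ℝ), p⁻¹ * Complex.exp (-((p + c ^ 2 / p) / 2) * s) := by
  have hp0 : p ≠ 0 := by rintro rfl; simp at hp
  have h1 : ∫ y in Ioi (0:ℝ), (rJ (c * y) : ℂ) * ((y : ℂ) * bK (p * y)) =
      (∫ y in Ioi (0:ℝ), ∫ s in Ioi (0:ℝ), (rJ (c * y) : ℂ) * ((y : ℂ) * ((s : ℂ)⁻¹ *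
        Complex.exp (-p / 2 * s) * Complex.exp (-(p / (2 * s)) * y ^ 2)))) / 2 := by
    rw [← integral_div]
    refine setIntegral_congr_fun measurableSet_Ioi fun y hy => ?_
    have hy : (0:ℝ) < y := hy
    rw [bK_eq (by rw [Complex.re_mul_ofReal]; positivity), bKc_mul_eq p hy, integral_const_mul,
      integral_const_mul]
    ring
  rw [h1, integral_integral_swap]
  · rw [div_mul_eq_mul_div, ← integral_const_mul]
    congr 1
    refine setIntegral_congr_fun measurableSet_Ioi fun s hs => ?_
    have hs : (0:ℝ) < s := hs
    have hs0 : (s : ℂ) ≠ 0 := by exact_mod_cast hs.ne'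
    have hre : (p / (2 * s)).re = p.re / (2 * s) := by
      rw [show (2 * s : ℂ) = ((2 * s : ℝ) : ℂ) by push_cast; rfl, Complex.div_ofReal_re]
    have h2 := integral_mul_exp_bI (l := p / (2 * s)) (by rw [hre]; positivity) (c * Complex.I)
    have h3 : ∀ y : ℝ, (rJ (c * y) : ℂ) * ((y : ℂ) * ((s : ℂ)⁻¹ *
        Complex.exp (-p / 2 * s) * Complex.exp (-(p / (2 * s)) * y ^ 2))) =
        ((s : ℂ)⁻¹ * Complex.exp (-p / 2 * s)) * ((y : ℂ) * Complex.exp (-(p / (2 * s)) * y ^ 2) *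
          bI (c * Complex.I * y)) := by
      intro y
      rw [← bI_I_mul]
      push_cast
      rw [mul_right_comm (c : ℂ) Complex.I]
      ring
    simp only [h3]
    rw [integral_const_mul, h2, show -((p + (c:ℂ) ^ 2 / p) / 2) * s = -p / 2 * s +
      (c * Complex.I) ^ 2 / (4 * (p / (2 * s))) by
        rw [mul_pow, Complex.I_sq]; field_simp; ring, Complex.exp_add]
    field_simp
  · have hb := (integrable_schwinger hp).bdd_mul (f := fun q : ℝ × ℝ => (rJ (c * q.1) : ℂ))
      (c := Real.pi) (by fun_prop) (Filter.Eventually.of_forall fun q => ?_)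
    · exact hb
    · rw [Complex.norm_real]
      exact abs_rJ_le _

lemma weber {p : ℂ} (hp : 0 < p.re) (c : ℝ) :
    ∫ y in Ioi (0:ℝ), (rJ (c * y) : ℂ) * ((y : ℂ) * bK (p * y)) = Real.pi / (p ^ 2 + c ^ 2) := by
  have hp0 : p ≠ 0 := by rintro rfl; simp at hp
  have hre : 0 < (p + c ^ 2 / p).re := by
    rw [Complex.add_re, ← Complex.ofReal_pow, Complex.div_re, Complex.ofReal_re, Complex.ofReal_im,
      zero_mul, zero_div, add_zero]
    have := Complex.normSq_nonneg p
    positivity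
  have hq : p + c ^ 2 / p ≠ 0 := by intro h; rw [h] at hre; simp at hre
  have hq2 : p ^ 2 + (c:ℂ) ^ 2 ≠ 0 := by
    intro h; apply hq; field_simp; rw [h, mul_zero]
  rw [integral_rJ_mul_bK hp, integral_const_mul, integral_exp_mul_complex_Ioi]
  · simp only [Complex.ofReal_zero, mul_zero, Complex.exp_zero]
    field_simp
  · have : (-((p + c ^ 2 / p) / 2)).re = -((p + c ^ 2 / p).re / 2) := by
      rw [show (2:ℂ) = ((2:ℝ) : ℂ) by norm_cast, Complex.neg_re, Complex.div_ofReal_re]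
    rw [this]; linarith

lemma one_add_mul_ne_zero {t z : ℂ} (ht : ‖t‖ < 1) (hz : ‖z‖ ≤ 1) : 1 + t * z ≠ 0 := by
  intro h
  have h1 : t * z = -1 := by linear_combination h
  have h2 : ‖t * z‖ = 1 := by rw [h1]; simp
  rw [norm_mul] at h2
  nlinarith [norm_nonneg t, norm_nonneg z]

lemma integral_inv_one_add {t : ℂ} (ht : ‖t‖ < 1) :
    ∫ θ in (-Real.pi)..Real.pi, (1 + t * Complex.exp (θ * Complex.I))⁻¹ = 2 * Real.pi := by
  have hpi := Real.pi_pos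
  have h := circleAverage_of_differentiable_on_off_countable (c := 0) (R := 1)
    (f := fun z : ℂ => (1 + t * z)⁻¹) (s := ∅) countable_empty
    (ContinuousOn.inv₀ (by fun_prop) fun z hz => one_add_mul_ne_zero ht (by simpa using hz))
    (fun z hz => (DifferentiableAt.inv (by fun_prop)
      (one_add_mul_ne_zero ht (by have := hz.1; rw [abs_one, mem_ball_zero_iff] at this; exact this.le))))
  rw [Real.circleAverage_def] at h
  simp only [circleMap_zero, Complex.ofReal_one, one_mul, mul_zero, add_zero, inv_one] at h
  have hp : Function.Periodic (fun θ : ℝ => (1 + t * Complex.exp (θ * Complex.I))⁻¹)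
      (2 * Real.pi) := by
    intro θ
    simp only
    push_cast
    rw [add_mul, Complex.exp_add, Complex.exp_two_pi_mul_I, mul_one]
  have h2 := hp.intervalIntegral_add_eq (-Real.pi) 0
  rw [show -Real.pi + 2 * Real.pi = Real.pi by ring, zero_add] at h2
  rw [h2]
  rw [Complex.real_smul] at h
  have h3 : ((2 * Real.pi : ℝ) : ℂ) ≠ 0 := by exact_mod_cast (by positivity : 2 * Real.pi ≠ 0)
  rw [Complex.ofReal_inv] at h
  rw [inv_mul_eq_iff_eq_mul₀ h3] at h
  rw [h]; push_cast; ring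

lemma integral_inv_one_add_neg {t : ℂ} (ht : ‖t‖ < 1) :
    ∫ θ in (-Real.pi)..Real.pi, (1 + t * Complex.exp (-(θ * Complex.I)))⁻¹ = 2 * Real.pi := by
  have h := intervalIntegral.integral_comp_neg (a := -Real.pi) (b := Real.pi)
    (fun θ : ℝ => (1 + t * Complex.exp (θ * Complex.I))⁻¹)
  rw [neg_neg, integral_inv_one_add ht] at h
  rw [← h]
  push_cast
  simp only [neg_mul]

lemma integral_inv_mul_inv {t : ℂ} (ht : ‖t‖ < 1) :
    ∫ θ in (-Real.pi)..Real.pi, ((1 + t * Complex.exp (θ * Complex.I)) *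
      (1 + t * Complex.exp (-(θ * Complex.I))))⁻¹ = 2 * Real.pi / (1 - t ^ 2) := by
  have n1 : ∀ θ : ℝ, 1 + t * Complex.exp (θ * Complex.I) ≠ 0 := fun θ =>
    one_add_mul_ne_zero ht (Complex.norm_exp_ofReal_mul_I θ).le
  have n2 : ∀ θ : ℝ, 1 + t * Complex.exp (-(θ * Complex.I)) ≠ 0 := fun θ => by
    have := n1 (-θ); push_cast at this; rwa [neg_mul] at this
  have h0 : 1 - t ^ 2 ≠ 0 := by
    intro h
    have h2 : ‖t ^ 2‖ = 1 := by rw [show t ^ 2 = 1 by linear_combination -h]; simp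
    rw [norm_pow] at h2
    nlinarith [norm_nonneg t]
  have e : ∀ θ : ℝ, ((1 + t * Complex.exp (θ * Complex.I)) *
      (1 + t * Complex.exp (-(θ * Complex.I))))⁻¹ = ((1 + t * Complex.exp (θ * Complex.I))⁻¹ +
        (1 + t * Complex.exp (-(θ * Complex.I)))⁻¹ - 1) * (1 - t ^ 2)⁻¹ := by
    intro θ
    have h1 := n1 θ
    have h2 := n2 θ
    have h3 : Complex.exp (θ * Complex.I) * Complex.exp (-(θ * Complex.I)) = 1 := by
      rw [← Complex.exp_add, add_neg_cancel, Complex.exp_zero]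
    set u := Complex.exp (θ * Complex.I)
    set v := Complex.exp (-(θ * Complex.I))
    field_simp
    linear_combination t ^ 2 * h3
  simp only [e]
  have c1 : Continuous fun θ : ℝ => (1 + t * Complex.exp (θ * Complex.I))⁻¹ :=
    Continuous.inv₀ (by fun_prop) n1
  have c2 : Continuous fun θ : ℝ => (1 + t * Complex.exp (-(θ * Complex.I)))⁻¹ :=
    Continuous.inv₀ (by fun_prop) n2
  rw [intervalIntegral.integral_mul_const, intervalIntegral.integral_sub,
    intervalIntegral.integral_add, integral_inv_one_add ht, integral_inv_one_add_neg ht,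
    intervalIntegral.integral_const]
  · rw [Complex.real_smul, mul_one, div_eq_mul_inv]
    congr 1; push_cast; ring
  · exact c1.intervalIntegrable _ _
  · exact c2.intervalIntegrable _ _
  · exact (c1.add c2).intervalIntegrable _ _
  · exact continuous_const.intervalIntegrable _ _

lemma csq_re_pos {z : ℂ} (hz : z ∈ Complex.slitPlane) : 0 < (csq z).re := by
  have hpi := Real.pi_pos
  rw [csq, Complex.cpow_ofReal_re]
  have h0 : 0 < ‖z‖ := norm_pos_iff.2 (Complex.slitPlane_ne_zero hz)
  refine mul_pos (by positivity) (Real.cos_pos_of_mem_Ioo ⟨?_, ?_⟩)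
  · have := (lt_of_le_of_ne (Complex.arg_le_pi z) (Complex.slitPlane_arg_ne_pi hz))
    linarith
  · have := Complex.neg_pi_lt_arg z
    linarith

/-- The principal value of `(A * B) ^ (-1/2)` for `A, B` in the upper half-plane. -/
noncomputable def bE (A B : ℂ) : ℂ := -Complex.I * (csq (-Complex.I * A) * csq (-Complex.I * B))

lemma integral_inv_add_mul_cos {P Q : ℂ} (h1 : 0 < (P + Q).im) (h2 : 0 < (P - Q).im) :
    ∫ θ in (-Real.pi)..Real.pi, (P + Q * Real.cos θ)⁻¹ = 2 * Real.pi * bE (P + Q) (P - Q) := by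
  have aux : ∀ {z : ℂ}, 0 < z.im → 0 < (-Complex.I * z).re ∧ csq (-Complex.I * z) ≠ 0 ∧
      ((csq (-Complex.I * z))⁻¹) ^ 2 = -Complex.I * z ∧ 0 < ((csq (-Complex.I * z))⁻¹).re := by
    intro z hz
    have h1 : 0 < (-Complex.I * z).re := by simpa using hz
    have h2 := csq_re_pos (re_pos_subset_slitPlane h1)
    have h3 : csq (-Complex.I * z) ≠ 0 := by intro h; rw [h] at h2; simp at h2
    refine ⟨h1, h3, ?_, ?_⟩
    · rw [inv_pow, pow_two, csq_mul_self, inv_inv]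
    · rw [Complex.inv_re]
      exact div_pos h2 (Complex.normSq_pos.2 h3)
  obtain ⟨ra, na, sa, pa⟩ := aux h1
  obtain ⟨rb, nb, sb, pb⟩ := aux h2
  rw [bE]
  have ea : csq (-Complex.I * (P + Q)) = ((csq (-Complex.I * (P + Q)))⁻¹)⁻¹ := (inv_inv _).symm
  have eb : csq (-Complex.I * (P - Q)) = ((csq (-Complex.I * (P - Q)))⁻¹)⁻¹ := (inv_inv _).symm
  rw [ea, eb]
  set α := (csq (-Complex.I * (P + Q)))⁻¹ with hα
  set β := (csq (-Complex.I * (P - Q)))⁻¹ with hβ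
  have hab : 0 < α.re * β.re + α.im * β.im := by
    have h3 : α.im ^ 2 < α.re ^ 2 := by
      have := congrArg Complex.re sa
      rw [pow_two, Complex.mul_re] at this
      nlinarith
    have h4 : β.im ^ 2 < β.re ^ 2 := by
      have := congrArg Complex.re sb
      rw [pow_two, Complex.mul_re] at this
      nlinarith
    have h5 := abs_lt_of_sq_lt_sq h3 pa.le
    have h6 := abs_lt_of_sq_lt_sq h4 pb.le
    have h7 : |α.im| * |β.im| < α.re * β.re := mul_lt_mul'' h5 h6 (abs_nonneg _) (abs_nonneg _)
    have h8 := neg_abs_le (α.im * β.im)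
    rw [abs_mul] at h8
    linarith
  have hns : ‖α - β‖ < ‖α + β‖ := by
    refine lt_of_pow_lt_pow_left₀ 2 (norm_nonneg _) ?_
    rw [← Complex.normSq_eq_norm_sq, ← Complex.normSq_eq_norm_sq, Complex.normSq_apply,
      Complex.normSq_apply, Complex.add_re, Complex.add_im, Complex.sub_re, Complex.sub_im]
    nlinarith
  have hs0 : α + β ≠ 0 := by
    intro h; rw [h, norm_zero] at hns; exact absurd hns (not_lt.2 (norm_nonneg _))
  have ht : ‖(α - β) / (α + β)‖ < 1 := by
    rw [norm_div, div_lt_one (norm_pos_iff.2 hs0)]; exact hns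
  have hα0 : α ≠ 0 := inv_ne_zero na
  have hβ0 : β ≠ 0 := inv_ne_zero nb
  have hI := Complex.I_sq
  have e : ∀ θ : ℝ, (P + Q * Real.cos θ)⁻¹ =
      (-4 * Complex.I / (α + β) ^ 2) * ((1 + (α - β) / (α + β) * Complex.exp (θ * Complex.I)) *
      (1 + (α - β) / (α + β) * Complex.exp (-(θ * Complex.I))))⁻¹ := by
    intro θ
    have h3 : Complex.exp (θ * Complex.I) * Complex.exp (-(θ * Complex.I)) = 1 := by
      rw [← Complex.exp_add, add_neg_cancel, Complex.exp_zero]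
    have h4 : (Real.cos θ : ℂ) = (Complex.exp (θ * Complex.I) + Complex.exp (-(θ * Complex.I))) / 2 := by
      rw [Complex.ofReal_cos, Complex.cos, neg_mul]
    rw [h4]
    set u := Complex.exp (θ * Complex.I)
    set v := Complex.exp (-(θ * Complex.I))
    have h5 : (-4 * Complex.I / (α + β) ^ 2) = (Complex.I / 4 * (α + β) ^ 2)⁻¹ := by
      refine eq_inv_of_mul_eq_one_left ?_
      field_simp
      linear_combination -hI
    rw [h5, ← mul_inv]
    congr 1
    have h6 : Complex.I / 4 * (α + β) ^ 2 *
        ((1 + (α - β) / (α + β) * u) * (1 + (α - β) / (α + β) * v)) =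
        Complex.I / 4 * ((α + β) + (α - β) * u) * ((α + β) + (α - β) * v) := by
      field_simp
    rw [h6]
    linear_combination (P + Q * (u + v) / 2) * hI - Complex.I / 4 * (2 + (u + v)) * sa -
      Complex.I / 4 * (2 - (u + v)) * sb - Complex.I / 4 * (α - β) ^ 2 * h3
  simp only [e]
  rw [intervalIntegral.integral_const_mul, integral_inv_mul_inv ht]
  have h7 : 1 - ((α - β) / (α + β)) ^ 2 = 4 * (α * β) / (α + β) ^ 2 := by
    field_simp; ring
  rw [h7]
  field_simp

lemma circle_norm_sq (a b δ : ℝ) : ‖(a + b * Complex.exp (δ * Complex.I) : ℂ)‖ ^ 2 =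
    a ^ 2 + b ^ 2 + 2 * a * b * Real.cos δ := by
  rw [← Complex.normSq_eq_norm_sq, Complex.normSq_apply, Complex.add_re, Complex.add_im,
    Complex.ofReal_re, Complex.ofReal_im, Complex.re_ofReal_mul, Complex.im_ofReal_mul,
    Complex.exp_ofReal_mul_I_re, Complex.exp_ofReal_mul_I_im]
  linear_combination b ^ 2 * Real.sin_sq_add_cos_sq δ

lemma weber_mul {p : ℂ} (hp : 0 < p.re) (hp2 : 0 < (p ^ 2).im) (a b : ℝ) :
    ∫ y in Ioi (0:ℝ), (rJ (a * y) * rJ (b * y) : ℂ) * ((y : ℂ) * bK (p * y)) =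
      Real.pi ^ 2 * bE (p ^ 2 + (a + b) ^ 2) (p ^ 2 + (a - b) ^ 2) := by
  have hpi := Real.pi_pos
  have h1 : ∀ y ∈ Ioi (0:ℝ), (rJ (a * y) * rJ (b * y) : ℂ) * ((y : ℂ) * bK (p * y)) =
      (∫ δ in Ioc (-Real.pi) Real.pi, (rJ (‖(a + b * Complex.exp (δ * Complex.I) : ℂ)‖ * y) : ℂ) *
        ((y : ℂ) * bK (p * y))) / 2 := by
    intro y hy
    have hy : (0:ℝ) < y := hy
    rw [integral_mul_const, ← Complex.ofReal_mul, rJ_mul_rJ,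
      intervalIntegral.integral_of_le (by linarith), integral_complex_ofReal]
    have : ∀ δ : ℝ, ‖(((a * y : ℝ) : ℂ) + ((b * y : ℝ) : ℂ) * Complex.exp (δ * Complex.I) : ℂ)‖ =
        ‖(a + b * Complex.exp (δ * Complex.I) : ℂ)‖ * y := by
      intro δ
      have h2 : ‖(y : ℂ)‖ = y := by rw [Complex.norm_real, Real.norm_eq_abs, abs_of_pos hy]
      rw [← h2, ← norm_mul, h2]
      congr 1; push_cast; ring
    simp only [this]
    push_cast; ring
  rw [setIntegral_congr_fun measurableSet_Ioi h1, integral_div, integral_integral_swap]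
  · simp only [weber hp]
    have h2 : ∀ δ : ℝ, (Real.pi : ℂ) / (p ^ 2 + (‖(a + b * Complex.exp (δ * Complex.I) : ℂ)‖ : ℂ) ^ 2) =
        Real.pi * ((p ^ 2 + (a ^ 2 + b ^ 2 : ℝ)) + (2 * a * b : ℝ) * Real.cos δ)⁻¹ := by
      intro δ
      rw [← Complex.ofReal_pow, circle_norm_sq, div_eq_mul_inv]
      congr 2; push_cast; ring
    simp only [h2]
    rw [integral_const_mul, ← intervalIntegral.integral_of_le (by linarith),
      integral_inv_add_mul_cos 
        (by simp only [Complex.add_im, Complex.ofReal_im, add_zero]; exact hp2)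
        (by simp only [Complex.add_im, Complex.sub_im, Complex.ofReal_im, add_zero, sub_zero]; exact hp2)]
    have e1 : p ^ 2 + ((a ^ 2 + b ^ 2 : ℝ) : ℂ) + ((2 * a * b : ℝ) : ℂ) = p ^ 2 + (a + b) ^ 2 := by
      push_cast; ring
    have e2 : p ^ 2 + ((a ^ 2 + b ^ 2 : ℝ) : ℂ) - ((2 * a * b : ℝ) : ℂ) = p ^ 2 + (a - b) ^ 2 := by
      push_cast; ring
    rw [e1, e2]; ring
  · have hb := ((integrableOn_mul_bK hp).mul_prod
      (integrable_const (1:ℂ) (μ := volume.restrict (Ioc (-Real.pi) Real.pi)))).bdd_mul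
      (f := fun q : ℝ × ℝ => (rJ (‖(a + b * Complex.exp (q.2 * Complex.I) : ℂ)‖ * q.1) : ℂ))
      (c := Real.pi) (by fun_prop) (Filter.Eventually.of_forall fun q => ?_)
    · simp only [mul_one] at hb; exact hb
    · rw [Complex.norm_real]
      exact abs_rJ_le _

lemma rJ_sq (y : ℝ) :
    rJ y ^ 2 = ∫ α in Ioc (-(Real.pi / 2)) (Real.pi / 2), rJ (2 * Real.cos α * y) := by
  have hpi := Real.pi_pos
  rw [pow_two, rJ_mul_rJ]
  have h : ∀ δ : ℝ, rJ ‖(y + y * Complex.exp (δ * Complex.I) : ℂ)‖ =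
      rJ (2 * Real.cos (δ / 2) * y) := by
    intro δ
    rw [← rJ_abs (2 * _ * _)]
    congr 1
    rw [← abs_of_nonneg (norm_nonneg _)]
    apply (sq_eq_sq_iff_abs_eq_abs _ _).1
    rw [circle_norm_sq]
    have := Real.cos_sq (δ / 2)
    rw [mul_div_cancel₀ _ (two_ne_zero)] at this
    linear_combination -(4 * y ^ 2) * this
  simp only [h]
  rw [intervalIntegral.integral_comp_div (fun x => rJ (2 * Real.cos x * y)) two_ne_zero,
    ← intervalIntegral.integral_of_le (by linarith), smul_eq_mul, mul_comm, mul_div_cancel_right₀ _ two_ne_zero, neg_div]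

/-- Lebesgue measure on a half-open interval of length `π`. -/
noncomputable def mua : Measure ℝ := volume.restrict (Ioc (-(Real.pi / 2)) (Real.pi / 2))

instance : IsFiniteMeasure mua := by unfold mua; infer_instance

lemma integral_rJ_pow_mul_bK {p : ℂ} (hp : 0 < p.re) (hp2 : 0 < (p ^ 2).im) :
    ∫ y in Ioi (0:ℝ), (rJ y : ℂ) ^ 4 * ((y : ℂ) * bK (p * y)) =
      ∫ q : ℝ × ℝ, Real.pi ^ 2 * bE (p ^ 2 + ((2 * Real.cos q.1 + 2 * Real.cos q.2) ^ 2 : ℝ))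
        (p ^ 2 + ((2 * Real.cos q.1 - 2 * Real.cos q.2) ^ 2 : ℝ)) ∂(mua.prod mua) := by
  have h1 : ∀ y ∈ Ioi (0:ℝ), (rJ y : ℂ) ^ 4 * ((y : ℂ) * bK (p * y)) =
      ∫ q : ℝ × ℝ, (rJ (2 * Real.cos q.1 * y) * rJ (2 * Real.cos q.2 * y) : ℂ) *
        ((y : ℂ) * bK (p * y)) ∂(mua.prod mua) := by
    intro y _
    rw [integral_mul_const, integral_prod_mul (fun α => (rJ (2 * Real.cos α * y) : ℂ))
      (fun α => (rJ (2 * Real.cos α * y) : ℂ)), integral_complex_ofReal, mua, ← rJ_sq]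
    push_cast; ring
  rw [setIntegral_congr_fun measurableSet_Ioi h1, integral_integral_swap]
  · congr 1
    funext q
    have := weber_mul hp hp2 (2 * Real.cos q.1) (2 * Real.cos q.2)
    rw [this]
    push_cast; rfl
  · have hb := ((integrableOn_mul_bK hp).mul_prod
      (integrable_const (1:ℂ) (μ := mua.prod mua))).bdd_mul
      (f := fun q : ℝ × ℝ × ℝ => (rJ (2 * Real.cos q.2.1 * q.1) * rJ (2 * Real.cos q.2.2 * q.1) : ℂ))
      (c := Real.pi * Real.pi) (by fun_prop) (Filter.Eventually.of_forall fun q => ?_)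
    · simp only [mul_one] at hb; exact hb
    · rw [norm_mul, Complex.norm_real, Complex.norm_real]
      exact mul_le_mul (abs_rJ_le _) (abs_rJ_le _) (abs_nonneg _) Real.pi_pos.le

lemma csq_ofReal_mul {t : ℝ} (ht : 0 < t) {z : ℂ} (hz : z ≠ 0) :
    csq (t * z) = isq t * csq z := by
  have ht0 : (t : ℂ) ≠ 0 := by exact_mod_cast ht.ne'
  rw [← csq_ofReal ht.le, csq, csq, csq, Complex.cpow_def_of_ne_zero (mul_ne_zero ht0 hz),
    Complex.cpow_def_of_ne_zero ht0, Complex.cpow_def_of_ne_zero hz, ← Complex.exp_add,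
    Complex.log_ofReal_mul ht hz, Complex.ofReal_log ht.le, add_mul]

lemma csq_I_mul_csq_neg_I : csq Complex.I * csq (-Complex.I) = 1 := by
  have h : Complex.I ∈ Complex.slitPlane := by simp [Complex.mem_slitPlane_iff]
  rw [← Complex.conj_I, csq_conj h, Complex.mul_conj, Complex.normSq_eq_norm_sq, norm_csq]
  simp [isq]

lemma bE_ofReal_im {s t : ℝ} (hs : s ≠ 0) (ht : t ≠ 0) : -(bE s t).im = isq (-(s * t)) := by
  have hp : ∀ {x : ℝ}, 0 < x → csq (-Complex.I * x) = isq x * csq (-Complex.I) := by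
    intro x hx
    rw [mul_comm, csq_ofReal_mul hx (by simp)]
  have hn : ∀ {x : ℝ}, x < 0 → csq (-Complex.I * x) = isq (-x) * csq Complex.I := by
    intro x hx
    rw [← csq_ofReal_mul (by linarith) Complex.I_ne_zero]
    congr 1; push_cast; ring
  have h1 : csq (-Complex.I) * csq (-Complex.I) = Complex.I := by
    rw [csq_mul_self, inv_neg, Complex.inv_I, neg_neg]
  have h2 : csq Complex.I * csq Complex.I = -Complex.I := by rw [csq_mul_self, Complex.inv_I]
  have h3 := csq_I_mul_csq_neg_I
  have hI := Complex.I_sq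
  rw [bE]
  rcases lt_or_gt_of_ne hs with hs | hs <;> rcases lt_or_gt_of_ne ht with ht | ht
  · rw [hn hs, hn ht, isq_of_nonpos (t := -(s * t)) (by nlinarith),
      show -Complex.I * (isq (-s) * csq Complex.I * (isq (-t) * csq Complex.I)) =
        ((-(isq (-s) * isq (-t)) : ℝ) : ℂ) by
        push_cast
        linear_combination -Complex.I * isq (-s) * isq (-t) * h2 + isq (-s) * isq (-t) * hI,
      Complex.ofReal_im, neg_zero]
  · rw [hn hs, hp ht, show -(s * t) = -s * t by ring, isq_mul (by linarith),
      show -Complex.I * (isq (-s) * csq Complex.I * (isq t * csq (-Complex.I))) =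
        ((-(isq (-s) * isq t) : ℝ) : ℂ) * Complex.I by
        push_cast
        linear_combination -Complex.I * isq (-s) * isq t * h3,
      Complex.im_ofReal_mul, Complex.I_im]
    ring
  · rw [hp hs, hn ht, show -(s * t) = s * -t by ring, isq_mul hs.le,
      show -Complex.I * (isq s * csq (-Complex.I) * (isq (-t) * csq Complex.I)) =
        ((-(isq s * isq (-t)) : ℝ) : ℂ) * Complex.I by
        push_cast
        linear_combination -Complex.I * isq s * isq (-t) * h3,
      Complex.im_ofReal_mul, Complex.I_im]
    ring
  · rw [hp hs, hp ht, isq_of_nonpos (t := -(s * t)) (by nlinarith),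
      show -Complex.I * (isq s * csq (-Complex.I) * (isq t * csq (-Complex.I))) =
        ((isq s * isq t : ℝ) : ℂ) by
        push_cast
        linear_combination -Complex.I * isq s * isq t * h1 - isq s * isq t * hI,
      Complex.ofReal_im, neg_zero]

/-- The unit vector approaching `I` from the first quadrant. -/
noncomputable def pdir (η : ℝ) : ℂ := Complex.exp (((Real.pi / 2 - η : ℝ) : ℂ) * Complex.I)

@[fun_prop]
lemma continuous_pdir : Continuous pdir := by unfold pdir; fun_prop

lemma norm_pdir (η : ℝ) : ‖pdir η‖ = 1 := Complex.norm_exp_ofReal_mul_I _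

lemma pdir_zero : pdir 0 = Complex.I := by
  rw [pdir, sub_zero]; push_cast; exact Complex.exp_pi_div_two_mul_I

lemma pdir_re (η : ℝ) : (pdir η).re = Real.sin η := by
  rw [pdir, Complex.exp_ofReal_mul_I_re, Real.cos_pi_div_two_sub]

lemma pdir_im (η : ℝ) : (pdir η).im = Real.cos η := by
  rw [pdir, Complex.exp_ofReal_mul_I_im, Real.sin_pi_div_two_sub]

lemma pdir_sq_im (η : ℝ) : (pdir η ^ 2).im = 2 * Real.sin η * Real.cos η := by
  rw [pow_two, Complex.mul_im, pdir_re, pdir_im]; ring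

lemma pdir_sq_re (η : ℝ) : (pdir η ^ 2).re = Real.sin η ^ 2 - Real.cos η ^ 2 := by
  rw [pow_two, Complex.mul_re, pdir_re, pdir_im]; ring

lemma abs_sub_one_le_norm_pdir (η : ℝ) {X : ℝ} (hX : 0 ≤ X) : |X - 1| ≤ ‖pdir η ^ 2 + (X : ℝ)‖ := by
  refine abs_le_of_sq_le_sq ?_ (norm_nonneg _)
  rw [← Complex.normSq_eq_norm_sq, Complex.normSq_apply, Complex.add_re, Complex.add_im,
    Complex.ofReal_re, Complex.ofReal_im, pdir_sq_re, pdir_sq_im]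
  have h := Real.sin_sq_add_cos_sq η
  have h2 : Real.cos η ^ 2 = 1 - Real.sin η ^ 2 := by linarith
  have h3 := sq_nonneg (Real.sin η)
  have h4 : (2 * Real.sin η * Real.cos η) ^ 2 = 4 * Real.sin η ^ 2 * (1 - Real.sin η ^ 2) := by
    rw [← h2]; ring
  nlinarith [mul_nonneg hX h3]

lemma norm_bE_le (η : ℝ) {X Y : ℝ} (hX : 0 ≤ X) (hY : 0 ≤ Y) (hX1 : X ≠ 1) (hY1 : Y ≠ 1) :
    ‖bE (pdir η ^ 2 + X) (pdir η ^ 2 + Y)‖ ≤ isq |X - 1| * isq |Y - 1| := by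
  rw [bE, norm_mul, norm_neg, Complex.norm_I, one_mul, norm_mul, norm_csq, norm_csq, norm_mul,
    norm_mul, norm_neg, Complex.norm_I, one_mul, one_mul]
  exact mul_le_mul (isq_anti (abs_pos.2 (sub_ne_zero.2 hX1)) (abs_sub_one_le_norm_pdir η hX))
    (isq_anti (abs_pos.2 (sub_ne_zero.2 hY1)) (abs_sub_one_le_norm_pdir η hY)) (isq_nonneg _)
    (isq_nonneg _)

lemma tendsto_bE {X Y : ℝ} (hX1 : X ≠ 1) (hY1 : Y ≠ 1) :
    Filter.Tendsto (fun η => bE (pdir η ^ 2 + X) (pdir η ^ 2 + Y)) (nhdsWithin 0 (Ioi 0))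
      (nhds (bE ((X - 1 : ℝ) : ℂ) ((Y - 1 : ℝ) : ℂ))) := by
  have hc : ∀ {X : ℝ}, X ≠ 1 → ContinuousAt (fun η => csq (-Complex.I * (pdir η ^ 2 + X))) 0 := by
    intro X hX
    refine ContinuousAt.comp (g := csq) (f := fun η => -Complex.I * (pdir η ^ 2 + X))
      (continuousAt_csq ?_) (by fun_prop)
    rw [pdir_zero, Complex.I_sq, Complex.mem_slitPlane_iff]
    right
    simpa [neg_eq_zero, add_comm, ← sub_eq_add_neg, sub_eq_zero] using hX.symm
  have h : ContinuousAt (fun η => bE (pdir η ^ 2 + X) (pdir η ^ 2 + Y)) 0 := by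
    unfold bE
    exact ((hc hX1).mul (hc hY1)).const_mul _
  have h2 := h.tendsto.mono_left (nhdsWithin_le_nhds (s := Ioi 0))
  rw [pdir_zero, Complex.I_sq] at h2
  convert h2 using 2
  push_cast; ring_nf

lemma abs_rJ_le_kdec {y : ℝ} (hy : 0 < y) : |rJ y| ≤ 2 * (kC * kdec y) := by
  have h0 : (y * Complex.I : ℂ) ≠ 0 := by simp [hy.ne']
  have h := norm_bK_le h0
  rw [norm_mul, Complex.norm_I, mul_one, Complex.norm_real, Real.norm_of_nonneg hy.le] at h
  simp only [Complex.re_ofReal_mul, Complex.I_re, mul_zero, neg_zero, Real.exp_zero, one_mul] at h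
  rw [rJ_eq hy, abs_mul, abs_neg, abs_two]
  have := Complex.abs_im_le_norm (bK (y * Complex.I))
  linarith

lemma integrableOn_mul_kdec_pow : IntegrableOn (fun y => y * kdec y ^ 5) (Ioi 0) := by
  rw [integrableOn_Ioi_iff_exp]
  refine integrable_logmaj.mono' ?_ (Filter.Eventually.of_forall fun t => ?_)
  · refine Continuous.aestronglyMeasurable ?_
    have h : Continuous fun t : ℝ => kdec (Real.exp t) :=
      continuous_iff_continuousAt.2 fun t =>
        ContinuousAt.comp (continuousAt_kdec (Real.exp_pos t)) Real.continuous_exp.continuousAt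
    fun_prop
  · have h0 := kdec_nonneg (Real.exp_pos t).le
    rw [Real.norm_of_nonneg (by positivity), ← mul_assoc, ← pow_two]
    exact sq_mul_kdec_le t

lemma norm_rJ_pow_mul_bK_le {p : ℂ} (hp : 0 ≤ p.re) (hp1 : ‖p‖ = 1) {y : ℝ} (hy : 0 < y) :
    ‖(rJ y : ℂ) ^ 4 * ((y : ℂ) * bK (p * y))‖ ≤ 16 * kC ^ 5 * (y * kdec y ^ 5) := by
  have hp0 : p * y ≠ 0 := mul_ne_zero (norm_ne_zero_iff.1 (by rw [hp1]; exact one_ne_zero))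
    (by exact_mod_cast hy.ne')
  have h1 := norm_bK_le hp0
  have hk := kdec_nonneg hy.le
  have hC := kC_nonneg
  rw [norm_mul, hp1, one_mul, Complex.norm_real, Real.norm_of_nonneg hy.le,
    Complex.re_mul_ofReal] at h1
  have h2 : Real.exp (-(p.re * y)) ≤ 1 := Real.exp_le_one_iff.2 (by nlinarith)
  have h3 : ‖bK (p * y)‖ ≤ kC * kdec y := h1.trans (mul_le_of_le_one_left (by positivity) h2)
  rw [norm_mul, norm_pow, norm_mul, Complex.norm_real, Complex.norm_real, Real.norm_eq_abs,
    Real.norm_of_nonneg hy.le]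
  calc |rJ y| ^ 4 * (y * ‖bK (p * y)‖) ≤ (2 * (kC * kdec y)) ^ 4 * (y * (kC * kdec y)) := by
        gcongr
        exact abs_rJ_le_kdec hy
    _ = _ := by ring

lemma continuousOn_rJ_pow_mul_bK {p : ℂ} (hp : p ∈ Complex.slitPlane) :
    ContinuousOn (fun y : ℝ => (rJ y : ℂ) ^ 4 * ((y : ℂ) * bK (p * y))) (Ioi 0) := by
  have h : ContinuousOn (fun y : ℝ => bK (p * y)) (Ioi 0) := by
    refine differentiableOn_bK.continuousOn.comp (by fun_prop) fun y hy => ?_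
    rw [Complex.mem_slitPlane_iff] at hp ⊢
    rw [Complex.re_mul_ofReal, Complex.im_mul_ofReal]
    have hy' : (0:ℝ) < y := hy
    exact hp.imp (fun h => mul_pos h hy') (fun h => mul_ne_zero h hy'.ne')
  fun_prop

lemma im_rJ_pow_mul_bK {y : ℝ} (hy : 0 < y) :
    -((rJ y : ℂ) ^ 4 * ((y : ℂ) * bK (Complex.I * y))).im = y * rJ y ^ 5 / 2 := by
  rw [← Complex.ofReal_pow, Complex.im_ofReal_mul, Complex.im_ofReal_mul, mul_comm Complex.I]
  have := rJ_eq hy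
  linear_combination (y * rJ y ^ 4 / 2) * (-this)

lemma eventually_pdir : ∀ᶠ η : ℝ in nhdsWithin 0 (Ioi 0), η ∈ Ioo 0 (Real.pi / 2) :=
  Ioo_mem_nhdsGT (by positivity)

lemma pdir_re_pos {η : ℝ} (h : η ∈ Ioo 0 (Real.pi / 2)) : 0 < (pdir η).re := by
  rw [pdir_re]
  exact Real.sin_pos_of_pos_of_lt_pi h.1 (by linarith [h.2, Real.pi_pos])

lemma pdir_sq_im_pos {η : ℝ} (h : η ∈ Ioo 0 (Real.pi / 2)) : 0 < (pdir η ^ 2).im := by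
  have h1 := pdir_re_pos h
  have h2 := Real.cos_pos_of_mem_Ioo ⟨by linarith [h.1, Real.pi_pos], h.2⟩
  rw [pdir_re] at h1
  rw [pdir_sq_im]
  positivity

lemma tendsto_integral_rJ_pow_mul_bK :
    Filter.Tendsto (fun η => -(∫ y in Ioi (0:ℝ),
      (rJ y : ℂ) ^ 4 * ((y : ℂ) * bK (pdir η * y))).im) (nhdsWithin 0 (Ioi 0))
      (nhds (∫ y in Ioi (0:ℝ), y * rJ y ^ 5 / 2)) := by
  have hI : Complex.I ∈ Complex.slitPlane := by simp [Complex.mem_slitPlane_iff]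
  have hlim : Filter.Tendsto (fun η => ∫ y in Ioi (0:ℝ),
      (rJ y : ℂ) ^ 4 * ((y : ℂ) * bK (pdir η * y))) (nhdsWithin 0 (Ioi 0))
      (nhds (∫ y in Ioi (0:ℝ), (rJ y : ℂ) ^ 4 * ((y : ℂ) * bK (Complex.I * y)))) := by
    refine tendsto_integral_filter_of_dominated_convergence
      (fun y => 16 * kC ^ 5 * (y * kdec y ^ 5)) ?_ ?_ (integrableOn_mul_kdec_pow.const_mul _) ?_
    · filter_upwards [eventually_pdir] with η hη
      exact (continuousOn_rJ_pow_mul_bK (re_pos_subset_slitPlane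
        (pdir_re_pos hη))).aestronglyMeasurable measurableSet_Ioi
    · filter_upwards [eventually_pdir] with η hη
      filter_upwards [ae_restrict_mem measurableSet_Ioi] with y hy
      exact norm_rJ_pow_mul_bK_le (pdir_re_pos hη).le (norm_pdir η) hy
    · filter_upwards [ae_restrict_mem measurableSet_Ioi] with y hy
      refine Filter.Tendsto.const_mul _ (Filter.Tendsto.const_mul _ ?_)
      have hIy : Complex.I * (y:ℂ) ∈ Complex.slitPlane := by
        simp [Complex.mem_slitPlane_iff, (mem_Ioi.1 hy).ne']
      have hc := (differentiableOn_bK.differentiableAt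
        (Complex.isOpen_slitPlane.mem_nhds hIy)).continuousAt
      have h : Continuous fun η => pdir η * (y:ℂ) := by fun_prop
      have h0 := h.tendsto 0
      rw [pdir_zero] at h0
      exact hc.tendsto.comp (h0.mono_left nhdsWithin_le_nhds)
  have hfi : IntegrableOn (fun y : ℝ => (rJ y : ℂ) ^ 4 * ((y : ℂ) * bK (Complex.I * y)))
      (Ioi 0) := by
    refine (integrableOn_mul_kdec_pow.const_mul (16 * kC ^ 5)).mono'
      ((continuousOn_rJ_pow_mul_bK hI).aestronglyMeasurable measurableSet_Ioi) ?_
    filter_upwards [ae_restrict_mem measurableSet_Ioi] with y hy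
    exact norm_rJ_pow_mul_bK_le (by simp) (by simp) hy
  have h2 := (Complex.continuous_im.tendsto _).comp hlim
  have h3 := h2.neg
  have e : -(∫ y in Ioi (0:ℝ), (rJ y : ℂ) ^ 4 * ((y : ℂ) * bK (Complex.I * y))).im =
      ∫ y in Ioi (0:ℝ), y * rJ y ^ 5 / 2 := by
    rw [← setIntegral_congr_fun measurableSet_Ioi (fun y hy => im_rJ_pow_mul_bK hy), integral_neg]
    congr 1
    exact (integral_im hfi).symm
  rw [e] at h3
  exact h3

/-- Uniform bound for the mass of an inverse square root singularity. -/
noncomputable def isqMass : ENNReal := ∫⁻ x in Ioc (-Real.pi) Real.pi, eisq |x|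

lemma isqMass_lt_top : isqMass < ⊤ := by
  have h := (integrableOn_isq_abs_sub 0 (-Real.pi) Real.pi).lintegral_lt_top
  simpa [isqMass, eisq] using h

lemma lintegral_mua_eisq_abs_sub_le {c : ℝ} (hc : |c| ≤ Real.pi / 2) :
    ∫⁻ α, eisq |α - c| ∂mua ≤ isqMass := by
  obtain ⟨h1, h2⟩ := abs_le.1 hc
  calc ∫⁻ α, eisq |α - c| ∂mua
      = ∫⁻ α, (Ioc (-(Real.pi / 2) - c) (Real.pi / 2 - c)).indicator (fun x => eisq |x|) (α - c) := by
        rw [mua, ← lintegral_indicator measurableSet_Ioc]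
        refine lintegral_congr fun α => ?_
        have : α - c ∈ Ioc (-(Real.pi / 2) - c) (Real.pi / 2 - c) ↔
            α ∈ Ioc (-(Real.pi / 2)) (Real.pi / 2) := by
          simp only [mem_Ioc, sub_lt_sub_iff_right, sub_le_sub_iff_right]
        simp only [indicator, this]
    _ = ∫⁻ x in Ioc (-(Real.pi / 2) - c) (Real.pi / 2 - c), eisq |x| := by
        rw [lintegral_sub_right_eq_self, lintegral_indicator measurableSet_Ioc]
    _ ≤ isqMass := lintegral_mono_set (Ioc_subset_Ioc (by linarith) (by linarith))

lemma half_dist_le_cos_sub {a κ : ℝ} (ha : a ∈ Icc 0 (Real.pi / 2))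
    (hκ : κ ∈ Icc (Real.pi / 3) (Real.pi / 2)) :
    |a - κ| / 2 ≤ |2 * Real.cos a - 2 * Real.cos κ| := by
  have hpi := Real.pi_pos
  obtain ⟨ha0, ha1⟩ := ha
  obtain ⟨hk0, hk1⟩ := hκ
  have h1 : 1 / 2 ≤ Real.sin ((a + κ) / 2) := by
    rw [← Real.sin_pi_div_six]
    exact Real.sin_le_sin_of_le_of_le_pi_div_two (by linarith) (by linarith) (by linarith)
  have h2 : |a - κ| / 4 ≤ |Real.sin ((a - κ) / 2)| := by
    have h := Real.mul_abs_le_abs_sin (x := (a - κ) / 2) (by rw [abs_le]; constructor <;> linarith)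
    refine le_trans ?_ h
    have : 1 / 2 ≤ 2 / Real.pi := by
      rw [div_le_div_iff₀ two_pos hpi]
      linarith [Real.pi_le_four]
    rw [abs_div, abs_two]
    nlinarith [abs_nonneg (a - κ)]
  have h3 : 2 * Real.cos a - 2 * Real.cos κ =
      -(4 * Real.sin ((a + κ) / 2) * Real.sin ((a - κ) / 2)) := by
    rw [← mul_sub, Real.cos_sub_cos]; ring
  rw [h3, abs_neg, abs_mul,
    abs_of_pos (show 0 < 4 * Real.sin ((a + κ) / 2) by linarith)]
  nlinarith [abs_nonneg (a - κ)]

lemma eisq_anti {s t : ℝ} (hs : 0 < s) (hst : s ≤ t) : eisq t ≤ eisq s :=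
  ENNReal.ofReal_le_ofReal (isq_anti hs hst)

lemma eisq_cos_le {k : ℝ} (hk : k ∈ Icc (0:ℝ) 1) : ∃ κ, |κ| ≤ Real.pi / 2 ∧
    ∀ α ∈ Ioc (-(Real.pi / 2)) (Real.pi / 2),
      eisq |2 * Real.cos α - k| ≤ eisq (1 / 2) * (eisq |α - κ| + eisq |α - -κ|) := by
  have hpi := Real.pi_pos
  obtain ⟨hk0, hk1⟩ := hk
  have hκ1 : Real.arccos (k / 2) ≤ Real.pi / 2 := Real.arccos_le_pi_div_two.2 (by linarith)
  have hκ0 : Real.pi / 3 ≤ Real.arccos (k / 2) := by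
    have : Real.arccos (1 / 2) = Real.pi / 3 := by
      rw [← Real.cos_pi_div_three, Real.arccos_cos (by positivity) (by linarith)]
    rw [← this]
    exact Real.antitone_arccos (by linarith)
  set κ := Real.arccos (k / 2) with hκ
  have hc : k = 2 * Real.cos κ := by
    rw [hκ, Real.cos_arccos (by linarith) (by linarith)]; ring
  refine ⟨κ, by rw [abs_of_nonneg (by linarith)]; exact hκ1, fun α hα => ?_⟩
  rw [hc, ← Real.cos_abs α, mul_add]
  have hd := half_dist_le_cos_sub (a := |α|) ⟨abs_nonneg _, abs_le.2 ⟨hα.1.le, hα.2⟩⟩ ⟨hκ0, hκ1⟩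
  have key : eisq |2 * Real.cos |α| - 2 * Real.cos κ| ≤ eisq (1 / 2) * eisq |(|α| - κ)| := by
    rw [← eisq_mul (by norm_num), one_div_mul_eq_div]
    rcases (abs_nonneg (|α| - κ)).eq_or_lt with h | h
    · have : |α| = κ := by linarith [abs_eq_zero.1 h.symm]
      rw [this]; simp
    · exact eisq_anti (by positivity) hd
  refine key.trans ?_
  rcases abs_cases α with h | h
  · rw [h.1]; exact le_self_add
  · rw [h.1, show |(-α - κ)| = |α - -κ| by rw [← abs_neg]; ring_nf]; exact le_add_self

lemma lintegral_eisq_cos_le {k : ℝ} (hk : k ∈ Icc (0:ℝ) 1) :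
    ∫⁻ α, eisq |2 * Real.cos α - k| ∂mua ≤ eisq (1 / 2) * (isqMass + isqMass) := by
  obtain ⟨κ, h1, h2⟩ := eisq_cos_le hk
  have hm := measurable_eisq
  calc ∫⁻ α, eisq |2 * Real.cos α - k| ∂mua
      ≤ ∫⁻ α, eisq (1 / 2) * (eisq |α - κ| + eisq |α - -κ|) ∂mua :=
        setLIntegral_mono (by fun_prop) h2
    _ = eisq (1 / 2) * (∫⁻ α, eisq |α - κ| ∂mua + ∫⁻ α, eisq |α - -κ| ∂mua) := by
        rw [lintegral_const_mul _ (by fun_prop), lintegral_add_left (by fun_prop)]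
    _ ≤ _ := by
        gcongr
        · exact lintegral_mua_eisq_abs_sub_le h1
        · exact lintegral_mua_eisq_abs_sub_le (by rwa [abs_neg])

lemma eisq_sq_sub_sq_le {u k : ℝ} (hu : 0 ≤ u) (hk : k ≠ 0) :
    eisq |u ^ 2 - k ^ 2| ≤ eisq |k| * eisq (abs (u - |k|)) := by
  have hk' := abs_pos.2 hk
  rw [← eisq_mul hk'.le]
  have e : |u ^ 2 - k ^ 2| = (u + |k|) * abs (u - |k|) := by
    rw [← sq_abs k, sq_sub_sq, abs_mul, abs_of_pos (by linarith)]
  rw [e]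
  rcases (abs_nonneg (u - |k|)).eq_or_lt with h | h
  · rw [← h, mul_zero, mul_zero]
  · exact eisq_anti (by positivity) (by gcongr; linarith)

lemma isq_mul_isq_le_of_le {u v : ℝ} (hu : 0 ≤ u) (h : u ≤ v) :
    isq |(u + v) ^ 2 - 1| * isq |(u - v) ^ 2 - 1| ≤ isq |u ^ 2 - (v - 1) ^ 2| := by
  have e : |(u + v) ^ 2 - 1| * |(u - v) ^ 2 - 1| =
      |u ^ 2 - (v - 1) ^ 2| * ((v + 1) ^ 2 - u ^ 2) := by
    rw [← abs_of_nonneg (show 0 ≤ (v + 1) ^ 2 - u ^ 2 by nlinarith), ← abs_mul, ← abs_mul,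
      ← abs_neg]
    ring_nf
  rw [← isq_mul (abs_nonneg _), e]
  rcases (abs_nonneg (u ^ 2 - (v - 1) ^ 2)).eq_or_lt with h0 | h0
  · rw [← h0, zero_mul]
  · exact isq_anti h0 (le_mul_of_one_le_right h0.le (by nlinarith))

lemma isq_mul_isq_le {u v : ℝ} (hu : 0 ≤ u) (hv : 0 ≤ v) :
    isq |(u + v) ^ 2 - 1| * isq |(u - v) ^ 2 - 1| ≤
      isq |u ^ 2 - (v - 1) ^ 2| + isq |v ^ 2 - (u - 1) ^ 2| := by
  rcases le_total u v with h | h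
  · exact (isq_mul_isq_le_of_le hu h).trans (le_add_of_nonneg_right (isq_nonneg _))
  · have := isq_mul_isq_le_of_le hv h
    rw [add_comm v, ← neg_sub u v, neg_sq] at this
    exact this.trans (le_add_of_nonneg_left (isq_nonneg _))

lemma volume_cos_eq (c : ℝ) : volume {x : ℝ | Real.cos x = c} = 0 := by
  rcases eq_empty_or_nonempty {x : ℝ | Real.cos x = c} with h | ⟨x0, h⟩
  · rw [h]; exact measure_empty
  · refine Countable.measure_zero (Countable.mono (s₂ := range (fun k : ℤ => 2 * k * Real.pi + x0) ∪
      range (fun k : ℤ => 2 * k * Real.pi - x0)) ?_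
      ((countable_range _).union (countable_range _))) _
    intro x hx
    have hx' : Real.cos x0 = Real.cos x := Eq.trans h (Eq.symm hx)
    obtain ⟨k, hk | hk⟩ := Real.cos_eq_cos_iff.1 hx'
    · exact Or.inl ⟨k, hk.symm⟩
    · exact Or.inr ⟨k, hk.symm⟩

lemma ae_mua_cos_ne (c : ℝ) : ∀ᵐ x ∂mua, Real.cos x ≠ c := by
  refine ae_restrict_of_ae ?_
  rw [ae_iff]
  simpa using volume_cos_eq c

lemma ae_mua_prod_cos_ne {g : ℝ → ℝ} (hg : Measurable g) :
    ∀ᵐ q ∂(mua.prod mua), Real.cos q.2 ≠ g q.1 := by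
  have hm : MeasurableSet {q : ℝ × ℝ | Real.cos q.2 = g q.1} :=
    measurableSet_eq_fun (by fun_prop) (by fun_prop)
  rw [ae_iff]
  simp only [ne_eq, not_not]
  rw [Measure.measure_prod_null hm]
  refine Filter.Eventually.of_forall fun x => ?_
  have := ae_mua_cos_ne (g x)
  rw [ae_iff] at this
  simpa using this

lemma ae_mua_mem : ∀ᵐ x ∂mua, x ∈ Ioc (-(Real.pi / 2)) (Real.pi / 2) :=
  ae_restrict_mem measurableSet_Ioc

lemma ae_mua_prod_mem : ∀ᵐ q ∂(mua.prod mua), 0 ≤ Real.cos q.1 ∧ 0 ≤ Real.cos q.2 := by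
  have h : ∀ᵐ x ∂mua, 0 ≤ Real.cos x := ae_mua_mem.mono fun x hx =>
    Real.cos_nonneg_of_mem_Icc ⟨hx.1.le, hx.2⟩
  exact (Measure.quasiMeasurePreserving_fst.ae h).and (Measure.quasiMeasurePreserving_snd.ae h)

lemma ae_mua_prod_ne_one : ∀ᵐ q ∂(mua.prod mua),
    (2 * Real.cos q.1 + 2 * Real.cos q.2) ^ 2 ≠ 1 ∧
    (2 * Real.cos q.1 - 2 * Real.cos q.2) ^ 2 ≠ 1 := by
  filter_upwards [ae_mua_prod_cos_ne (g := fun x => 1 / 2 - Real.cos x) (by fun_prop),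
    ae_mua_prod_cos_ne (g := fun x => -1 / 2 - Real.cos x) (by fun_prop),
    ae_mua_prod_cos_ne (g := fun x => Real.cos x - 1 / 2) (by fun_prop),
    ae_mua_prod_cos_ne (g := fun x => Real.cos x + 1 / 2) (by fun_prop)] with q h1 h2 h3 h4
  constructor
  · intro h
    rcases sq_eq_one_iff.1 h with h | h
    · exact h1 (by linarith)
    · exact h2 (by linarith)
  · intro h
    rcases sq_eq_one_iff.1 h with h | h
    · exact h3 (by linarith)
    · exact h4 (by linarith)

/-- Integrable majorant for the averaged kernels. -/
noncomputable def cosMaj (q : ℝ × ℝ) : ℝ :=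
  isq |(2 * Real.cos q.1) ^ 2 - (2 * Real.cos q.2 - 1) ^ 2| +
    isq |(2 * Real.cos q.2) ^ 2 - (2 * Real.cos q.1 - 1) ^ 2|

lemma lintegral_cosMaj_lt_top :
    ∫⁻ β, ∫⁻ α, eisq |(2 * Real.cos α) ^ 2 - (2 * Real.cos β - 1) ^ 2| ∂mua ∂mua < ⊤ := by
  have hm := measurable_eisq
  have hC : eisq (1 / 2) * (isqMass + isqMass) < ⊤ :=
    ENNReal.mul_lt_top ENNReal.ofReal_lt_top (ENNReal.add_lt_top.2 ⟨isqMass_lt_top, isqMass_lt_top⟩)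
  have h : ∀ᵐ β ∂mua, ∫⁻ α, eisq |(2 * Real.cos α) ^ 2 - (2 * Real.cos β - 1) ^ 2| ∂mua ≤
      eisq |2 * Real.cos β - 1| * (eisq (1 / 2) * (isqMass + isqMass)) := by
    filter_upwards [ae_mua_mem, ae_mua_cos_ne (1 / 2)] with β hβ hne
    have hc := Real.cos_nonneg_of_mem_Icc ⟨hβ.1.le, hβ.2⟩
    have hc1 := Real.cos_le_one β
    have hk : 2 * Real.cos β - 1 ≠ 0 := fun h => hne (by linarith)
    calc ∫⁻ α, eisq |(2 * Real.cos α) ^ 2 - (2 * Real.cos β - 1) ^ 2| ∂mua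
        ≤ ∫⁻ α, eisq |2 * Real.cos β - 1| * eisq (abs (2 * Real.cos α - |2 * Real.cos β - 1|)) ∂mua := by
          refine setLIntegral_mono (by fun_prop) fun α hα => ?_
          have := Real.cos_nonneg_of_mem_Icc ⟨hα.1.le, hα.2⟩
          exact eisq_sq_sub_sq_le (by positivity) hk
      _ ≤ _ := by
          rw [lintegral_const_mul _ (by fun_prop)]
          gcongr
          exact lintegral_eisq_cos_le ⟨abs_nonneg _, abs_le.2 ⟨by linarith, by linarith⟩⟩
  refine (lintegral_mono_ae h).trans_lt ?_
  rw [lintegral_mul_const _ (by fun_prop)]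
  exact ENNReal.mul_lt_top ((lintegral_eisq_cos_le ⟨zero_le_one, le_rfl⟩).trans_lt hC) hC

lemma measurable_isq_cos : Measurable fun q : ℝ × ℝ =>
    isq |(2 * Real.cos q.1) ^ 2 - (2 * Real.cos q.2 - 1) ^ 2| :=
  measurable_isq.comp (by fun_prop)

lemma integrable_cosMaj : Integrable cosMaj (mua.prod mua) := by
  have hm := measurable_eisq
  have hm' := measurable_isq
  have h1 : Integrable (fun q : ℝ × ℝ =>
      isq |(2 * Real.cos q.1) ^ 2 - (2 * Real.cos q.2 - 1) ^ 2|) (mua.prod mua) := by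
    refine ⟨measurable_isq_cos.aestronglyMeasurable, ?_⟩
    rw [hasFiniteIntegral_iff_ofReal (Filter.Eventually.of_forall fun q => isq_nonneg _),
      lintegral_prod_symm' _ (measurable_isq_cos.ennreal_ofReal)]
    exact lintegral_cosMaj_lt_top
  exact h1.add h1.swap

lemma measurable_bE : Measurable fun q : ℂ × ℂ => bE q.1 q.2 := by
  unfold bE csq
  fun_prop

lemma isq_abs_le_cosMaj {q : ℝ × ℝ} (h : 0 ≤ Real.cos q.1 ∧ 0 ≤ Real.cos q.2) :
    isq |(2 * Real.cos q.1 + 2 * Real.cos q.2) ^ 2 - 1| *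
      isq |(2 * Real.cos q.1 - 2 * Real.cos q.2) ^ 2 - 1| ≤ cosMaj q :=
  isq_mul_isq_le (by linarith [h.1]) (by linarith [h.2])

/-- The averaged kernel as a function of the angles. -/
noncomputable def avgE (p : ℂ) (q : ℝ × ℝ) : ℂ :=
  Real.pi ^ 2 * bE (p + ((2 * Real.cos q.1 + 2 * Real.cos q.2) ^ 2 : ℝ))
    (p + ((2 * Real.cos q.1 - 2 * Real.cos q.2) ^ 2 : ℝ))

lemma measurable_avgE (p : ℂ) : Measurable (avgE p) :=
  (measurable_bE.comp (by fun_prop : Measurable fun q : ℝ × ℝ =>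
    (p + ((2 * Real.cos q.1 + 2 * Real.cos q.2) ^ 2 : ℝ),
    p + ((2 * Real.cos q.1 - 2 * Real.cos q.2) ^ 2 : ℝ)))).const_mul _

lemma ae_norm_avgE_le (η : ℝ) :
    ∀ᵐ q ∂(mua.prod mua), ‖avgE (pdir η ^ 2) q‖ ≤ Real.pi ^ 2 * cosMaj q := by
  filter_upwards [ae_mua_prod_mem, ae_mua_prod_ne_one] with q h1 h2
  rw [avgE, norm_mul, norm_pow, Complex.norm_real, Real.norm_of_nonneg Real.pi_pos.le]
  gcongr
  exact (norm_bE_le η (sq_nonneg _) (sq_nonneg _) h2.1 h2.2).trans (isq_abs_le_cosMaj h1)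

lemma tendsto_integral_avgE :
    Filter.Tendsto (fun η => ∫ q, avgE (pdir η ^ 2) q ∂(mua.prod mua)) (nhdsWithin 0 (Ioi 0))
      (nhds (∫ q, avgE (pdir 0 ^ 2) q ∂(mua.prod mua))) := by
  refine tendsto_integral_filter_of_dominated_convergence (fun q => Real.pi ^ 2 * cosMaj q)
    (Filter.Eventually.of_forall fun η => (measurable_avgE _).aestronglyMeasurable)
    (Filter.Eventually.of_forall fun η => ae_norm_avgE_le η) (integrable_cosMaj.const_mul _) ?_
  filter_upwards [ae_mua_prod_ne_one] with q h
  have := (tendsto_bE h.1 h.2).const_mul (Real.pi ^ 2 : ℂ)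
  have e : avgE (pdir 0 ^ 2) q = Real.pi ^ 2 *
      bE (((2 * Real.cos q.1 + 2 * Real.cos q.2) ^ 2 - 1 : ℝ) : ℂ)
        (((2 * Real.cos q.1 - 2 * Real.cos q.2) ^ 2 - 1 : ℝ) : ℂ) := by
    rw [avgE, pdir_zero, Complex.I_sq]
    push_cast
    ring_nf
  rw [e]
  exact this

/-- The real density obtained in the limit. -/
noncomputable def mixQ (x y : ℝ) : ℝ :=
  -((4 * (1 + Real.cos x) * (1 + Real.cos y) - 1) * (4 * (1 - Real.cos x) * (1 - Real.cos y) - 1))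

lemma mixQ_add_sub (a b : ℝ) : mixQ (a + b) (a - b) =
    -(((2 * Real.cos a + 2 * Real.cos b) ^ 2 - 1) * ((2 * Real.cos a - 2 * Real.cos b) ^ 2 - 1)) := by
  have h1 := Real.sin_sq_add_cos_sq a
  have h2 := Real.sin_sq_add_cos_sq b
  have e1 : (1 + Real.cos (a + b)) * (1 + Real.cos (a - b)) = (Real.cos a + Real.cos b) ^ 2 := by
    rw [Real.cos_add, Real.cos_sub]
    linear_combination (-Real.sin b ^ 2) * h1 + (Real.cos a ^ 2 - 1) * h2
  have e2 : (1 - Real.cos (a + b)) * (1 - Real.cos (a - b)) = (Real.cos a - Real.cos b) ^ 2 := by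
    rw [Real.cos_add, Real.cos_sub]
    linear_combination (-Real.sin b ^ 2) * h1 + (Real.cos a ^ 2 - 1) * h2
  rw [mixQ, mul_assoc 4, mul_assoc 4, e1, e2]
  ring

lemma neg_im_avgE {q : ℝ × ℝ} (h : (2 * Real.cos q.1 + 2 * Real.cos q.2) ^ 2 ≠ 1 ∧
    (2 * Real.cos q.1 - 2 * Real.cos q.2) ^ 2 ≠ 1) :
    -(avgE (pdir 0 ^ 2) q).im = Real.pi ^ 2 * isq (mixQ (q.1 + q.2) (q.1 - q.2)) := by
  have := bE_ofReal_im (sub_ne_zero.2 h.1) (sub_ne_zero.2 h.2)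
  rw [mixQ_add_sub, ← this, avgE, pdir_zero, Complex.I_sq, ← Complex.ofReal_pow,
    Complex.im_ofReal_mul, mul_neg]
  push_cast
  ring_nf

lemma integral_rJ_pow_eq : ∫ y in Ioi (0:ℝ), y * rJ y ^ 5 / 2 =
    ∫ q : ℝ × ℝ, Real.pi ^ 2 * isq (mixQ (q.1 + q.2) (q.1 - q.2)) ∂(mua.prod mua) := by
  have h1 := ((Complex.continuous_im.tendsto _).comp tendsto_integral_avgE).neg
  have hfi : Integrable (avgE (pdir 0 ^ 2)) (mua.prod mua) :=
    (integrable_cosMaj.const_mul _).mono' (measurable_avgE _).aestronglyMeasurable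
      (ae_norm_avgE_le 0)
  have e : -(∫ q, avgE (pdir 0 ^ 2) q ∂(mua.prod mua)).im =
      ∫ q : ℝ × ℝ, Real.pi ^ 2 * isq (mixQ (q.1 + q.2) (q.1 - q.2)) ∂(mua.prod mua) := by
    rw [integral_congr_ae (ae_mua_prod_ne_one.mono fun q hq => (neg_im_avgE hq).symm),
      integral_neg]
    congr 1
    exact (integral_im hfi).symm
  rw [e] at h1
  refine tendsto_nhds_unique tendsto_integral_rJ_pow_mul_bK (h1.congr' ?_)
  filter_upwards [eventually_pdir] with η hη
  simp only [Function.comp_apply]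
  rw [integral_rJ_pow_mul_bK (pdir_re_pos hη) (pdir_sq_im_pos hη)]
  rfl

lemma continuous_mixQ : Continuous fun q : ℝ × ℝ => mixQ q.1 q.2 := by
  unfold mixQ
  fun_prop

lemma ofReal_integral_rJ_pow : ENNReal.ofReal (∫ y in Ioi (0:ℝ), y * rJ y ^ 5 / 2) =
    ENNReal.ofReal (Real.pi ^ 2) * ∫⁻ β, ∫⁻ α, eisq (mixQ (α + β) (α - β)) ∂mua ∂mua := by
  have hm : Measurable fun q : ℝ × ℝ => isq (mixQ (q.1 + q.2) (q.1 - q.2)) :=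
    measurable_isq.comp (continuous_mixQ.comp (by fun_prop :
      Continuous fun q : ℝ × ℝ => (q.1 + q.2, q.1 - q.2))).measurable
  have hfi : Integrable (fun q : ℝ × ℝ => isq (mixQ (q.1 + q.2) (q.1 - q.2)))
      (mua.prod mua) := by
    refine integrable_cosMaj.mono' hm.aestronglyMeasurable ?_
    filter_upwards [ae_mua_prod_mem] with q h
    rw [Real.norm_of_nonneg (isq_nonneg _), mixQ_add_sub]
    refine le_trans ?_ (isq_abs_le_cosMaj h)
    rw [← isq_mul (abs_nonneg _), ← abs_mul]
    rcases le_or_gt (-(((2 * Real.cos q.1 + 2 * Real.cos q.2) ^ 2 - 1) *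
      ((2 * Real.cos q.1 - 2 * Real.cos q.2) ^ 2 - 1))) 0 with h0 | h0
    · rw [isq_of_nonpos h0]; exact isq_nonneg _
    · rw [abs_of_neg (by linarith)]
  rw [integral_rJ_pow_eq, integral_const_mul, ENNReal.ofReal_mul (by positivity),
    ofReal_integral_eq_lintegral_ofReal hfi (Filter.Eventually.of_forall fun _ => isq_nonneg _),
    lintegral_prod_symm' _ hm.ennreal_ofReal]
  rfl

lemma setLIntegral_periodic {g : ℝ → ENNReal} {T : ℝ} (hT : 0 < T) (hg : Function.Periodic g T)
    (a b : ℝ) : ∫⁻ x in Ioc a (a + T), g x = ∫⁻ x in Ioc b (b + T), g x := by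
  refine (isAddFundamentalDomain_Ioc hT a).setLIntegral_eq (isAddFundamentalDomain_Ioc hT b) g ?_
  rintro ⟨_, n, rfl⟩ x
  rw [AddSubgroup.vadd_def, vadd_eq_add, add_comm]
  exact hg.zsmul n x

lemma lintegral_mua_eq {g : ℝ → ENNReal} (hg : Function.Periodic g Real.pi) (a : ℝ) :
    ∫⁻ x, g x ∂mua = ∫⁻ x in Ioc a (a + Real.pi), g x := by
  rw [← setLIntegral_periodic Real.pi_pos hg (-(Real.pi / 2)) a, mua]
  congr 3
  ring

lemma mixQ_add_pi (x y : ℝ) : mixQ (x + Real.pi) (y + Real.pi) = mixQ x y := by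
  simp only [mixQ, Real.cos_add_pi]
  ring

lemma mixQ_add_two_pi (x y : ℝ) : mixQ x (y + 2 * Real.pi) = mixQ x y := by
  simp only [mixQ, Real.cos_add_two_pi]

lemma mixQ_two_arctan {S v : ℝ} (hv : 0 < v) : mixQ S (2 * Real.arctan (√v)) =
    ((1 + v) ^ 2)⁻¹ * (((8*(1+Real.cos S)-1) - v) * (1 - (8*(1-Real.cos S)-1)*v)) := by
  have h0 := (cos_half_pos (two_arctan_mem (√v))).ne'
  have hv' : 1 + v ≠ 0 := by positivity
  have h : Real.cos (2 * Real.arctan (√v)) = (1 - v) / (1 + v) := by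
    rw [cos_eq_tan_half h0, tan_half_two_arctan, Real.sq_sqrt hv.le]
  rw [mixQ, h]
  field_simp
  ring

lemma lintegral_mixQ_eq_fibre (S : ℝ) :
    ∫⁻ B in Ioo 0 Real.pi, eisq (mixQ S B) = fibre S := by
  have hpi := Real.pi_pos
  rw [lintegral_cov (s := Ioi 0) (t := Ioo 0 Real.pi) (fun v => 2 * Real.arctan (√v))
    (fun v => isq v / (1 + v)) (fun B => Real.tan (B / 2) ^ 2) measurableSet_Ioi
    (fun v hv => ?_) (fun v hv => ⟨?_, ?_⟩) (fun v hv => ?_) (fun B hB => ?_) (fun B hB => ?_), fibre]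
  · refine setLIntegral_congr_fun measurableSet_Ioi fun v hv => ?_
    have hv' : 0 < v := hv
    rw [mixQ_two_arctan hv', eisq_mul (by positivity), mul_assoc v, eisq_mul hv'.le, ← mul_assoc]
    congr 1
    rw [eisq, eisq, ← ENNReal.ofReal_mul (abs_nonneg _)]
    congr 1
    rw [abs_of_nonneg (div_nonneg (isq_nonneg _) (by positivity)), isq, isq, Real.sqrt_inv,
      Real.sqrt_sq (by positivity)]
    field_simp
  · have hv' : 0 < v := hv
    have h := ((Real.hasDerivAt_sqrt hv'.ne').arctan).const_mul 2
    refine h.congr_deriv ?_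
    rw [Real.sq_sqrt hv'.le, isq]
    field_simp
  · have := Real.arctan_pos.2 (Real.sqrt_pos.2 hv)
    positivity
  · linarith [Real.arctan_lt_pi_div_two (√v)]
  · have hv' : 0 < v := hv
    rw [mul_div_cancel_left₀ _ two_ne_zero, Real.tan_arctan, Real.sq_sqrt hv'.le]
  · have := Real.tan_pos_of_pos_of_lt_pi_div_two (x := B / 2) (by linarith [hB.1])
      (by linarith [hB.2])
    exact pow_pos this 2
  · have := Real.tan_pos_of_pos_of_lt_pi_div_two (x := B / 2) (by linarith [hB.1])
      (by linarith [hB.2])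
    rw [Real.sqrt_sq this.le, Real.arctan_tan (by linarith [hB.1]) (by linarith [hB.2])]
    ring

lemma fibre_periodic : Function.Periodic fibre Real.pi := by
  intro S
  rw [← lintegral_mixQ_eq_fibre, ← lintegral_mixQ_eq_fibre,
    lintegral_cov (s := Ioo 0 Real.pi) (t := Ioo 0 Real.pi) (fun B => Real.pi - B) (fun _ => -1)
      (fun B => Real.pi - B) measurableSet_Ioo
      (fun x _ => by simpa using (hasDerivAt_id x).const_sub Real.pi)
      (fun x hx => ⟨by linarith [hx.2], by linarith [hx.1]⟩) (by simp)
      (fun x hx => ⟨by linarith [hx.2], by linarith [hx.1]⟩) (by simp)]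
  refine lintegral_congr fun B => ?_
  rw [abs_neg, abs_one, ENNReal.ofReal_one, one_mul]
  congr 1
  simp only [mixQ, Real.cos_add_pi, Real.cos_pi_sub]
  ring

lemma lintegral_mixQ_sub (S : ℝ) :
    ∫⁻ β, eisq (mixQ S (S - 2 * β)) ∂mua = fibre S := by
  have hpi := Real.pi_pos
  have hm := measurable_eisq
  have hmix : Measurable fun B => mixQ S B :=
    (continuous_mixQ.comp (by fun_prop : Continuous fun B : ℝ => (S, B))).measurable
  have h2 : (2:ENNReal) * ∫⁻ β, eisq (mixQ S (S - 2 * β)) ∂mua =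
      ∫⁻ B in Ioo (-Real.pi) Real.pi, eisq (mixQ S B) := by
    rw [setLIntegral_congr Ioo_ae_eq_Ioc]
    have hp := setLIntegral_periodic (g := fun B => eisq (mixQ S B)) Real.two_pi_pos
      (fun B => by simp only [mixQ_add_two_pi]) (-Real.pi) (S - Real.pi)
    rw [show -Real.pi + 2 * Real.pi = Real.pi by ring] at hp
    rw [hp, setLIntegral_congr Ioo_ae_eq_Ioc.symm,
      lintegral_cov (s := Ioo (-(Real.pi / 2)) (Real.pi / 2))
      (t := Ioo (S - Real.pi) (S - Real.pi + 2 * Real.pi)) (fun β => S - 2 * β) (fun _ => -2)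
      (fun B => (S - B) / 2) measurableSet_Ioo
      (fun x _ => by simpa using ((hasDerivAt_id x).const_mul 2).const_sub S)
      (fun x hx => ⟨by linarith [hx.2], by linarith [hx.1]⟩) (fun x _ => by ring)
      (fun x hx => ⟨by linarith [hx.2], by linarith [hx.1]⟩) (fun x _ => by ring),
      lintegral_const_mul' _ _ (by simp), mua, setLIntegral_congr Ioo_ae_eq_Ioc]
    simp
  have h3 : ∫⁻ B in Ioo (-Real.pi) Real.pi, eisq (mixQ S B) = 2 * fibre S := by
    rw [← lintegral_mixQ_eq_fibre]
    have h := lintegral_even (f := (Ioo (-Real.pi) Real.pi).indicator fun B => eisq (mixQ S B))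
      (fun B => by
        have : -B ∈ Ioo (-Real.pi) Real.pi ↔ B ∈ Ioo (-Real.pi) Real.pi := by
          simp only [mem_Ioo]
          constructor <;> intro h <;> constructor <;> linarith [h.1, h.2]
        by_cases hB : B ∈ Ioo (-Real.pi) Real.pi
        · simp only [indicator_of_mem hB, indicator_of_mem (this.2 hB), mixQ, Real.cos_neg]
        · rw [indicator_of_notMem hB, indicator_of_notMem (mt this.1 hB)])
    rw [lintegral_indicator measurableSet_Ioo, setLIntegral_indicator measurableSet_Ioo] at h
    rw [h]
    congr 3
    ext B
    simp only [mem_inter_iff, mem_Ioo, mem_Ioi]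
    constructor
    · rintro ⟨⟨_, h⟩, h'⟩; exact ⟨h', h⟩
    · rintro ⟨h, h'⟩; exact ⟨⟨by linarith, h'⟩, h⟩
  rw [h3] at h2
  exact (ENNReal.mul_right_inj two_ne_zero (by simp)).1 h2

lemma lintegral_mua_mixQ : ∫⁻ β, ∫⁻ α, eisq (mixQ (α + β) (α - β)) ∂mua ∂mua =
    ∫⁻ A in Ioo 0 Real.pi, fibre A := by
  have hpi := Real.pi_pos
  have hm := measurable_eisq
  have hmix : Measurable fun q : ℝ × ℝ => mixQ q.2 (q.2 - 2 * q.1) :=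
    (continuous_mixQ.comp (by fun_prop :
      Continuous fun q : ℝ × ℝ => (q.2, q.2 - 2 * q.1))).measurable
  have h1 : ∀ β, ∫⁻ α, eisq (mixQ (α + β) (α - β)) ∂mua =
      ∫⁻ S, eisq (mixQ S (S - 2 * β)) ∂mua := by
    intro β
    rw [lintegral_mua_eq (g := fun S => eisq (mixQ S (S - 2 * β))) (fun S => by
        dsimp only
        rw [add_sub_right_comm, mixQ_add_pi]) (-(Real.pi / 2) + β),
      setLIntegral_congr Ioo_ae_eq_Ioc.symm,
      lintegral_cov (s := Ioo (-(Real.pi / 2)) (Real.pi / 2))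
      (t := Ioo (-(Real.pi / 2) + β) (-(Real.pi / 2) + β + Real.pi)) (fun α => α + β) (fun _ => 1)
      (fun S => S - β) measurableSet_Ioo
      (fun x _ => (hasDerivAt_id x).add_const β)
      (fun x hx => ⟨by linarith [hx.1], by linarith [hx.2]⟩) (fun x _ => by ring)
      (fun x hx => ⟨by linarith [hx.1], by linarith [hx.2]⟩) (fun x _ => by ring),
      mua, setLIntegral_congr Ioo_ae_eq_Ioc.symm]
    refine lintegral_congr fun α => ?_
    rw [abs_one, ENNReal.ofReal_one, one_mul]
    congr 2
    ring
  simp only [h1]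
  rw [lintegral_lintegral_swap (f := fun β S => eisq (mixQ S (S - 2 * β)))
    (hm.comp hmix).aemeasurable]
  simp only [lintegral_mixQ_sub]
  rw [lintegral_mua_eq fibre_periodic 0, zero_add, setLIntegral_congr Ioo_ae_eq_Ioc.symm]

lemma integral_rI_mul_rK_pow : 15 * ∫ r in Ioi (0:ℝ), r * rI r * rK r ^ 4 =
    Real.pi ^ 2 * (Real.pi^2*√15/8*(th3 (√(5/3))^2*th3 (√15)^2)) := by
  have h := ofReal_integral_rJ_pow
  have hpos : 0 ≤ ∫ y in Ioi (0:ℝ), y * rJ y ^ 5 / 2 := by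
    rw [integral_rJ_pow_eq]
    exact integral_nonneg fun q => mul_nonneg (by positivity) (isq_nonneg _)
  rw [lintegral_mua_mixQ, lintegral_fibre_eq, ← ENNReal.ofReal_mul (by positivity)] at h
  rw [integral_rotate]
  exact (ENNReal.ofReal_eq_ofReal_iff hpos (by positivity)).1 h

lemma rI_nonneg (r : ℝ) : 0 ≤ rI r := integral_nonneg fun θ => by positivity

lemma rK_nonneg (r : ℝ) : 0 ≤ rK r :=
  div_nonneg (integral_nonneg fun _ => (Real.exp_pos _).le) two_pos.le

lemma rI_eq_re (r : ℝ) : rI r = (bI r).re := by rw [bI_ofReal, Complex.ofReal_re]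

lemma continuous_rI : Continuous rI := by
  have h : Continuous bI := differentiable_bI.continuous
  rw [funext rI_eq_re]
  exact Complex.continuous_re.comp (h.comp Complex.continuous_ofReal)

lemma abs_rI_le {r : ℝ} (hr : 0 ≤ r) : |rI r| ≤ Real.pi * Real.exp r := by
  have h := norm_bI_le r
  rwa [bI_ofReal, Complex.norm_real, Complex.norm_real, Real.norm_eq_abs,
    Real.norm_of_nonneg hr] at h

/-- The half-line measure. -/
noncomputable def muh : Measure ℝ := volume.restrict (Ioi 0)

instance : SFinite muh := by unfold muh; infer_instance

lemma ae_muh_pos : ∀ᵐ x ∂muh, 0 < x := ae_restrict_mem measurableSet_Ioi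

lemma lintegral_gauss_rI {c : ℝ} (hc : 0 < c) :
    ∫⁻ r, ENNReal.ofReal (r * rI r) * ENNReal.ofReal (Real.exp (-c * r ^ 2)) ∂muh =
      ENNReal.ofReal (Real.pi / (2 * c) * Real.exp (1 / (4 * c))) := by
  have hI := continuous_rI
  have h := integral_mul_exp_bI (l := c) (by simpa using hc) 1
  have e : ∫ r in Ioi (0:ℝ), r * Real.exp (-c * r ^ 2) * rI r =
      Real.pi / (2 * c) * Real.exp (1 / (4 * c)) := by
    apply Complex.ofReal_injective
    rw [← integral_complex_ofReal]
    push_cast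
    rw [one_pow] at h
    rw [← h]
    refine setIntegral_congr_fun measurableSet_Ioi fun y hy => ?_
    rw [one_mul, bI_ofReal]
  have hfi : IntegrableOn (fun r => r * Real.exp (-c * r ^ 2) * rI r) (Ioi 0) := by
    refine ((integrableOn_mul_exp_quadratic hc 1).const_mul Real.pi).mono' (by fun_prop) ?_
    filter_upwards [ae_restrict_mem measurableSet_Ioi] with r hr
    have hr' : 0 < r := hr
    rw [norm_mul, Real.norm_of_nonneg (by positivity), Real.norm_eq_abs, one_mul, Real.exp_add]
    calc r * Real.exp (-c * r ^ 2) * |rI r|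
        ≤ r * Real.exp (-c * r ^ 2) * (Real.pi * Real.exp r) := by
          gcongr
          exact abs_rI_le hr'.le
      _ = _ := by ring
  rw [← e, ofReal_integral_eq_lintegral_ofReal hfi]
  · refine setLIntegral_congr_fun measurableSet_Ioi fun r hr => ?_
    have hr' : 0 < r := hr
    rw [← ENNReal.ofReal_mul (mul_nonneg hr'.le (rI_nonneg r))]
    congr 1
    ring
  · filter_upwards [ae_restrict_mem measurableSet_Ioi] with r hr
    have hr' : 0 < r := hr
    have := rI_nonneg r
    positivity

lemma lintegral_exp_neg {c : ℝ} (hc : 0 < c) :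
    ∫⁻ s, ENNReal.ofReal (Real.exp (-c * s)) ∂muh = ENNReal.ofReal c⁻¹ := by
  have h := integral_exp_mul_Ioi (a := -c) (by linarith) 0
  rw [mul_zero, Real.exp_zero, neg_div_neg_eq, one_div] at h
  rw [← h, ofReal_integral_eq_lintegral_ofReal (integrableOn_exp_mul_Ioi (by linarith) 0)
    (Filter.Eventually.of_forall fun _ => (Real.exp_pos _).le)]
  rfl

lemma lintegral_muh_scale {t : ℝ} (ht : 0 < t) (F : ℝ → ENNReal) :
    ∫⁻ x, F x * ENNReal.ofReal x⁻¹ ∂muh = ∫⁻ x, F (t * x) * ENNReal.ofReal x⁻¹ ∂muh := by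
  rw [muh, lintegral_cov (s := Ioi 0) (t := Ioi 0) (fun x => t * x) (fun _ => t) (fun x => x / t)
    measurableSet_Ioi (fun x _ => by simpa using (hasDerivAt_id x).const_mul t)
    (fun x hx => mul_pos ht hx) (fun x _ => by field_simp)
    (fun x hx => div_pos hx ht) (fun x _ => by field_simp)]
  refine lintegral_congr fun x => ?_
  rw [mul_left_comm, ← ENNReal.ofReal_mul (abs_nonneg _), abs_of_pos ht, mul_inv,
    mul_inv_cancel_left₀ ht.ne']

lemma lintegral_rK {r t : ℝ} (hr : 0 < r) (ht : 0 < t) :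
    ∫⁻ x, ENNReal.ofReal (Real.exp (-(r / 2) * (t * x + (t * x)⁻¹))) * ENNReal.ofReal x⁻¹ ∂muh =
      ENNReal.ofReal (2 * rK r) := by
  rw [← lintegral_muh_scale ht fun x => ENNReal.ofReal (Real.exp (-(r / 2) * (x + x⁻¹))), rK,
    mul_div_cancel₀ _ two_ne_zero,
    ofReal_integral_eq_lintegral_ofReal (integrable_exp_neg_mul_cosh hr)
      (Filter.Eventually.of_forall fun _ => (Real.exp_pos _).le), muh,
    lintegral_cov (s := univ) (t := Ioi 0) Real.exp Real.exp Real.log MeasurableSet.univ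
      (fun x _ => Real.hasDerivAt_exp x) (fun x _ => Real.exp_pos x) (fun x _ => Real.log_exp x)
      (fun _ _ => mem_univ _) (fun x hx => Real.exp_log hx), setLIntegral_univ]
  refine lintegral_congr fun u => ?_
  rw [mul_left_comm, ← ENNReal.ofReal_mul (abs_nonneg _), abs_of_pos (Real.exp_pos u),
    mul_inv_cancel₀ (Real.exp_pos u).ne', ENNReal.ofReal_one, mul_one, Real.cosh_eq, Real.exp_neg]
  congr 2
  ring

lemma lintegral_gauss_exp {A B : ℝ} (hB : 0 < B) (hAB : 1 < A * B) :
    ∫⁻ r, ENNReal.ofReal (r * rI r) * ∫⁻ a, ENNReal.ofReal (Real.exp (-(r / 2) * (a * A + a⁻¹ * B))) *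
      ENNReal.ofReal a⁻¹ ∂muh ∂muh = ENNReal.ofReal (2 * Real.pi / (A * B - 1)) := by
  have hI := continuous_rI
  have h1 : ∀ r, 0 < r → ∫⁻ a, ENNReal.ofReal (Real.exp (-(r / 2) * (a * A + a⁻¹ * B))) *
      ENNReal.ofReal a⁻¹ ∂muh = ∫⁻ s, ENNReal.ofReal (Real.exp (-(B / (2 * s)) * r ^ 2)) *
        (ENNReal.ofReal (Real.exp (-(A / 2) * s)) * ENNReal.ofReal s⁻¹) ∂muh := by
    intro r hr
    rw [lintegral_muh_scale (inv_pos.2 hr)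
      fun a => ENNReal.ofReal (Real.exp (-(r / 2) * (a * A + a⁻¹ * B)))]
    refine setLIntegral_congr_fun measurableSet_Ioi fun s hs => ?_
    have hs' : s ≠ 0 := (mem_Ioi.1 hs).ne'
    rw [← mul_assoc]
    congr 1
    rw [← ENNReal.ofReal_mul (Real.exp_pos _).le, ← Real.exp_add]
    congr 2
    field_simp
    ring
  have h2 : ∫⁻ r, ENNReal.ofReal (r * rI r) * ∫⁻ a,
      ENNReal.ofReal (Real.exp (-(r / 2) * (a * A + a⁻¹ * B))) * ENNReal.ofReal a⁻¹ ∂muh ∂muh =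
      ∫⁻ r, ∫⁻ s, ENNReal.ofReal (r * rI r) * (ENNReal.ofReal (Real.exp (-(B / (2 * s)) * r ^ 2)) *
        (ENNReal.ofReal (Real.exp (-(A / 2) * s)) * ENNReal.ofReal s⁻¹)) ∂muh ∂muh := by
    refine lintegral_congr_ae (ae_muh_pos.mono fun r hr => ?_)
    dsimp only
    rw [h1 r hr, lintegral_const_mul _ (by fun_prop)]
  rw [h2, lintegral_lintegral_swap (by fun_prop)]
  have hc : 0 < A / 2 - 1 / (2 * B) := by
    rw [div_sub_div _ _ two_ne_zero (by positivity)]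
    apply div_pos <;> nlinarith
  have h3 : ∀ s, 0 < s → ∫⁻ r, ENNReal.ofReal (r * rI r) *
      (ENNReal.ofReal (Real.exp (-(B / (2 * s)) * r ^ 2)) *
        (ENNReal.ofReal (Real.exp (-(A / 2) * s)) * ENNReal.ofReal s⁻¹)) ∂muh =
      ENNReal.ofReal (Real.pi / B) * ENNReal.ofReal (Real.exp (-(A / 2 - 1 / (2 * B)) * s)) := by
    intro s hs
    simp only [← mul_assoc]
    rw [lintegral_mul_const _ (by fun_prop), lintegral_mul_const _ (by fun_prop),
      lintegral_gauss_rI (by positivity), ← ENNReal.ofReal_mul (by positivity),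
      ← ENNReal.ofReal_mul (by positivity), ← ENNReal.ofReal_mul (by positivity)]
    congr 1
    have e : Real.exp (-(A / 2 - 1 / (2 * B)) * s) =
        Real.exp (1 / (4 * (B / (2 * s)))) * Real.exp (-(A / 2) * s) := by
      rw [← Real.exp_add]
      congr 1
      field_simp
      ring
    rw [e]
    field_simp
  rw [lintegral_congr_ae (ae_muh_pos.mono fun s hs => h3 s hs), lintegral_const_mul _ (by fun_prop),
    lintegral_exp_neg hc, ← ENNReal.ofReal_mul (by positivity)]
  congr 1
  have : A * B - 1 ≠ 0 := by linarith
  have e : A / 2 - 1 / (2 * B) = (A * B - 1) / (2 * B) := by field_simp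
  rw [e, inv_div]
  field_simp

/-- The sum of the edge variables. -/
def sunA (p : ℝ × ℝ × ℝ) : ℝ := 1 + p.1 + p.2.1 + p.2.2

/-- The sum of the inverse edge variables. -/
noncomputable def sunB (p : ℝ × ℝ × ℝ) : ℝ := 1 + p.1⁻¹ + p.2.1⁻¹ + p.2.2⁻¹

/-- The scale-invariant density. -/
noncomputable def sunW (p : ℝ × ℝ × ℝ) : ENNReal :=
  ENNReal.ofReal p.1⁻¹ * (ENNReal.ofReal p.2.1⁻¹ * ENNReal.ofReal p.2.2⁻¹)

lemma measurable_sunA : Measurable sunA := by unfold sunA; fun_prop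

lemma measurable_sunB : Measurable sunB := by unfold sunB; fun_prop

lemma measurable_sunW : Measurable sunW := by unfold sunW; fun_prop

/-- The measure on the positive octant. -/
noncomputable def muo : Measure (ℝ × ℝ × ℝ) := muh.prod (muh.prod muh)

instance : SFinite muo := by unfold muo; infer_instance

lemma lintegral_muo_exp {r a : ℝ} (hr : 0 < r) (ha : 0 < a) :
    ∫⁻ p, ENNReal.ofReal (Real.exp (-(r / 2) * (a * sunA p + a⁻¹ * sunB p))) * sunW p ∂muo =
      ENNReal.ofReal (Real.exp (-(r / 2) * (a + a⁻¹))) * ENNReal.ofReal (2 * rK r) ^ 3 := by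
  set F : ℝ → ENNReal := fun x =>
    ENNReal.ofReal (Real.exp (-(r / 2) * (a * x + (a * x)⁻¹))) * ENNReal.ofReal x⁻¹ with hF
  have hFm : Measurable F := by fun_prop
  have e : ∀ p, ENNReal.ofReal (Real.exp (-(r / 2) * (a * sunA p + a⁻¹ * sunB p))) * sunW p =
      ENNReal.ofReal (Real.exp (-(r / 2) * (a + a⁻¹))) * (F p.1 * (F p.2.1 * F p.2.2)) := by
    intro p
    have e1 : Real.exp (-(r / 2) * (a * sunA p + a⁻¹ * sunB p)) =
        Real.exp (-(r / 2) * (a + a⁻¹)) * (Real.exp (-(r / 2) * (a * p.1 + (a * p.1)⁻¹)) *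
          (Real.exp (-(r / 2) * (a * p.2.1 + (a * p.2.1)⁻¹)) *
            Real.exp (-(r / 2) * (a * p.2.2 + (a * p.2.2)⁻¹)))) := by
      rw [← Real.exp_add, ← Real.exp_add, ← Real.exp_add, sunA, sunB, mul_inv, mul_inv, mul_inv]
      congr 1
      ring
    rw [e1, ENNReal.ofReal_mul (Real.exp_pos _).le, ENNReal.ofReal_mul (Real.exp_pos _).le,
      ENNReal.ofReal_mul (Real.exp_pos _).le, sunW]
    ring
  simp only [e]
  rw [lintegral_const_mul _ (by fun_prop), muo,
    lintegral_prod_mul (f := F) (g := fun p : ℝ × ℝ => F p.1 * F p.2) hFm.aemeasurable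
      (by fun_prop), lintegral_prod_mul hFm.aemeasurable hFm.aemeasurable]
  have h := lintegral_rK hr ha
  rw [hF, h]
  ring

lemma lintegral_rK_pow {r : ℝ} (hr : 0 < r) :
    ∫⁻ a, ∫⁻ p, ENNReal.ofReal (Real.exp (-(r / 2) * (a * sunA p + a⁻¹ * sunB p))) *
      ENNReal.ofReal a⁻¹ * sunW p ∂muo ∂muh = ENNReal.ofReal (2 * rK r) ^ 4 := by
  have h : ∀ a, 0 < a → ∫⁻ p, ENNReal.ofReal (Real.exp (-(r / 2) * (a * sunA p + a⁻¹ * sunB p))) *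
      ENNReal.ofReal a⁻¹ * sunW p ∂muo =
      ENNReal.ofReal (Real.exp (-(r / 2) * (1 * a + (1 * a)⁻¹))) * ENNReal.ofReal a⁻¹ *
        ENNReal.ofReal (2 * rK r) ^ 3 := by
    intro a ha
    have hA := measurable_sunA
    have hB := measurable_sunB
    have hW := measurable_sunW
    simp only [mul_right_comm _ (ENNReal.ofReal a⁻¹)]
    rw [lintegral_mul_const _ (by fun_prop), lintegral_muo_exp hr ha, one_mul]
  rw [lintegral_congr_ae (ae_muh_pos.mono h), lintegral_mul_const _ (by fun_prop),
    lintegral_rK hr one_pos]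
  ring

lemma one_lt_sunA_mul_sunB {p : ℝ × ℝ × ℝ} (h : 0 < p.1 ∧ 0 < p.2.1 ∧ 0 < p.2.2) :
    1 < sunA p * sunB p := by
  obtain ⟨h1, h2, h3⟩ := h
  have hA : 1 < sunA p := by unfold sunA; linarith
  have hB : 1 < sunB p := by
    have := inv_pos.2 h1
    have := inv_pos.2 h2
    have := inv_pos.2 h3
    unfold sunB; linarith
  nlinarith

lemma sunB_pos {p : ℝ × ℝ × ℝ} (h : 0 < p.1 ∧ 0 < p.2.1 ∧ 0 < p.2.2) : 0 < sunB p := by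
  obtain ⟨h1, h2, h3⟩ := h
  unfold sunB; positivity

lemma muo_eq : muo = volume.restrict (Ioi (0:ℝ) ×ˢ (Ioi (0:ℝ) ×ˢ Ioi (0:ℝ))) := by
  rw [muo, muh, Measure.prod_restrict, Measure.prod_restrict]
  rfl

lemma ae_muo_pos : ∀ᵐ p ∂muo, 0 < p.1 ∧ 0 < p.2.1 ∧ 0 < p.2.2 := by
  rw [muo_eq]
  exact ae_restrict_mem (measurableSet_Ioi.prod (measurableSet_Ioi.prod measurableSet_Ioi))

lemma lintegral_sunrise : ∫⁻ p, ENNReal.ofReal (2 * Real.pi / (sunA p * sunB p - 1)) * sunW p ∂muo =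
    ∫⁻ r, ENNReal.ofReal (r * rI r) * ENNReal.ofReal (2 * rK r) ^ 4 ∂muh := by
  have hA := measurable_sunA
  have hB := measurable_sunB
  have hW := measurable_sunW
  have hI := continuous_rI
  have h1 : ∀ p : ℝ × ℝ × ℝ, 0 < p.1 ∧ 0 < p.2.1 ∧ 0 < p.2.2 →
      ENNReal.ofReal (2 * Real.pi / (sunA p * sunB p - 1)) * sunW p =
      ∫⁻ r, ENNReal.ofReal (r * rI r) * ∫⁻ a,
        ENNReal.ofReal (Real.exp (-(r / 2) * (a * sunA p + a⁻¹ * sunB p))) *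
        ENNReal.ofReal a⁻¹ * sunW p ∂muh ∂muh := by
    intro p hp
    rw [← lintegral_gauss_exp (sunB_pos hp) (one_lt_sunA_mul_sunB hp),
      ← lintegral_mul_const _ (by fun_prop)]
    refine lintegral_congr fun r => ?_
    rw [mul_assoc, ← lintegral_mul_const _ (by fun_prop)]
  rw [lintegral_congr_ae (ae_muo_pos.mono h1), lintegral_lintegral_swap]
  · refine lintegral_congr_ae (ae_muh_pos.mono fun r hr => ?_)
    dsimp only
    rw [lintegral_const_mul _ (by fun_prop), lintegral_lintegral_swap (by fun_prop),
      lintegral_rK_pow hr]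
  · fun_prop

/-- The integrand of the three-banana integral at `t = 1`. -/
noncomputable def sunrise (p : ℝ × ℝ × ℝ) : ℝ :=
  ((1 + p.1 + p.2.1 + p.2.2) * (1 + 1/p.1 + 1/p.2.1 + 1/p.2.2) - 1)⁻¹ / (p.1 * p.2.1 * p.2.2)

lemma sunrise_eq {p : ℝ × ℝ × ℝ} :
    sunrise p = (sunA p * sunB p - 1)⁻¹ * (p.1⁻¹ * (p.2.1⁻¹ * p.2.2⁻¹)) := by
  simp only [sunrise, sunA, sunB, one_mul, div_eq_mul_inv, mul_inv, mul_assoc]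

lemma integral_sunrise : ∫ p, sunrise p ∂muo =
    8 / Real.pi * ∫ r in Ioi (0:ℝ), r * rI r * rK r ^ 4 := by
  have hpi := Real.pi_pos
  have hA := measurable_sunA
  have hB := measurable_sunB
  have hW := measurable_sunW
  have hs : 0 ≤ ∫ r in Ioi (0:ℝ), r * rI r * rK r ^ 4 :=
    setIntegral_nonneg measurableSet_Ioi fun r hr =>
      mul_nonneg (mul_nonneg (le_of_lt hr) (rI_nonneg r)) (pow_nonneg (rK_nonneg r) 4)
  have hm : Measurable sunrise := by unfold sunrise; fun_prop
  have hpos : ∀ᵐ p ∂muo, 0 ≤ sunrise p := ae_muo_pos.mono fun p hp => by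
    have := one_lt_sunA_mul_sunB hp
    obtain ⟨h1, h2, h3⟩ := hp
    rw [sunrise_eq]
    have : 0 < sunA p * sunB p - 1 := by linarith
    positivity
  have h1 : ∫⁻ p, ENNReal.ofReal (2 * Real.pi / (sunA p * sunB p - 1)) * sunW p ∂muo =
      ENNReal.ofReal (2 * Real.pi) * ∫⁻ p, ENNReal.ofReal (sunrise p) ∂muo := by
    rw [← lintegral_const_mul _ hm.ennreal_ofReal]
    refine lintegral_congr_ae (ae_muo_pos.mono fun p hp => ?_)
    have := one_lt_sunA_mul_sunB hp
    have h0 : 0 < sunA p * sunB p - 1 := by linarith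
    obtain ⟨h1, h2, h3⟩ := hp
    dsimp only
    rw [sunW, ← ENNReal.ofReal_mul (by positivity), ← ENNReal.ofReal_mul (by positivity),
      ← ENNReal.ofReal_mul (by positivity), ← ENNReal.ofReal_mul (by positivity), sunrise_eq,
      div_eq_mul_inv, mul_assoc]
  have h2 : ∫⁻ r, ENNReal.ofReal (r * rI r) * ENNReal.ofReal (2 * rK r) ^ 4 ∂muh =
      ENNReal.ofReal (16 * ∫ r in Ioi (0:ℝ), r * rI r * rK r ^ 4) := by
    rw [← integral_const_mul, ofReal_integral_eq_lintegral_ofReal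
      (integrableOn_rI_mul_rK_pow.const_mul 16)]
    · refine setLIntegral_congr_fun measurableSet_Ioi fun r hr => ?_
      have hr' : 0 < r := hr
      have := rI_nonneg r
      have := rK_nonneg r
      rw [← ENNReal.ofReal_pow (by positivity), ← ENNReal.ofReal_mul (by positivity)]
      congr 1
      ring
    · filter_upwards [ae_restrict_mem measurableSet_Ioi] with r hr
      have hr' : 0 < r := hr
      have := rI_nonneg r
      have := rK_nonneg r
      positivity
  have h3 := lintegral_sunrise
  rw [h1, h2] at h3
  have h4 := congrArg ENNReal.toReal h3
  rw [ENNReal.toReal_mul, ENNReal.toReal_ofReal (by positivity),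
    ENNReal.toReal_ofReal (by positivity)] at h4
  rw [integral_eq_lintegral_of_nonneg_ae hpos hm.aestronglyMeasurable]
  field_simp
  linarith

lemma integral_sunrise_eq_theta : ∫ p, sunrise p ∂muo =
    Real.pi ^ 3 / √15 * th3 (√(5/3)) ^ 2 * th3 (√15) ^ 2 := by
  have hpi := Real.pi_pos
  have h := integral_rI_mul_rK_pow
  have h15 : √15 * √15 = 15 := Real.mul_self_sqrt (by norm_num)
  have h0 : 0 < √15 := by positivity
  rw [integral_sunrise, show ∫ r in Ioi (0:ℝ), r * rI r * rK r ^ 4 =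
    Real.pi ^ 2 * (Real.pi^2*√15/8*(th3 (√(5/3))^2*th3 (√15)^2)) / 15 by linarith]
  generalize th3 (√15) = a
  generalize th3 (√(5/3)) = b
  have h1 : (√15)⁻¹ = √15 / 15 := by
    rw [inv_eq_one_div, div_eq_div_iff h0.ne' (by norm_num), h15, one_mul]
  rw [div_eq_mul_inv (Real.pi ^ 3), h1]
  field_simp

end Banana

theorem stmt13 :
    (∫ p in Set.Ioi (0:ℝ) ×ˢ (Set.Ioi (0:ℝ) ×ˢ Set.Ioi (0:ℝ)),
      ((1 + p.1 + p.2.1 + p.2.2) * (1 + 1/p.1 + 1/p.2.1 + 1/p.2.2) - 1)⁻¹ /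
        (p.1 * p.2.1 * p.2.2)) =
    (Real.pi^3 / Real.sqrt 15) *
      (1 + 2 * ∑' n : ℕ, Real.exp (-((n:ℝ)+1)^2 * Real.pi * Real.sqrt (5/3)))^2 *
      (1 + 2 * ∑' n : ℕ, Real.exp (-((n:ℝ)+1)^2 * Real.pi * Real.sqrt 15))^2 := by
  rw [← Banana.th3_eq_nat (Real.sqrt_pos.2 (by norm_num)),
    ← Banana.th3_eq_nat (Real.sqrt_pos.2 (by norm_num)),
    ← Banana.integral_sunrise_eq_theta, Banana.muo_eq]
  rfl
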